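/- Let H be a non-semisimple Hopf algebra of dimension 4p over an algebraically closed field k of characteristic zero, p an odd prime. (i) If H contains a Hopf subalgebra K of dimension 2p, then H is pointed and K is isomorphic to the group algebra of a cyclic group of order 2p. (ii) If H contains a Hopf ideal I of dimension 2p, then H* is pointed and H/I is isomorphic to the group algebra of a cyclic group of order 2p. -/

import Mathlib

open scoped TensorProduct

/-- An element of a coalgebra (with comultiplication `Δ`) is group-like if it is
nonzero and `Δ a = a ⊗ a`. -/
def IsGroupLikeOf {k H : Type} [CommRing k] [AddCommGroup H] [Module k H]
    (Δ : H →ₗ[k] H ⊗[k] H) (a : H) : Prop :=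
  a ≠ 0 ∧ Δ a = a ⊗ₜ[k] a

/-- A `k`-subspace `C` of a coalgebra with comultiplication `Δ` is a subcoalgebra if
`Δ C ⊆ C ⊗ C`. -/
def IsSubcoalgebraOf {k H : Type} [CommRing k] [AddCommGroup H] [Module k H]
    (Δ : H →ₗ[k] H ⊗[k] H) (C : Submodule k H) : Prop :=
  ∀ c ∈ C, Δ c ∈ LinearMap.range (TensorProduct.map C.subtype C.subtype)

/-- A subcoalgebra is simple if it is nonzero and has no proper nonzero subcoalgebras. -/
def IsSimpleSubcoalgebraOf {k H : Type} [CommRing k] [AddCommGroup H] [Module k H]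
    (Δ : H →ₗ[k] H ⊗[k] H) (C : Submodule k H) : Prop :=
  IsSubcoalgebraOf Δ C ∧ C ≠ ⊥ ∧
    ∀ D : Submodule k H, IsSubcoalgebraOf Δ D → D ≤ C → D = ⊥ ∨ D = C

/-- A coalgebra is pointed if every simple subcoalgebra is one-dimensional. -/
def IsPointedOf {k H : Type} [CommRing k] [AddCommGroup H] [Module k H]
    (Δ : H →ₗ[k] H ⊗[k] H) : Prop :=
  ∀ C : Submodule k H, IsSimpleSubcoalgebraOf Δ C → Module.finrank k C = 1

/-- A linear functional on `H` (with multiplication `m` and unit `u`) is a group-like element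
of the dual Hopf algebra `H*` precisely when it is an algebra character. -/
def IsDualGroupLikeOf {k H : Type} [CommRing k] [AddCommGroup H] [Module k H]
    (m : H →ₗ[k] H →ₗ[k] H) (u : H) (φ : Module.Dual k H) : Prop :=
  φ u = 1 ∧ ∀ a b : H, φ (m a b) = φ a * φ b

/-- A subspace `C` of `H* = Dual k H` is a subcoalgebra of the dual Hopf algebra iff the dual
comultiplication (dual to the multiplication `m` of `H`) of every `f ∈ C` lies in `C ⊗ C`,
i.e. `f ∘ m` decomposes as a finite sum `∑ uᵢ ⊗ vᵢ` with `uᵢ, vᵢ ∈ C`. -/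
def IsDualSubcoalgebraOf {k H : Type} [CommRing k] [AddCommGroup H] [Module k H]
    (m : H →ₗ[k] H →ₗ[k] H) (C : Submodule k (Module.Dual k H)) : Prop :=
  ∀ f ∈ C, ∃ (n : ℕ) (u v : Fin n → Module.Dual k H),
    (∀ i, u i ∈ C ∧ v i ∈ C) ∧ ∀ a b : H, f (m a b) = ∑ i, u i a * v i b

/-- A simple subcoalgebra of the dual Hopf algebra. -/
def IsDualSimpleSubcoalgebraOf {k H : Type} [CommRing k] [AddCommGroup H] [Module k H]
    (m : H →ₗ[k] H →ₗ[k] H) (C : Submodule k (Module.Dual k H)) : Prop :=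
  IsDualSubcoalgebraOf m C ∧ C ≠ ⊥ ∧
    ∀ D : Submodule k (Module.Dual k H), IsDualSubcoalgebraOf m D → D ≤ C → D = ⊥ ∨ D = C

/-- The dual Hopf algebra `H*` is pointed iff all its simple subcoalgebras are
one-dimensional. -/
def IsDualPointedOf {k H : Type} [CommRing k] [AddCommGroup H] [Module k H]
    (m : H →ₗ[k] H →ₗ[k] H) : Prop :=
  ∀ C : Submodule k (Module.Dual k H), IsDualSimpleSubcoalgebraOf m C → Module.finrank k C = 1

/-- Convolution product of linear functionals on a coalgebra. -/
noncomputable def convMul {k H : Type} [CommRing k] [AddCommGroup H] [Module k H]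
    [CoalgebraStruct k H] (φ ψ : Module.Dual k H) : Module.Dual k H :=
  LinearMap.mul' k k ∘ₗ TensorProduct.map φ ψ ∘ₗ Coalgebra.comul

/-- Convolution powers of a linear functional on a bialgebra; the zeroth power is the counit. -/
noncomputable def convPow {k H : Type} [CommRing k] [AddCommGroup H] [Module k H]
    [CoalgebraStruct k H] (φ : Module.Dual k H) : ℕ → Module.Dual k H
  | 0 => Coalgebra.counit
  | n + 1 => convMul (convPow φ n) φ

attribute [fun_prop] IsLinearMap
set_option linter.unusedSectionVars false

namespace Hopf

section lin
variable {k : Type*} [Field k] {M N P : Type*} [AddCommGroup M] [Module k M] [AddCommGroup N] [Module k N]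
  [AddCommGroup P] [Module k P]

@[fun_prop] theorem lin_id : IsLinearMap k (fun x : M => x) := ⟨fun _ _ => rfl, fun _ _ => rfl⟩

@[fun_prop] theorem lin_zero : IsLinearMap k (fun _ : M => (0 : N)) :=
  ⟨fun _ _ => (add_zero 0).symm, fun _ _ => (smul_zero _).symm⟩

@[fun_prop] theorem lin_comp {g : N → P} {f : M → N} (hg : IsLinearMap k g) (hf : IsLinearMap k f) :
    IsLinearMap k (fun x => g (f x)) :=
  ⟨fun x y => by rw [hf.map_add, hg.map_add], fun c x => by rw [hf.map_smul, hg.map_smul]⟩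

@[fun_prop] theorem lin_coe (q : N →ₗ[k] P) : IsLinearMap k (fun x => q x) := q.isLinear

@[fun_prop] theorem lin_coe_left {f : M → N →ₗ[k] P} (hf : IsLinearMap k f) (y : N) :
    IsLinearMap k (fun x => f x y) :=
  ⟨fun x z => by rw [hf.map_add]; rfl, fun c x => by rw [hf.map_smul]; rfl⟩

@[fun_prop] theorem lin_add {f g : M → N} (hf : IsLinearMap k f) (hg : IsLinearMap k g) :
    IsLinearMap k (fun x => f x + g x) :=
  ⟨fun x y => by rw [hf.map_add, hg.map_add]; abel, fun c x => by rw [hf.map_smul, hg.map_smul, smul_add]⟩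

@[fun_prop] theorem lin_sub {f g : M → N} (hf : IsLinearMap k f) (hg : IsLinearMap k g) :
    IsLinearMap k (fun x => f x - g x) :=
  ⟨fun x y => by rw [hf.map_add, hg.map_add]; abel, fun c x => by rw [hf.map_smul, hg.map_smul, smul_sub]⟩

@[fun_prop] theorem lin_neg {f : M → N} (hf : IsLinearMap k f) :
    IsLinearMap k (fun x => - f x) :=
  ⟨fun x y => by rw [hf.map_add]; abel, fun c x => by rw [hf.map_smul, smul_neg]⟩

@[fun_prop] theorem lin_smul_left {f : M → k} (hf : IsLinearMap k f) (n : N) :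
    IsLinearMap k (fun x => f x • n) :=
  ⟨fun x y => by rw [hf.map_add, add_smul], fun c x => by rw [hf.map_smul, smul_assoc]⟩

@[fun_prop] theorem lin_smul_right {f : M → N} (hf : IsLinearMap k f) (c : k) :
    IsLinearMap k (fun x => c • f x) :=
  ⟨fun x y => by rw [hf.map_add, smul_add], fun d x => by rw [hf.map_smul, smul_comm]⟩

@[fun_prop] theorem lin_tmul_left {f : M → N} (hf : IsLinearMap k f) (n : P) :
    IsLinearMap k (fun x => f x ⊗ₜ[k] n) :=
  ⟨fun x y => by rw [hf.map_add, TensorProduct.add_tmul],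
   fun c x => by rw [hf.map_smul, TensorProduct.smul_tmul']⟩

@[fun_prop] theorem lin_tmul_right {f : M → N} (hf : IsLinearMap k f) (n : P) :
    IsLinearMap k (fun x => n ⊗ₜ[k] f x) :=
  ⟨fun x y => by rw [hf.map_add, TensorProduct.tmul_add],
   fun c x => by rw [hf.map_smul, TensorProduct.tmul_smul]⟩

@[fun_prop] theorem lin_sum {ι : Type*} (s : Finset ι) {f : ι → M → N} (hf : ∀ i, IsLinearMap k (f i)) :
    IsLinearMap k (fun x => ∑ i ∈ s, f i x) :=
  ⟨fun x y => by simp only [(hf _).map_add, Finset.sum_add_distrib],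
   fun c x => by simp only [(hf _).map_smul, Finset.smul_sum]⟩

variable {A : Type*} [Ring A] [Algebra k A]

@[fun_prop] theorem lin_mul_left {f : M → A} (hf : IsLinearMap k f) (a : A) :
    IsLinearMap k (fun x => f x * a) :=
  ⟨fun x y => by rw [hf.map_add, add_mul], fun c x => by rw [hf.map_smul, smul_mul_assoc]⟩

@[fun_prop] theorem lin_mul_right {f : M → A} (hf : IsLinearMap k f) (a : A) :
    IsLinearMap k (fun x => a * f x) :=
  ⟨fun x y => by rw [hf.map_add, mul_add], fun c x => by rw [hf.map_smul, mul_smul_comm]⟩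

end lin

section sw
variable {k : Type*} [Field k] {C : Type*} [AddCommGroup C] [Module k C] [Coalgebra k C]
  {M N P : Type*} [AddCommGroup M] [Module k M] [AddCommGroup N] [Module k N]
  [AddCommGroup P] [Module k P]

variable (k) in
/-- Sweedler sum: `sw k a f = ∑ f a₁ a₂`, evaluated on a chosen representation of `Δ a`. -/
noncomputable def sw (a : C) (f : C → C → M) : M :=
  ∑ i ∈ (Coalgebra.Repr.arbitrary k a).index,
    f ((Coalgebra.Repr.arbitrary k a).left i) ((Coalgebra.Repr.arbitrary k a).right i)

/-- The bilinear function `f` as a linear map on the tensor square. -/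
noncomputable def bil (f : C → C → M) (h1 : ∀ y, IsLinearMap k (fun x => f x y))
    (h2 : ∀ x, IsLinearMap k (fun y => f x y)) : C ⊗[k] C →ₗ[k] M :=
  TensorProduct.lift (LinearMap.mk₂ k f (fun x x' y => (h1 y).map_add x x') (fun c x y => (h1 y).map_smul c x)
    (fun x y y' => (h2 x).map_add y y') (fun c x y => (h2 x).map_smul c y))

theorem sw_eq_bil (a : C) (f : C → C → M) (h1 : ∀ y, IsLinearMap k (fun x => f x y))
    (h2 : ∀ x, IsLinearMap k (fun y => f x y)) : sw k a f = bil f h1 h2 (Coalgebra.comul a) := by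
  conv_rhs => rw [← (Coalgebra.Repr.arbitrary k a).eq]
  simp [sw, bil]

theorem sw_tmul (a : C) : sw k a (fun x y => x ⊗ₜ[k] y) = Coalgebra.comul a :=
  (Coalgebra.Repr.arbitrary k a).eq

theorem sw_of_comul_eq_tmul {a x y : C} (h : Coalgebra.comul a = x ⊗ₜ[k] y) (f : C → C → M)
    (h1 : ∀ y, IsLinearMap k (fun x => f x y) := by fun_prop)
    (h2 : ∀ x, IsLinearMap k (fun y => f x y) := by fun_prop) :
    sw k a f = f x y := by
  rw [sw_eq_bil a f h1 h2, h]; simp [bil]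

theorem lin_sw (f : C → C → M) (h1 : ∀ y, IsLinearMap k (fun x => f x y))
    (h2 : ∀ x, IsLinearMap k (fun y => f x y)) : IsLinearMap k (fun a => sw k a f) := by
  simp only [sw_eq_bil _ f h1 h2]
  exact ((bil f h1 h2) ∘ₗ Coalgebra.comul).isLinear

@[fun_prop] theorem lin_sw' (f : C → C → M) (h1 : ∀ y, IsLinearMap k (fun x => f x y))
    (h2 : ∀ x, IsLinearMap k (fun y => f x y)) {g : N → C} (hg : IsLinearMap k g) :
    IsLinearMap k (fun a => sw k (g a) f) := lin_comp (g := fun a => sw k a f) (lin_sw f h1 h2) hg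

@[fun_prop] theorem lin_sw_fun (a : C) {f : N → C → C → M} (h : ∀ x y, IsLinearMap k (fun n => f n x y)) :
    IsLinearMap k (fun n => sw k a (f n)) := by
  unfold sw
  exact lin_sum _ (fun i => h _ _)

theorem map_sw (q : M →ₗ[k] N) (a : C) (f : C → C → M) :
    q (sw k a f) = sw k a (fun x y => q (f x y)) := map_sum _ _ _

theorem sw_map {q : M → N} (hq : IsLinearMap k q) (a : C) (f : C → C → M) :
    sw k a (fun x y => q (f x y)) = q (sw k a f) := (map_sw (hq.mk' q) a f).symm

theorem smul_sw (c : k) (a : C) (f : C → C → M) : c • sw k a f = sw k a (fun x y => c • f x y) :=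
  Finset.smul_sum

theorem sw_smul_right (a : C) (f : C → C → k) (m : M) : sw k a (fun x y => f x y • m) = sw k a f • m :=
  Finset.sum_smul.symm

theorem sw_add (a : C) (f g : C → C → M) :
    sw k a (fun x y => f x y + g x y) = sw k a f + sw k a g := Finset.sum_add_distrib

theorem sw_finsum {ι : Type*} (s : Finset ι) (a : C) (f : ι → C → C → M) :
    sw k a (fun x y => ∑ i ∈ s, f i x y) = ∑ i ∈ s, sw k a (f i) := Finset.sum_comm

theorem sw_zero (a : C) : sw k a (fun _ _ => (0 : M)) = 0 := Finset.sum_const_zero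

theorem sw_comm {C' : Type*} [AddCommGroup C'] [Module k C'] [Coalgebra k C'] (a : C) (b : C')
    (f : C → C → C' → C' → M) :
    sw k a (fun x y => sw k b (f x y)) = sw k b (fun u v => sw k a (fun x y => f x y u v)) :=
  Finset.sum_comm

/-- `a₁₁ ⊗ a₁₂ ⊗ a₂ = a₁ ⊗ a₂₁ ⊗ a₂₂`. -/
theorem sw_assoc (a : C) (f : C → C → C → M)
    (h1 : ∀ y z, IsLinearMap k (fun x => f x y z) := by fun_prop)
    (h2 : ∀ x z, IsLinearMap k (fun y => f x y z) := by fun_prop)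
    (h3 : ∀ x y, IsLinearMap k (fun z => f x y z) := by fun_prop) :
    sw k a (fun x z => sw k x (fun u v => f u v z)) = sw k a (fun u y => sw k y (fun v w => f u v w)) := by
  let F : C ⊗[k] (C ⊗[k] C) →ₗ[k] M := TensorProduct.lift (
    { toFun := fun u => bil (f u) (fun z => h2 u z) (fun y => h3 u y)
      map_add' := fun u u' => by ext y z; simpa [bil] using (h1 y z).map_add u u'
      map_smul' := fun c u => by ext y z; simpa [bil] using (h1 y z).map_smul c u })
  have hL : sw k a (fun x z => sw k x (fun u v => f u v z))
      = (F ∘ₗ (TensorProduct.assoc k C C C).toLinearMap ∘ₗ Coalgebra.comul.rTensor C) (Coalgebra.comul a) := by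
    rw [← sw_tmul, map_sw]
    simp only [LinearMap.comp_apply, LinearEquiv.coe_coe, LinearMap.rTensor_tmul]
    congr; ext x z
    rw [← sw_tmul, sw_eq_bil x _ (by fun_prop) (by fun_prop), sw_tmul]
    generalize (Coalgebra.comul x : C ⊗[k] C) = t
    induction t with
    | zero => simp
    | tmul p q => simp [F, bil]
    | add p q hp hq => rw [map_add, hp, hq, TensorProduct.add_tmul]; simp
  have hR : sw k a (fun u y => sw k y (fun v w => f u v w))
      = F (Coalgebra.comul.lTensor C (Coalgebra.comul a)) := by
    rw [← sw_tmul, map_sw, map_sw]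
    congr; ext u y
    rw [sw_eq_bil y _ (by fun_prop) (by fun_prop)]
    simp [F]
  rw [hL, hR, ← Coalgebra.coassoc_apply]; rfl

theorem sw_counit_left (a : C) (f : C → M) (hf : IsLinearMap k f := by fun_prop) :
    sw k a (fun x y => Coalgebra.counit (R := k) x • f y) = f a := by
  have h : sw k a (fun x y => Coalgebra.counit (R := k) x • y) = a :=
    Coalgebra.sum_counit_smul (Coalgebra.Repr.arbitrary k a)
  conv_rhs => rw [← h]
  rw [← sw_map hf]
  simp only [hf.map_smul]

theorem sw_counit_right (a : C) (f : C → M) (hf : IsLinearMap k f := by fun_prop) :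
    sw k a (fun x y => Coalgebra.counit (R := k) y • f x) = f a := by
  have h : sw k a (fun x y => Coalgebra.counit (R := k) y • x) = a := by
    have := congrArg (TensorProduct.rid k C) (Coalgebra.lTensor_counit_comul (R := k) a)
    rw [← sw_tmul, map_sw, TensorProduct.rid_tmul, one_smul] at this
    conv_rhs => rw [← this]
    refine Eq.trans ?_ (map_sw (TensorProduct.rid k C).toLinearMap a _).symm
    simp
  conv_rhs => rw [← h]
  rw [← sw_map hf]
  simp only [hf.map_smul]

end sw
end Hopf

namespace Hopf

section calculus
variable {k : Type*} [Field k] {H : Type*} [Ring H] [HopfAlgebra k H]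
  {M : Type*} [AddCommGroup M] [Module k M]

local notation "ε" => Coalgebra.counit (R := k)
local notation "σ" => HopfAlgebra.antipode k

theorem sw_mul (a b : H) (f : H → H → M)
    (h1 : ∀ y, IsLinearMap k (fun x => f x y) := by fun_prop)
    (h2 : ∀ x, IsLinearMap k (fun y => f x y) := by fun_prop) :
    sw k (a * b) f = sw k a (fun x y => sw k b (fun u v => f (x * u) (y * v))) := by
  rw [sw_eq_bil _ f h1 h2, Bialgebra.comul_mul, ← sw_tmul (k := k) a, ← sw_tmul (k := k) b]
  rw [← sw_map (q := fun t => t * _) (by fun_prop), map_sw]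
  congr; ext x y
  rw [← sw_map (q := fun t => _ * t) (by fun_prop), map_sw]
  simp [bil]

theorem sw_one (f : H → H → M)
    (h1 : ∀ y, IsLinearMap k (fun x => f x y) := by fun_prop)
    (h2 : ∀ x, IsLinearMap k (fun y => f x y) := by fun_prop) : sw k (1 : H) f = f 1 1 :=
  sw_of_comul_eq_tmul (by rw [Bialgebra.comul_one]; rfl) f h1 h2

theorem sw_antipode_mul (a : H) (f : H → M) (hf : IsLinearMap k f := by fun_prop) :
    sw k a (fun x y => f (σ x * y)) = ε a • f 1 := by
  rw [sw_map hf, ← hf.map_smul]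
  congr 1
  exact HopfAlgebra.sum_antipode_mul_eq_smul (Coalgebra.Repr.arbitrary k a)

theorem sw_mul_antipode (a : H) (f : H → M) (hf : IsLinearMap k f := by fun_prop) :
    sw k a (fun x y => f (x * σ y)) = ε a • f 1 := by
  rw [sw_map hf, ← hf.map_smul]
  congr 1
  exact HopfAlgebra.sum_mul_antipode_eq_smul (Coalgebra.Repr.arbitrary k a)

theorem comul_antipode (a : H) : Coalgebra.comul (σ a) = sw k a (fun x y => σ y ⊗ₜ[k] σ x) := by
  have e1 : sw k a (fun u y => sw k y (fun v z => sw k z (fun p q =>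
      (σ v ⊗ₜ[k] σ u) * (Coalgebra.comul (R := k) (p * σ q))))) = sw k a (fun x y => σ y ⊗ₜ[k] σ x) := by
    have : ∀ u v z : H, sw k z (fun p q => (σ v ⊗ₜ[k] σ u) * (Coalgebra.comul (R := k) (p * σ q)))
        = ε z • (σ v ⊗ₜ[k] σ u) := fun u v z => by
      rw [sw_mul_antipode z (fun t => (σ v ⊗ₜ[k] σ u) * (Coalgebra.comul (R := k) t))]
      simp
    simp only [this]
    congr; ext u y
    rw [sw_counit_right y (fun v => σ v ⊗ₜ[k] σ u)]
  have e2 : ∀ b : H, sw k b (fun u y => sw k y (fun v p => (σ v ⊗ₜ[k] σ u) * Coalgebra.comul (R := k) p))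
      = ε b • 1 := fun b => by
    have : ∀ u v p : H, (σ v ⊗ₜ[k] σ u) * Coalgebra.comul (R := k) p =
        sw k p (fun s t => (σ v * s) ⊗ₜ[k] (σ u * t)) := fun u v p => by
      rw [← sw_tmul, ← sw_map (q := fun t => _ * t) (by fun_prop)]
      simp
    simp only [this]
    have : ∀ u y : H, sw k y (fun v p => sw k p (fun s t => (σ v * s) ⊗ₜ[k] (σ u * t))) =
        1 ⊗ₜ[k] (σ u * y) := fun u y => by
      rw [← sw_assoc y (fun v s t => (σ v * s) ⊗ₜ[k] (σ u * t))]
      have : ∀ x t : H, sw k x (fun v s => (σ v * s) ⊗ₜ[k] (σ u * t)) = ε x • (1 ⊗ₜ[k] (σ u * t)) :=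
        fun x t => sw_antipode_mul x (fun r => r ⊗ₜ[k] (σ u * t))
      simp only [this]
      exact sw_counit_left y (fun t => 1 ⊗ₜ[k] (σ u * t))
    simp only [this]
    exact sw_antipode_mul b (fun t => 1 ⊗ₜ[k] t)
  rw [← e1]
  have e3 : ∀ u v z : H, sw k z (fun p q => (σ v ⊗ₜ[k] σ u) * (Coalgebra.comul (R := k) (p * σ q)))
      = sw k z (fun p q => ((σ v ⊗ₜ[k] σ u) * Coalgebra.comul (R := k) p) * Coalgebra.comul (R := k) (σ q)) :=
    fun u v z => by simp only [Bialgebra.comul_mul, mul_assoc]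
  simp only [e3]
  have : ∀ u y : H, sw k y (fun v z => sw k z (fun p q =>
      ((σ v ⊗ₜ[k] σ u) * Coalgebra.comul (R := k) p) * Coalgebra.comul (R := k) (σ q))) =
      sw k y (fun w q => sw k w (fun v p => (σ v ⊗ₜ[k] σ u) * Coalgebra.comul (R := k) p) *
        Coalgebra.comul (R := k) (σ q)) := fun u y => by
    rw [← sw_assoc y (fun v p q => ((σ v ⊗ₜ[k] σ u) * Coalgebra.comul (R := k) p) *
      Coalgebra.comul (R := k) (σ q))]
    congr; ext w q
    exact sw_map (q := fun t => t * Coalgebra.comul (R := k) (σ q)) (by fun_prop) _ _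
  simp only [this]
  rw [← sw_assoc a (fun u w q => sw k w (fun v p => (σ v ⊗ₜ[k] σ u) * Coalgebra.comul (R := k) p) *
        Coalgebra.comul (R := k) (σ q))]
  have : ∀ x q : H, sw k x (fun u w => sw k w (fun v p => (σ v ⊗ₜ[k] σ u) * Coalgebra.comul (R := k) p) *
        Coalgebra.comul (R := k) (σ q)) = ε x • Coalgebra.comul (R := k) (σ q) := fun x q => by
    rw [sw_map (q := fun t => t * Coalgebra.comul (R := k) (σ q)) (by fun_prop), e2]
    simp
  simp only [this]
  exact (sw_counit_left a (fun q => Coalgebra.comul (R := k) (σ q))).symm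

theorem sw_antipode (a : H) (f : H → H → M)
    (h1 : ∀ y, IsLinearMap k (fun x => f x y) := by fun_prop)
    (h2 : ∀ x, IsLinearMap k (fun y => f x y) := by fun_prop) :
    sw k (σ a) f = sw k a (fun x y => f (σ y) (σ x)) := by
  rw [sw_eq_bil _ f h1 h2, comul_antipode, map_sw]; simp [bil]

theorem antipode_mul (a b : H) : σ (a * b) = σ b * σ a := HopfAlgebra.antipode_mul_antidistrib a b

theorem eq_of_dual {V : Type*} [AddCommGroup V] [Module k V] {x y : V} (h : ∀ q : V →ₗ[k] k, q x = q y) :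
    x = y := by
  rw [← sub_eq_zero, ← Module.forall_dual_apply_eq_zero_iff k]
  intro φ; rw [map_sub, h, sub_self]

end calculus

/-- The dual of a finite-dimensional Hopf algebra. -/
def HDual (k : Type*) [Field k] (H : Type*) [AddCommGroup H] [Module k H] := H →ₗ[k] k

namespace HDual

section basic
variable {k : Type*} [Field k] {H : Type*} [AddCommGroup H] [Module k H]

noncomputable instance : AddCommGroup (HDual k H) := inferInstanceAs (AddCommGroup (H →ₗ[k] k))
noncomputable instance : Module k (HDual k H) := inferInstanceAs (Module k (H →ₗ[k] k))
instance : FunLike (HDual k H) H k := inferInstanceAs (FunLike (H →ₗ[k] k) H k)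
instance [FiniteDimensional k H] : FiniteDimensional k (HDual k H) :=
  inferInstanceAs (FiniteDimensional k (Module.Dual k H))

/-- A linear functional, as an element of the dual. -/
def of (q : H →ₗ[k] k) : HDual k H := q
/-- An element of the dual, as a linear functional. -/
def toLin (q : HDual k H) : H →ₗ[k] k := q

@[simp] theorem of_apply (q : H →ₗ[k] k) (x : H) : of q x = q x := rfl
@[simp] theorem toLin_apply (q : HDual k H) (x : H) : q.toLin x = q x := rfl
@[simp] theorem add_apply (q r : HDual k H) (x : H) : (q + r) x = q x + r x := rfl
@[simp] theorem sub_apply (q r : HDual k H) (x : H) : (q - r) x = q x - r x := rfl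
@[simp] theorem neg_apply (q : HDual k H) (x : H) : (-q) x = - q x := rfl
@[simp] theorem zero_apply (x : H) : (0 : HDual k H) x = 0 := rfl
@[simp] theorem smul_apply (c : k) (q : HDual k H) (x : H) : (c • q) x = c * q x := rfl
@[ext] theorem ext {q r : HDual k H} (h : ∀ x, q x = r x) : q = r := LinearMap.ext h

instance : LinearMapClass (HDual k H) k H k where
  map_add q := LinearMap.map_add q.toLin
  map_smulₛₗ q := LinearMap.map_smul q.toLin

@[fun_prop] theorem lin_apply (q : HDual k H) : IsLinearMap k (fun x => q x) := q.toLin.isLinear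

variable (k) in
/-- Evaluation at a point. -/
def ev (x : H) : HDual k H →ₗ[k] k where
  toFun q := q x
  map_add' _ _ := rfl
  map_smul' _ _ := rfl

@[simp] theorem ev_apply (x : H) (q : HDual k H) : ev k x q = q x := rfl

@[fun_prop] theorem lin_ev {M : Type*} [AddCommGroup M] [Module k M] {f : M → HDual k H}
    (hf : IsLinearMap k f) (x : H) : IsLinearMap k (fun q => f q x) :=
  lin_comp (g := ev k x) (ev k x).isLinear hf

theorem finrank_eq [FiniteDimensional k H] : Module.finrank k (HDual k H) = Module.finrank k H :=
  Subspace.dual_finrank_eq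

theorem sum_apply {ι : Type*} (s : Finset ι) (f : ι → HDual k H) (x : H) :
    (∑ i ∈ s, f i) x = ∑ i ∈ s, f i x := map_sum (ev k x) _ _

end basic

section algebra
variable {k : Type*} [Field k] {C : Type*} [AddCommGroup C] [Module k C] [Coalgebra k C]

noncomputable instance : Mul (HDual k C) :=
  ⟨fun q r => IsLinearMap.mk' (fun x => sw k x (fun u v => q u * r v)) (by fun_prop)⟩
noncomputable instance : One (HDual k C) := ⟨(Coalgebra.counit : C →ₗ[k] k)⟩

theorem mul_apply (q r : HDual k C) (x : C) : (q * r) x = sw k x (fun u v => q u * r v) := rfl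
theorem one_apply (x : C) : (1 : HDual k C) x = Coalgebra.counit x := rfl

noncomputable instance : Ring (HDual k C) :=
  { (inferInstance : AddCommGroup (HDual k C)) with
    mul := (· * ·)
    one := 1
    left_distrib := fun q r s => by ext x; simp only [mul_apply, add_apply, mul_add, sw_add]
    right_distrib := fun q r s => by ext x; simp only [mul_apply, add_apply, add_mul, sw_add]
    zero_mul := fun q => by ext x; simp only [mul_apply, zero_apply, zero_mul, sw_zero]
    mul_zero := fun q => by ext x; simp only [mul_apply, zero_apply, mul_zero, sw_zero]
    mul_assoc := fun q r s => by
      ext x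
      simp only [mul_apply]
      have h1 : ∀ u v : C, sw k u (fun y z => q y * r z) * s v = sw k u (fun y z => q y * (r z * s v)) :=
        fun u v => by rw [← sw_map (q := fun t => t * s v) (by fun_prop)]; simp only [mul_assoc]
      have h2 : ∀ u v : C, q u * sw k v (fun y z => r y * s z) = sw k v (fun y z => q u * (r y * s z)) :=
        fun u v => by rw [← sw_map (q := fun t => q u * t) (by fun_prop)]
      simp only [h1, h2]
      exact sw_assoc x (fun y z v => q y * (r z * s v))
    one_mul := fun q => by
      ext x; simp only [mul_apply, one_apply]
      exact sw_counit_left x (fun v => q v)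
    mul_one := fun q => by
      ext x; simp only [mul_apply, one_apply, mul_comm (q _)]
      exact sw_counit_right x (fun v => q v) }

noncomputable instance : Algebra k (HDual k C) :=
  Algebra.ofModule (fun c q r => by
      ext x; simp only [mul_apply, smul_apply, mul_assoc]
      exact sw_map (q := fun t => c * t) (by fun_prop) _ _)
    (fun c q r => by
      ext x; simp only [mul_apply, smul_apply, mul_left_comm _ c]
      exact sw_map (q := fun t => c * t) (by fun_prop) _ _)

end algebra

section coalgebra
variable {k : Type*} [Field k] {H : Type*} [Ring H] [Algebra k H] [FiniteDimensional k H]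

/-- `(q ∘ L_x)(y) = q (x y)`. -/
noncomputable def lact (x : H) : HDual k H →ₗ[k] HDual k H where
  toFun q := of (q.toLin ∘ₗ LinearMap.mulLeft k x)
  map_add' _ _ := rfl
  map_smul' _ _ := rfl

@[simp] theorem lact_apply (x y : H) (q : HDual k H) : lact x q y = q (x * y) := rfl

/-- `HDual k H ⊗ V` as the space of linear maps `H → V`. -/
noncomputable def tensorHom (V : Type*) [AddCommGroup V] [Module k V] :
    HDual k H ⊗[k] V ≃ₗ[k] (H →ₗ[k] V) := dualTensorHomEquiv k H V

@[simp] theorem tensorHom_tmul {V : Type*} [AddCommGroup V] [Module k V] (q : HDual k H) (v : V) (x : H) :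
    tensorHom V (q ⊗ₜ[k] v) x = q x • v := by
  simp [tensorHom]; rfl

noncomputable instance : CoalgebraStruct k (HDual k H) where
  comul :=
    { toFun := fun q => (tensorHom (HDual k H)).symm
        { toFun := fun x => lact x q
          map_add' := fun x y => by ext z; simp [add_mul]
          map_smul' := fun c x => by ext z; simp }
      map_add' := fun q r => by
        rw [← map_add]; congr 1
      map_smul' := fun c q => by
        rw [← map_smul]; congr 1 }
  counit := ev k 1

@[simp] theorem tensorHom_comul (q : HDual k H) (x : H) :
    tensorHom (HDual k H) (Coalgebra.comul (R := k) q) x = lact x q := by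
  simp [CoalgebraStruct.comul]

theorem counit_apply (q : HDual k H) : Coalgebra.counit (R := k) q = q 1 := rfl

noncomputable instance : Coalgebra k (HDual k H) where
  coassoc := by
    have h1 : ∀ (t : HDual k H ⊗[k] HDual k H) (x : H), tensorHom _ (TensorProduct.assoc k _ _ _
        (Coalgebra.comul.rTensor _ t)) x = (lact x).rTensor _ t := fun t x => by
      induction t with
      | zero => simp
      | add s t hs ht => simp only [map_add, LinearMap.add_apply, hs, ht]
      | tmul u v =>
        rw [LinearMap.rTensor_tmul, LinearMap.rTensor_tmul, ← tensorHom_comul]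
        generalize (Coalgebra.comul (R := k) u) = w
        induction w with
        | zero => simp
        | add s t hs ht => simp only [map_add, LinearMap.add_apply, hs, ht, TensorProduct.add_tmul]
        | tmul a b => simp [TensorProduct.smul_tmul']
    have h2 : ∀ (t : HDual k H ⊗[k] HDual k H) (x : H), tensorHom _
        (Coalgebra.comul.lTensor _ t) x = Coalgebra.comul (R := k) (tensorHom _ t x) := fun t x => by
      induction t with
      | zero => simp
      | add s t hs ht => simp only [map_add, LinearMap.add_apply, hs, ht]
      | tmul u v => simp
    have h3 : ∀ (t : HDual k H ⊗[k] HDual k H) (x y : H), tensorHom _ ((lact x).rTensor _ t) y =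
        tensorHom _ t (x * y) := fun t x y => by
      induction t with
      | zero => simp
      | add s t hs ht => simp only [map_add, LinearMap.add_apply, hs, ht]
      | tmul u v => simp
    ext q
    apply (tensorHom _).injective
    ext x : 1
    apply (tensorHom _).injective
    ext y z
    simp [h1, h2, h3, mul_assoc]
  rTensor_counit_comp_comul := by
    have h : ∀ (t : HDual k H ⊗[k] HDual k H), (Coalgebra.counit (R := k)).rTensor _ t =
        1 ⊗ₜ tensorHom _ t 1 := fun t => by
      induction t with
      | zero => simp
      | add s t hs ht => simp only [map_add, LinearMap.add_apply, hs, ht, TensorProduct.tmul_add]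
      | tmul u v =>
        rw [LinearMap.rTensor_tmul, tensorHom_tmul, TensorProduct.tmul_smul, TensorProduct.smul_tmul',
          smul_eq_mul, mul_one]; rfl
    ext q
    simp only [LinearMap.comp_apply, h, tensorHom_comul]
    simp only [TensorProduct.mk_apply]
    congr; ext x; simp
  lTensor_counit_comp_comul := by
    have h : ∀ (t : HDual k H ⊗[k] HDual k H) (x : H), tensorHom _ ((Coalgebra.counit (R := k)).lTensor _ t) x =
        tensorHom _ t x 1 := fun t x => by
      induction t with
      | zero => simp
      | add s t hs ht => simp only [map_add, LinearMap.add_apply, hs, ht, add_apply]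
      | tmul u v => simp [counit_apply]
    ext q
    apply (tensorHom _).injective
    ext x
    simp [h]

theorem sw_ev_left (q : HDual k H) (x : H) : sw k q (fun q1 q2 => q1 x • q2) = lact x q := by
  rw [← tensorHom_comul, ← sw_tmul]
  refine ((map_sw ((LinearMap.applyₗ x) ∘ₗ (tensorHom (HDual k H)).toLinearMap) q
    (fun a b => a ⊗ₜ[k] b)).trans ?_).symm
  simp

theorem sw_ev_ev (q : HDual k H) (x y : H) : sw k q (fun q1 q2 => q1 x * q2 y) = q (x * y) := by
  rw [← lact_apply, ← sw_ev_left]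
  exact (map_sw (ev k y) q (fun q1 q2 => q1 x • q2)).symm

end coalgebra

section hopf
variable {k : Type*} [Field k] {H : Type*} [Ring H] [HopfAlgebra k H] [FiniteDimensional k H]

theorem tensorHom_mul (s t : HDual k H ⊗[k] HDual k H) (x y : H) : tensorHom _ (s * t) x y =
    sw k x (fun x1 x2 => sw k y (fun y1 y2 => tensorHom _ s x1 y1 * tensorHom _ t x2 y2)) := by
  induction s with
  | zero => simp [sw_zero]
  | add s s' hs hs' => simp only [add_mul, map_add, LinearMap.add_apply, hs, hs', add_apply, sw_add]
  | tmul a b =>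
    induction t with
    | zero => simp [sw_zero]
    | add s s' hs hs' => simp only [mul_add, map_add, LinearMap.add_apply, hs, hs', add_apply, sw_add]
    | tmul c d =>
      rw [Algebra.TensorProduct.tmul_mul_tmul, tensorHom_tmul, smul_apply, mul_apply, mul_apply,
        ← sw_map (q := fun t => t * _) (by fun_prop)]
      congr; ext u v
      rw [← sw_map (q := fun t => _ * t) (by fun_prop)]
      congr; ext w z
      simp; ring

noncomputable instance : Bialgebra k (HDual k H) :=
  Bialgebra.mk' k _ (by rw [counit_apply, one_apply, Bialgebra.counit_one])
    (fun {q r} => by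
      rw [counit_apply, mul_apply, sw_one (fun u v => q u * r v)]; rfl)
    (by
      apply (tensorHom _).injective
      ext x y
      simp [one_apply, Algebra.TensorProduct.one_def])
    (fun {q r} => by
      apply (tensorHom _).injective
      ext x y
      simp only [tensorHom_mul, tensorHom_comul, lact_apply, mul_apply]
      rw [sw_mul x y (fun u v => q u * r v)])

noncomputable instance : HopfAlgebra k (HDual k H) where
  antipode :=
    { toFun := fun q => of (q.toLin ∘ₗ HopfAlgebra.antipode k)
      map_add' := fun _ _ => rfl
      map_smul' := fun _ _ => rfl }
  mul_antipode_rTensor_comul := by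
    ext q x
    simp only [LinearMap.comp_apply]
    rw [← sw_tmul, map_sw, map_sw]
    have := map_sw (ev k x) q (fun q1 q2 => of (q1.toLin ∘ₗ HopfAlgebra.antipode k) * q2)
    refine this.trans ?_
    simp only [ev_apply, mul_apply]
    rw [sw_comm]
    simp only [of_apply, LinearMap.comp_apply, toLin_apply, sw_ev_ev]
    rw [sw_antipode_mul x (fun t => q t)]
    simp [counit_apply, Algebra.algebraMap_eq_smul_one, one_apply, mul_comm]
  mul_antipode_lTensor_comul := by
    ext q x
    simp only [LinearMap.comp_apply]
    rw [← sw_tmul, map_sw, map_sw]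
    have := map_sw (ev k x) q (fun q1 q2 => q1 * of (q2.toLin ∘ₗ HopfAlgebra.antipode k))
    refine this.trans ?_
    simp only [ev_apply, mul_apply]
    rw [sw_comm]
    simp only [of_apply, LinearMap.comp_apply, toLin_apply, sw_ev_ev]
    rw [sw_mul_antipode x (fun t => q t)]
    simp [counit_apply, Algebra.algebraMap_eq_smul_one, one_apply, mul_comm]

@[simp] theorem antipode_apply (q : HDual k H) (x : H) :
    HopfAlgebra.antipode k q x = q (HopfAlgebra.antipode k x) := rfl

end hopf
end HDual
end Hopf

namespace Hopf

section tr
variable {k : Type*} [Field k] {V : Type*} [AddCommGroup V] [Module k V] [FiniteDimensional k V]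

variable (k) in
/-- The trace of a (linear) self-map, given as a bare function. -/
noncomputable def Tr (f : V → V) : k :=
  ∑ i, (Module.finBasis k V).coord i (f (Module.finBasis k V i))

theorem Tr_eq_trace (f : V →ₗ[k] V) : Tr k (fun x => f x) = LinearMap.trace k V f := by
  rw [LinearMap.trace_eq_matrix_trace k (Module.finBasis k V), Matrix.trace, Tr]
  simp [LinearMap.toMatrix_apply]

theorem sum_coord (f : V →ₗ[k] V) (x : V) {W : Type*} [AddCommGroup W] [Module k W] (g : V → W)
    (hg : IsLinearMap k g) :
    g (f x) = ∑ i, (Module.finBasis k V).coord i x • g (f (Module.finBasis k V i)) := by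
  conv_lhs => rw [← (Module.finBasis k V).sum_repr x]
  rw [map_sum, ← IsLinearMap.mk'_apply hg, map_sum]
  simp

theorem Tr_smul (φ : V → k) (hφ : IsLinearMap k φ) (v : V) : Tr k (fun x => φ x • v) = φ v := by
  conv_rhs => rw [show v = LinearMap.id (R := k) v from rfl, sum_coord LinearMap.id v φ hφ]
  simp [Tr, mul_comm]

theorem Tr_finsum {ι : Type*} (s : Finset ι) (f : ι → V → V) :
    Tr k (fun x => ∑ i ∈ s, f i x) = ∑ i ∈ s, Tr k (f i) := by
  simp only [Tr, map_sum]; exact Finset.sum_comm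

theorem Tr_sw {C : Type*} [AddCommGroup C] [Module k C] [Coalgebra k C] (a : C) (f : C → C → V → V) :
    Tr k (fun x => sw k a (fun u v => f u v x)) = sw k a (fun u v => Tr k (f u v)) := Tr_finsum _ _

theorem Tr_const_smul (c : k) (f : V → V) : Tr k (fun x => c • f x) = c * Tr k f := by
  simp [Tr, Finset.mul_sum]

end tr

section cointegral
variable {k : Type*} [Field k] {H : Type*} [Ring H] [HopfAlgebra k H] [FiniteDimensional k H]

local notation "ε" => Coalgebra.counit (R := k)
local notation "σ" => HopfAlgebra.antipode k

theorem Tr_twist (r : HDual k H) (M : H →ₗ[k] H) :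
    Tr k (fun h => sw k h (fun h1 h2 => sw k (M h2) (fun m1 m2 => r (m1 * σ h1) • m2))) = r 1 * Tr k M := by
  obtain ⟨w, hw⟩ : ∃ w : Fin (Module.finrank k H) → H, ∀ i, w i = M (Module.finBasis k H i) := ⟨_, fun _ => rfl⟩
  have e : ∀ h1 h2 : H, sw k (M h2) (fun m1 m2 => r (m1 * σ h1) • m2) =
      ∑ i, (Module.finBasis k H).coord i h2 • sw k (w i) (fun m1 m2 => r (m1 * σ h1) • m2) := fun h1 h2 => by
    simp only [hw]
    exact sum_coord M h2 (fun t => sw k t (fun m1 m2 => r (m1 * σ h1) • m2)) (by fun_prop)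
  simp only [e, sw_finsum, Tr_finsum, smul_sw]
  conv_rhs => rw [Tr, Finset.mul_sum]
  congr; ext i
  generalize (Module.finBasis k H).coord i = φ
  rw [← hw]
  generalize w i = v
  simp only [smul_smul]
  have e2 : ∀ h : H, sw k h (fun h1 h2 => sw k v (fun m1 m2 => (φ h2 * r (m1 * σ h1)) • m2)) =
      sw k v (fun m1 m2 => (sw k h (fun h1 h2 => φ h2 * r (m1 * σ h1))) • m2) := fun h => by
    rw [sw_comm]; simp only [sw_smul_right]
  simp only [e2]
  rw [Tr_sw]
  have e3 : ∀ m1 m2 : H, Tr k (fun x => (sw k x (fun h1 h2 => φ h2 * r (m1 * σ h1))) • m2) =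
      sw k m2 (fun h1 h2 => φ h2 * r (m1 * σ h1)) := fun m1 m2 =>
    Tr_smul (fun x => sw k x (fun h1 h2 => φ h2 * r (m1 * σ h1))) (by fun_prop) m2
  simp only [e3]
  rw [← sw_assoc v (fun m1 h1 h2 => φ h2 * r (m1 * σ h1))]
  have e4 : ∀ x h2 : H, sw k x (fun m1 h1 => φ h2 * r (m1 * σ h1)) = ε x • (φ h2 * r 1) := fun x h2 =>
    sw_mul_antipode x (fun t => φ h2 * r t)
  simp only [e4]
  rw [sw_counit_left v (fun h2 => φ h2 * r 1), mul_comm]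

theorem sw_antipode_antipode {M : Type*} [AddCommGroup M] [Module k M] (a : H) (f : H → H → M)
    (h1 : ∀ y, IsLinearMap k (fun x => f x y) := by fun_prop)
    (h2 : ∀ x, IsLinearMap k (fun y => f x y) := by fun_prop) :
    sw k (σ (σ a)) f = sw k a (fun x y => f (σ (σ x)) (σ (σ y))) := by
  rw [sw_antipode _ f h1 h2, sw_antipode a (fun x y => f (σ y) (σ x))]

/-- `y ↦ y₁ q(y₂)`. -/
noncomputable def ract (q : HDual k H) : H →ₗ[k] H :=
  IsLinearMap.mk' (fun y => sw k y (fun y1 y2 => q y2 • y1)) (by fun_prop)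

/-- `y ↦ q(y₁) y₂`. -/
noncomputable def lactH (q : HDual k H) : H →ₗ[k] H :=
  IsLinearMap.mk' (fun y => sw k y (fun y1 y2 => q y1 • y2)) (by fun_prop)

theorem ract_apply (q : HDual k H) (y : H) : ract q y = sw k y (fun y1 y2 => q y2 • y1) := rfl
theorem lactH_apply (q : HDual k H) (y : H) : lactH q y = sw k y (fun y1 y2 => q y1 • y2) := rfl

theorem apply_ract (q r : HDual k H) (y : H) : r (ract q y) = (r * q) y := by
  rw [ract_apply, HDual.mul_apply, ← sw_map (q := fun t => r t) (by fun_prop)]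
  simp [mul_comm]

theorem apply_lactH (q r : HDual k H) (y : H) : r (lactH q y) = (q * r) y := by
  rw [lactH_apply, HDual.mul_apply, ← sw_map (q := fun t => r t) (by fun_prop)]
  simp

theorem sw_ract {M : Type*} [AddCommGroup M] [Module k M] (q : HDual k H) (y : H) (f : H → H → M)
    (h1 : ∀ y, IsLinearMap k (fun x => f x y) := by fun_prop)
    (h2 : ∀ x, IsLinearMap k (fun y => f x y) := by fun_prop) :
    sw k (ract q y) f = sw k y (fun y1 y2 => f y1 (ract q y2)) := by
  rw [ract_apply, ← sw_map (q := fun t => sw k t f) (by fun_prop)]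
  have e : ∀ x z : H, sw k (q z • x) f = sw k x (fun u v => q z • f u v) := fun x z => by
    rw [(lin_sw f h1 h2).map_smul, smul_sw]
  simp only [e]
  rw [sw_assoc y (fun u v z => q z • f u v)]
  congr; ext u w
  rw [ract_apply, ← sw_map (q := fun t => f u t) (by fun_prop)]
  simp only [(h2 _).map_smul]

variable (k H) in
theorem exists_cointegral [Nontrivial H] : ∃ l : HDual k H, l ≠ 0 ∧ ∀ r : HDual k H, r * l = r 1 • l := by
  let P : HDual k H → HDual k H := fun q => HDual.of (IsLinearMap.mk'
    (fun x => Tr k (fun h => ract q (x * σ (σ h)))) (by unfold Tr; fun_prop))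
  have hP : ∀ q x, P q x = Tr k (fun h => ract q (x * σ (σ h))) := fun _ _ => rfl
  have hinv : ∀ q r, r * P q = r 1 • P q := fun q r => by
    ext x
    rw [HDual.smul_apply, hP]
    let M : H →ₗ[k] H := IsLinearMap.mk' (fun y => ract q (x * σ (σ y))) (by fun_prop)
    rw [show (fun h => ract q (x * σ (σ h))) = M from rfl, ← Tr_twist r M, HDual.mul_apply]
    simp only [hP, ← Tr_const_smul]
    rw [← Tr_sw]
    congr; ext h
    have e : ∀ h1 h2 : H, sw k (M h2) (fun m1 m2 => r (m1 * σ h1) • m2) =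
        sw k h2 (fun u v => sw k x (fun x1 x2 => r (x1 * σ (h1 * σ u)) • ract q (x2 * σ (σ v)))) :=
      fun h1 h2 => by
      show sw k (ract q (x * σ (σ h2))) _ = _
      rw [sw_ract q _ (fun m1 m2 => r (m1 * σ h1) • m2),
        sw_mul x (σ (σ h2)) (fun m1 m2 => r (m1 * σ h1) • ract q m2)]
      have : ∀ x1 x2 : H, sw k (σ (σ h2)) (fun u v => r (x1 * u * σ h1) • ract q (x2 * v)) =
        sw k h2 (fun u v => r (x1 * σ (σ u) * σ h1) • ract q (x2 * σ (σ v))) := fun x1 x2 =>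
        sw_antipode_antipode h2 (fun u v => r (x1 * u * σ h1) • ract q (x2 * v))
      simp only [this]
      rw [sw_comm]
      simp only [antipode_mul, mul_assoc]
    simp only [e]
    rw [← sw_assoc h (fun h1 u v => sw k x (fun x1 x2 => r (x1 * σ (h1 * σ u)) • ract q (x2 * σ (σ v))))]
    have e2 : ∀ t v : H, sw k t (fun h1 u => sw k x (fun x1 x2 => r (x1 * σ (h1 * σ u)) • ract q (x2 * σ (σ v))))
      = ε t • sw k x (fun x1 x2 => r (x1 * σ 1) • ract q (x2 * σ (σ v))) := fun t v =>
      sw_mul_antipode t (fun s => sw k x (fun x1 x2 => r (x1 * σ s) • ract q (x2 * σ (σ v))))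
    simp only [e2]
    rw [sw_counit_left h (fun v => sw k x (fun x1 x2 => r (x1 * σ 1) • ract q (x2 * σ (σ v)))) (by fun_prop)]
    simp [HopfAlgebra.antipode_one]
  by_contra! hcon
  have hP0 : ∀ q, P q = 0 := fun q => by
    by_contra hq
    obtain ⟨r, hr⟩ := hcon (P q) hq
    exact hr (hinv q r)
  let b := Module.finBasis k H
  let E : Fin (Module.finrank k H) → HDual k H := fun i => HDual.of (b.coord i)
  have hE : ∀ q : HDual k H, q = ∑ l, q (b l) • E l := fun q => by
    ext x
    rw [HDual.sum_apply]
    conv_lhs => rw [← b.sum_repr x, map_sum]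
    simp [E, mul_comm]
  have key : ∀ (q : HDual k H) (x : H), q x = 0 := fun q x => by
    have h0 : ∑ i, P (E i * q) (x * σ (b i)) = 0 := by simp [hP0]
    have h1 : ∀ i j, b.coord j (ract (E i * q) (x * σ (b i) * σ (σ (b j)))) =
        (E j * E i * q) (x * σ (σ (b j) * b i)) := fun i j => by
      rw [antipode_mul, ← mul_assoc, mul_assoc (E j), ← apply_ract]; rfl
    simp only [hP, Tr] at h0
    have h0' : ∑ i, ∑ j, (E j * E i * q) (x * σ (σ (b j) * b i)) = 0 := by
      rw [← h0]; exact Finset.sum_congr rfl fun i _ => Finset.sum_congr rfl fun j _ => (h1 i j).symm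
    have h2 : ∀ (q' : HDual k H) (h : H), (q' * q) (x * σ h) = ∑ l, (E l * q) (x * σ (q' (b l) • h)) :=
      fun q' h => by
        conv_lhs => rw [hE q', Finset.sum_mul, HDual.sum_apply]
        simp
    have h0'' : ∑ i, ∑ j, ∑ l, (E l * q) (x * σ ((E j * E i) (b l) • (σ (b j) * b i))) = 0 := by
      rw [← h0']
      exact Finset.sum_congr rfl fun i _ => Finset.sum_congr rfl fun j _ => (h2 _ _).symm
    have h3 : ∀ l, ∑ i, ∑ j, (E j * E i) (b l) • (σ (b j) * b i) = ε (b l) • 1 := fun l => by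
      rw [← sw_antipode_mul (b l) (fun t => t)]
      have : ∀ u v : H, σ u * v = ∑ i, ∑ j, (E j u * E i v) • (σ (b j) * b i) := fun u v => by
        conv_lhs => rw [← b.sum_repr u, ← b.sum_repr v, map_sum, Finset.sum_mul_sum, Finset.sum_comm]
        simp [E, smul_smul, mul_comm]
      rw [show (fun u v : H => σ u * v) = fun u v => ∑ i, ∑ j, (E j u * E i v) • (σ (b j) * b i) from
        funext₂ this]
      simp only [sw_finsum, HDual.mul_apply, sw_smul_right]
    have h4 : ∑ i, ∑ j, ∑ l, (E l * q) (x * σ ((E j * E i) (b l) • (σ (b j) * b i))) =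
        ∑ l, (E l * q) (x * σ (∑ i, ∑ j, (E j * E i) (b l) • (σ (b j) * b i))) := by
      simp only [map_sum, Finset.mul_sum]
      conv_rhs => rw [Finset.sum_comm]
      refine Finset.sum_congr rfl fun i _ => ?_
      exact Finset.sum_comm
    rw [h4] at h0''
    rw [Finset.sum_congr rfl fun l _ => by rw [h3 l]] at h0''
    have h5 := h2 1 1
    simp only [HDual.one_apply] at h5
    rw [h0'', one_mul, HopfAlgebra.antipode_one, mul_one] at h5
    exact h5
  obtain ⟨x, hx⟩ := exists_ne (0 : H)
  exact hx ((Module.forall_dual_apply_eq_zero_iff k x).1 (fun φ => key (HDual.of φ) x))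

end cointegral
end Hopf

namespace Hopf
section frob
variable {k : Type*} [Field k] {H : Type*} [Ring H] [HopfAlgebra k H] [FiniteDimensional k H]

local notation "ε" => Coalgebra.counit (R := k)
local notation "σ" => HopfAlgebra.antipode k

theorem cointegral_sw {M : Type*} [AddCommGroup M] [Module k M] {l : HDual k H}
    (hl : ∀ r, r * l = r 1 • l) (x : H) (f : H → M) (hf : IsLinearMap k f := by fun_prop) :
    sw k x (fun u v => l v • f u) = l x • f 1 := by
  have : sw k x (fun u v => l v • u) = l x • (1 : H) := by
    refine eq_of_dual (k := k) fun q => ?_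
    have := congrArg (fun r : HDual k H => r x) (hl (HDual.of q))
    simp only [HDual.mul_apply, HDual.smul_apply, HDual.of_apply] at this
    rw [map_sw]; simp only [map_smul, smul_eq_mul, mul_comm (l _)]; exact this
  rw [← hf.map_smul, ← this, ← sw_map hf]; simp only [hf.map_smul]

/-- `∑ λ(a b₂) b₁ = ∑ λ(a₂ b) S(a₁)`. -/
theorem cointegral_slide {M : Type*} [AddCommGroup M] [Module k M] {l : HDual k H}
    (hl : ∀ r, r * l = r 1 • l) (a b : H) (f : H → M) (hf : IsLinearMap k f := by fun_prop) :
    sw k b (fun u v => l (a * v) • f u) = sw k a (fun u v => l (v * b) • f (σ u)) := by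
  have e : ∀ u v : H, l (v * b) • f (σ u) =
      sw k v (fun v1 v2 => sw k b (fun b1 b2 => l (v2 * b2) • f (σ u * v1 * b1))) := fun u v => by
    have := cointegral_sw hl (v * b) (fun x => f (σ u * x))
    rw [mul_one, sw_mul v b (fun x y => l y • f (σ u * x))] at this
    simp only [mul_assoc, this]
  simp only [e]
  rw [← sw_assoc a (fun u v1 v2 => sw k b (fun b1 b2 => l (v2 * b2) • f (σ u * v1 * b1)))]
  have e2 : ∀ x v2 : H, sw k x (fun u v1 => sw k b (fun b1 b2 => l (v2 * b2) • f (σ u * v1 * b1))) =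
      ε x • sw k b (fun b1 b2 => l (v2 * b2) • f b1) := fun x v2 => by
    simpa using sw_antipode_mul x (fun t => sw k b (fun b1 b2 => l (v2 * b2) • f (t * b1)))
  simp only [e2]
  rw [sw_counit_left a (fun v2 => sw k b (fun b1 b2 => l (v2 * b2) • f b1))]

/-- A nonzero cointegral gives a nondegenerate form. -/
theorem cointegral_nondeg {l : HDual k H} (hl : ∀ r, r * l = r 1 • l) (h0 : l ≠ 0) {b : H}
    (hb : ∀ a, l (a * b) = 0) : b = 0 := by
  have hε : ∀ b, (∀ a, l (a * b) = 0) → ε b = 0 := fun b hb => by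
    by_contra hne
    refine h0 (HDual.ext fun x => ?_)
    have := sw_antipode_mul (k := k) b (fun t => l (x * t))
    rw [mul_one] at this
    have h2 : ε b • l x = 0 := by
      rw [← this]
      have h3 : ∀ y, sw k b (fun u v => l (y * v) • u) = 0 := fun y => by
        rw [cointegral_slide hl y b (fun u => u)]
        have : ∀ u v : H, l (v * b) • σ u = 0 := fun u v => by rw [hb, zero_smul]
        simp only [this, sw_zero]
      let B := Module.finBasis k H
      have h4 : ∀ u v : H, l (x * (σ u * v)) = ∑ i, B.coord i u * l (x * σ (B i) * v) := fun u v => by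
        conv_lhs => rw [← B.sum_repr u, map_sum, Finset.sum_mul, Finset.mul_sum, map_sum]
        simp [mul_assoc]
      simp only [h4, sw_finsum]
      refine Finset.sum_eq_zero fun i _ => ?_
      have := congrArg (B.coord i) (h3 (x * σ (B i)))
      rw [map_sw, map_zero] at this
      rw [← this]; simp only [map_smul, smul_eq_mul, mul_comm]
    simpa [hne] using h2
  refine (Module.forall_dual_apply_eq_zero_iff k b).1 fun q => ?_
  have : ε (sw k b (fun u v => q u • v)) = 0 := by
    refine hε _ fun a => ?_
    rw [← sw_map (q := fun t => l (a * t)) (by fun_prop)]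
    have := cointegral_slide hl a b (fun u => q u)
    simp only [hb, zero_smul, sw_zero] at this
    rw [← this]
    simp [mul_comm]
  rw [map_sw] at this
  simp only [map_smul, smul_eq_mul] at this
  rw [← this, ← sw_counit_right (k := k) b (fun u => q u)]
  simp [mul_comm]

theorem exists_of_nondeg (l : HDual k H) (h : ∀ b, (∀ a, l (a * b) = 0) → b = 0) (q : HDual k H) :
    ∃ n, ∀ b, l (b * n) = q b := by
  let T : H →ₗ[k] HDual k H := IsLinearMap.mk' (fun n => HDual.of (IsLinearMap.mk' (fun b => l (b * n))
    (by fun_prop))) ⟨fun x y => by ext; simp [mul_add], fun c x => by ext; simp⟩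
  have hT : Function.Injective T := by
    rw [← LinearMap.ker_eq_bot, LinearMap.ker_eq_bot']
    intro m hm
    exact h m fun a => congrArg (fun r : HDual k H => r a) hm
  obtain ⟨n, hn⟩ := (LinearMap.injective_iff_surjective_of_finrank_eq_finrank HDual.finrank_eq.symm).1 hT q
  exact ⟨n, fun b => congrArg (fun r : HDual k H => r b) hn⟩

variable (k H) in
/-- A left cointegral together with a left integral, normalised against each other. -/
structure Frob where
  lam : HDual k H
  Lam : H
  mul_lam : ∀ r : HDual k H, r * lam = r 1 • lam
  lam_mul_Lam : ∀ a, lam (a * Lam) = ε a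

variable (k H) in
theorem exists_frob [Nontrivial H] : Nonempty (Frob k H) := by
  obtain ⟨l, h0, hl⟩ := exists_cointegral k H
  obtain ⟨n, hn⟩ := exists_of_nondeg l (fun b hb => cointegral_nondeg hl h0 hb) 1
  exact ⟨⟨l, n, hl, hn⟩⟩

namespace Frob
variable (F : Frob k H)

theorem lam_Lam : F.lam F.Lam = 1 := by simpa using F.lam_mul_Lam 1

theorem nondeg_right {b : H} (hb : ∀ a, F.lam (a * b) = 0) : b = 0 := by
  rcases subsingleton_or_nontrivial H with h | h
  · exact Subsingleton.elim _ _
  · refine cointegral_nondeg F.mul_lam (fun h0 => ?_) hb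
    have := F.lam_Lam
    simp [h0] at this

theorem eq_of_lam {b c : H} (hb : ∀ a, F.lam (a * b) = F.lam (a * c)) : b = c := by
  refine sub_eq_zero.1 (F.nondeg_right fun a => ?_)
  rw [mul_sub, map_sub, hb, sub_self]

theorem mul_Lam (a : H) : a * F.Lam = ε a • F.Lam := by
  refine F.eq_of_lam fun b => ?_
  rw [← mul_assoc, F.lam_mul_Lam, mul_smul_comm, map_smul, F.lam_mul_Lam]
  simp [mul_comm]

/-- Integrals are unique. -/
theorem eq_smul_Lam {t : H} (ht : ∀ a, a * t = ε a • t) : t = F.lam t • F.Lam := by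
  refine F.eq_of_lam fun b => ?_
  rw [ht, mul_smul_comm, map_smul, map_smul, F.lam_mul_Lam]
  simp [mul_comm]

theorem sw_ev_right (q : HDual k H) (x : H) : sw k q (fun q1 q2 => q2 x • q1) =
    HDual.of (q.toLin ∘ₗ LinearMap.mulRight k x) := by
  ext y
  rw [← HDual.ev_apply, map_sw]
  simp only [map_smul, HDual.ev_apply, smul_eq_mul]
  rw [HDual.of_apply]
  simp only [LinearMap.comp_apply, HDual.toLin_apply, LinearMap.mulRight_apply]
  rw [← HDual.sw_ev_ev]
  simp only [mul_comm]

/-- The Frobenius structure on the dual. -/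
noncomputable def dual : Frob k (HDual k H) where
  lam := HDual.of (HDual.ev k F.Lam)
  Lam := F.lam
  mul_lam R := by
    ext q
    simp only [HDual.mul_apply, HDual.of_apply, HDual.ev_apply, HDual.smul_apply]
    have := congrArg R (sw_ev_right q F.Lam)
    rw [← sw_map (q := fun t => R t) (by fun_prop)] at this
    simp only [map_smul, smul_eq_mul, mul_comm _ (R _)] at this
    rw [this, mul_comm, ← smul_eq_mul, ← map_smul]
    congr 1; ext y
    simp [F.mul_Lam, HDual.one_apply, mul_comm]
  lam_mul_Lam r := by
    simp [F.mul_lam, HDual.counit_apply, F.lam_Lam]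

@[simp] theorem dual_lam (q : HDual k H) : F.dual.lam q = q F.Lam := rfl
@[simp] theorem dual_Lam : F.dual.Lam = F.lam := rfl

theorem eq_smul_lam {l : HDual k H} (hl : ∀ r, r * l = r 1 • l) : l = l F.Lam • F.lam :=
  F.dual.eq_smul_Lam hl

/-- `S(a) = ∑ Λ₁ λ(a Λ₂)`. -/
theorem antipode_eq (a : H) : σ a = sw k F.Lam (fun u v => F.lam (a * v) • u) := by
  rw [cointegral_slide F.mul_lam a F.Lam (fun u => u)]
  simp only [F.lam_mul_Lam]
  rw [sw_counit_right a (fun u => σ u)]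

theorem antipode_injective (F : Frob k H) : Function.Injective (σ : H → H) := by
  intro a b hab
  rw [← sub_eq_zero] at hab ⊢
  rw [← map_sub] at hab
  generalize a - b = c at hab
  have h1 : HDual.lact c F.lam = 0 := by
    refine F.dual.nondeg_right fun q => ?_
    rw [dual_lam, HDual.mul_apply]
    have := congrArg q ((F.antipode_eq c).symm.trans hab)
    rw [map_zero, ← sw_map (q := fun t => q t) (by fun_prop)] at this
    rw [← this]
    simp [mul_comm]
  -- left nondegeneracy from right nondegeneracy
  refine (Module.forall_dual_apply_eq_zero_iff k c).1 fun q => ?_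
  obtain ⟨n, hn⟩ := exists_of_nondeg F.lam (fun b => F.nondeg_right) (HDual.of q)
  exact (hn c).symm.trans (congrArg (fun r : HDual k H => r n) h1)

theorem nondeg_left {a : H} (h : ∀ b, F.lam (a * b) = 0) : a = 0 := by
  refine (Module.forall_dual_apply_eq_zero_iff k a).1 fun q => ?_
  obtain ⟨n, hn⟩ := exists_of_nondeg F.lam (fun b => F.nondeg_right) (HDual.of q)
  exact (hn a).symm.trans (h n)

theorem trace_mul_antipode_sq (b : H) : Tr k (fun a => b * σ (σ a)) = F.lam b * ε F.Lam := by
  have : ∀ a : H, b * σ (σ a) = sw k F.Lam (fun u v => F.lam (a * v) • (b * σ u)) := fun a => by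
    rw [F.antipode_eq a, ← sw_map (q := fun t => b * σ t) (by fun_prop)]; simp
  simp only [this]
  rw [Tr_sw]
  have h2 : ∀ u v : H, Tr k (fun a => F.lam (a * v) • (b * σ u)) = F.lam (b * (σ u * v)) := fun u v => by
    rw [Tr_smul (fun a => F.lam (a * v)) (by fun_prop), mul_assoc]
  simp only [h2]
  rw [sw_antipode_mul F.Lam (fun t => F.lam (b * t))]
  simp [mul_comm]

/-- The modular function. -/
noncomputable def alpha : HDual k H := HDual.lact F.Lam F.lam

theorem alpha_apply (h : H) : F.alpha h = F.lam (F.Lam * h) := rfl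

theorem Lam_mul (h : H) : F.Lam * h = F.alpha h • F.Lam := by
  rw [alpha_apply]
  exact F.eq_smul_Lam fun a => by rw [← mul_assoc, F.mul_Lam, smul_mul_assoc]

theorem alpha_one : F.alpha 1 = 1 := by rw [alpha_apply, mul_one, F.lam_Lam]

theorem alpha_mul (a b : H) : F.alpha (a * b) = F.alpha a * F.alpha b := by
  rw [alpha_apply, ← mul_assoc, F.Lam_mul, smul_mul_assoc, map_smul, F.Lam_mul, map_smul, F.lam_Lam]
  simp

/-- The distinguished group-like element. -/
noncomputable def g : H := sw k F.Lam (fun u v => F.lam u • v)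

theorem lam_mul (q : HDual k H) : F.lam * q = q F.g • F.lam := by
  have : q F.g = (F.lam * q) F.Lam := by
    rw [g, HDual.mul_apply, ← sw_map (q := fun t => q t) (by fun_prop)]; simp
  rw [this]
  exact F.eq_smul_lam fun r => by rw [← mul_assoc, F.mul_lam, smul_mul_assoc]

theorem apply_g_mul (q r : HDual k H) : (q * r) F.g = q F.g * r F.g := by
  have h := congrArg (fun t : HDual k H => t F.Lam) (F.lam_mul (q * r))
  simp only [← mul_assoc, F.lam_mul q, smul_mul_assoc, F.lam_mul r, HDual.smul_apply, F.lam_Lam, mul_one] at h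
  exact h.symm

theorem counit_g : ε F.g = 1 := by
  have h := congrArg (fun t : HDual k H => t F.Lam) (F.lam_mul 1)
  simp only [mul_one, HDual.smul_apply, F.lam_Lam, HDual.one_apply] at h
  exact h.symm

end Frob

theorem isGroupLikeElem_of_apply {a : H} (h1 : ε a = 1) (h : ∀ q r : HDual k H, (q * r) a = q a * r a) :
    IsGroupLikeElem k a := by
  refine ⟨h1, ?_⟩
  let b := Module.finBasis k H
  refine (b.tensorProduct b).ext_elem fun ⟨i, j⟩ => ?_
  have := h (HDual.of (b.coord i)) (HDual.of (b.coord j))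
  rw [HDual.mul_apply] at this
  have e : ∀ t : H ⊗[k] H, (b.tensorProduct b).repr t (i, j) =
     TensorProduct.lid k k (TensorProduct.map (b.coord i) (b.coord j) t) := fun t => by
    induction t with
    | zero => simp
    | tmul x y => simp [mul_comm]
    | add x y hx hy => simp [hx, hy]
  rw [e, e]
  rw [← sw_tmul, map_sw, ← sw_map (q := fun t => TensorProduct.lid k k t) 
    (TensorProduct.lid k k).toLinearMap.isLinear]
  simpa using this

theorem IsGroupLikeElem.apply_mul {a : H} (ha : IsGroupLikeElem k a) (q r : HDual k H) :
    (q * r) a = q a * r a := by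
  exact sw_of_comul_eq_tmul ha.comul_eq_tmul_self (fun u v => q u * r v)

theorem isGroupLikeElem_dual_iff {χ : HDual k H} :
    IsGroupLikeElem k χ ↔ χ 1 = 1 ∧ ∀ a b, χ (a * b) = χ a * χ b := by
  constructor
  · intro h
    refine ⟨h.counit_eq_one, fun a b => ?_⟩
    rw [← HDual.sw_ev_ev]
    exact sw_of_comul_eq_tmul h.comul_eq_tmul_self (fun q r : HDual k H => q a * r b)
  · rintro ⟨h1, h2⟩
    refine ⟨h1, (HDual.tensorHom _).injective ?_⟩
    ext a b
    rw [HDual.tensorHom_comul, HDual.tensorHom_tmul]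
    simp [h2]

namespace Frob
variable (F : Frob k H)

theorem isGroupLikeElem_g : IsGroupLikeElem k F.g := isGroupLikeElem_of_apply F.counit_g F.apply_g_mul
theorem isGroupLikeElem_alpha : IsGroupLikeElem k F.alpha :=
  isGroupLikeElem_dual_iff.2 ⟨F.alpha_one, F.alpha_mul⟩

end Frob
end frob
end Hopf

namespace Hopf
section radford
variable {k : Type*} [Field k] {H : Type*} [Ring H] [HopfAlgebra k H] [FiniteDimensional k H]

local notation "ε" => Coalgebra.counit (R := k)
local notation "σ" => HopfAlgebra.antipode k

theorem antipode_antipode_mul (a b : H) : σ (σ (a * b)) = σ (σ a) * σ (σ b) := by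
  simp only [antipode_mul]

theorem dual_grouplike_antipode_antipode {χ : HDual k H} (hχ : IsGroupLikeElem k χ) (x : H) :
    χ (σ (σ x)) = χ x := by
  conv_rhs => rw [← _root_.IsGroupLikeElem.antipode_antipode hχ]
  simp

theorem ract_antipode_antipode {χ : HDual k H} (hχ : IsGroupLikeElem k χ) (x : H) :
    ract χ (σ (σ x)) = σ (σ (ract χ x)) := by
  rw [ract_apply, sw_antipode_antipode x (fun y1 y2 => χ y2 • y1), ract_apply,
    ← sw_map (q := fun t => σ (σ t)) (by fun_prop)]
  simp [dual_grouplike_antipode_antipode hχ]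

theorem lactH_antipode_antipode {χ : HDual k H} (hχ : IsGroupLikeElem k χ) (x : H) :
    lactH χ (σ (σ x)) = σ (σ (lactH χ x)) := by
  rw [lactH_apply, sw_antipode_antipode x (fun y1 y2 => χ y1 • y2), lactH_apply,
    ← sw_map (q := fun t => σ (σ t)) (by fun_prop)]
  simp [dual_grouplike_antipode_antipode hχ]

theorem ract_mul {χ : HDual k H} (hχ : IsGroupLikeElem k χ) (x y : H) :
    ract χ (x * y) = ract χ x * ract χ y := by
  have hm := (isGroupLikeElem_dual_iff.1 hχ).2
  rw [ract_apply, sw_mul x y (fun y1 y2 => χ y2 • y1), ract_apply,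
    ← sw_map (q := fun t => t * ract χ y) (by fun_prop)]
  congr; ext u v
  rw [ract_apply, ← sw_map (q := fun t => χ v • u * t) (by fun_prop)]
  simp [hm, smul_smul, mul_comm (χ v)]

theorem lactH_mul {χ : HDual k H} (hχ : IsGroupLikeElem k χ) (x y : H) :
    lactH χ (x * y) = lactH χ x * lactH χ y := by
  have hm := (isGroupLikeElem_dual_iff.1 hχ).2
  rw [lactH_apply, sw_mul x y (fun y1 y2 => χ y1 • y2), lactH_apply,
    ← sw_map (q := fun t => t * lactH χ y) (by fun_prop)]
  congr; ext u v
  rw [lactH_apply, ← sw_map (q := fun t => χ u • v * t) (by fun_prop)]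
  simp [hm, smul_smul, mul_comm (χ u)]

theorem ract_grouplike {a : H} (ha : IsGroupLikeElem k a) (q : HDual k H) : ract q a = q a • a :=
  sw_of_comul_eq_tmul ha.comul_eq_tmul_self (fun y1 y2 => q y2 • y1)

theorem lactH_grouplike {a : H} (ha : IsGroupLikeElem k a) (q : HDual k H) : lactH q a = q a • a :=
  sw_of_comul_eq_tmul ha.comul_eq_tmul_self (fun y1 y2 => q y1 • y2)

theorem ract_lactH (q r : HDual k H) (x : H) : ract q (lactH r x) = lactH r (ract q x) := by
  refine eq_of_dual (k := k) fun s => ?_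
  change HDual.of s _ = HDual.of s _
  rw [apply_ract, apply_lactH, apply_lactH, apply_ract, mul_assoc]

theorem ract_ract (q r : HDual k H) (x : H) : ract q (ract r x) = ract (q * r) x := by
  refine eq_of_dual (k := k) fun s => ?_
  change HDual.of s _ = HDual.of s _
  rw [apply_ract, apply_ract, apply_ract, mul_assoc]

theorem lactH_lactH (q r : HDual k H) (x : H) : lactH q (lactH r x) = lactH (r * q) x := by
  refine eq_of_dual (k := k) fun s => ?_
  change HDual.of s _ = HDual.of s _
  rw [apply_lactH, apply_lactH, apply_lactH, mul_assoc]

theorem ract_one (x : H) : ract (1 : HDual k H) x = x := sw_counit_right x (fun y => y)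
theorem lactH_one (x : H) : lactH (1 : HDual k H) x = x := sw_counit_left x (fun y => y)

namespace Frob
variable (F : Frob k H)

theorem sw_lam_left {M : Type*} [AddCommGroup M] [Module k M] (x : H) (f : H → M)
    (hf : IsLinearMap k f := by fun_prop) :
    sw k x (fun u v => F.lam u • f v) = F.lam x • f F.g := by
  have : sw k x (fun u v => F.lam u • v) = F.lam x • F.g := by
    refine eq_of_dual (k := k) fun q => ?_
    have := congrArg (fun r : HDual k H => r x) (F.lam_mul (HDual.of q))
    simp only [HDual.mul_apply, HDual.smul_apply, HDual.of_apply] at this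
    rw [map_sw]; simp only [map_smul, smul_eq_mul]; rw [this, mul_comm]
  rw [← hf.map_smul, ← this, ← sw_map hf]; simp only [hf.map_smul]

/-- `∑ λ(a₁ b) a₂ = ∑ λ(a b₁) g S(b₂)`. -/
theorem slide {M : Type*} [AddCommGroup M] [Module k M] (a b : H) (f : H → M)
    (hf : IsLinearMap k f := by fun_prop) :
    sw k a (fun u v => F.lam (u * b) • f v) = sw k b (fun u v => F.lam (a * u) • f (F.g * σ v)) := by
  have e : ∀ u v : H, F.lam (a * u) • f (F.g * σ v) =
      sw k u (fun u1 u2 => sw k a (fun a1 a2 => F.lam (a1 * u1) • f (a2 * (u2 * σ v)))) := fun u v => by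
    have := F.sw_lam_left (a * u) (fun x => f (x * σ v))
    rw [sw_mul a u (fun x y => F.lam x • f (y * σ v)), sw_comm] at this
    simp only [← mul_assoc, this]
  simp only [e]
  rw [sw_assoc b (fun u1 u2 v => sw k a (fun a1 a2 => F.lam (a1 * u1) • f (a2 * (u2 * σ v))))]
  have e2 : ∀ u1 x : H, sw k x (fun u2 v => sw k a (fun a1 a2 => F.lam (a1 * u1) • f (a2 * (u2 * σ v)))) =
      ε x • sw k a (fun a1 a2 => F.lam (a1 * u1) • f a2) := fun u1 x => by
    simpa using sw_mul_antipode x (fun t => sw k a (fun a1 a2 => F.lam (a1 * u1) • f (a2 * t)))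
  simp only [e2]
  rw [sw_counit_right b (fun u1 => sw k a (fun a1 a2 => F.lam (a1 * u1) • f a2))]

/-- A Nakayama element for `a`. -/
theorem exists_nakayama (a : H) : ∃ n, ∀ b, F.lam (b * n) = F.lam (a * b) :=
  exists_of_nondeg F.lam (fun _ => F.nondeg_right) (HDual.lact a F.lam)

theorem ract_nakayama {a n : H} (h : ∀ b, F.lam (b * n) = F.lam (a * b)) :
    ract F.alpha n = σ (σ a) := by
  have h1 := cointegral_slide F.mul_lam F.Lam n (fun u => u)
  simp only [← alpha_apply] at h1
  rw [ract_apply, h1, F.antipode_eq a, ← sw_map (q := fun t => σ t) (by fun_prop)]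
  simp [h]

theorem eq_g_mul (a : H) : a = sw k F.Lam (fun u v => F.lam (a * u) • (F.g * σ v)) := by
  rw [← F.slide a F.Lam (fun u => u)]
  simp only [F.lam_mul_Lam]
  rw [sw_counit_left a (fun u => u)]

theorem lactH_nakayama {a n : H} (h : ∀ b, F.lam (b * n) = F.lam (a * b)) :
    a = F.g * σ (σ (lactH F.alpha n)) * σ F.g := by
  have h1 := F.slide F.Lam n (fun u => F.g * σ u)
  simp only [h, ← alpha_apply] at h1
  conv_lhs => rw [F.eq_g_mul a, h1]
  rw [lactH_apply, ← sw_map (q := fun t => F.g * σ (σ t) * σ F.g) (by fun_prop)]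
  simp [antipode_mul, mul_assoc]

theorem antipode_g_mul : σ F.g * F.g = 1 := F.isGroupLikeElem_g.antipode_mul_cancel

/-- Radford's formula for the fourth power of the antipode. -/
theorem radford (a : H) :
    ract F.alpha a = F.g * σ (σ (σ (σ (lactH F.alpha a)))) * σ F.g := by
  obtain ⟨n, hn⟩ := F.exists_nakayama a
  have hα := F.isGroupLikeElem_alpha
  conv_lhs => rw [F.lactH_nakayama hn]
  rw [ract_mul hα, ract_mul hα, ract_antipode_antipode hα, ract_lactH, F.ract_nakayama hn,
    lactH_antipode_antipode hα, ract_grouplike F.isGroupLikeElem_g,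
    ract_grouplike F.isGroupLikeElem_g.antipode]
  simp only [smul_mul_assoc, mul_smul_comm, smul_smul]
  have : F.alpha (σ F.g) * F.alpha F.g = 1 := by
    rw [← F.alpha_mul, F.antipode_g_mul, F.alpha_one]
  rw [this, one_smul]

end Frob
end radford
end Hopf

namespace Hopf
section maschke
variable {k : Type*} [Field k] {H : Type*} [Ring H] [HopfAlgebra k H] [FiniteDimensional k H]

local notation "ε" => Coalgebra.counit (R := k)
local notation "σ" => HopfAlgebra.antipode k

theorem integral_slide {M : Type*} [AddCommGroup M] [Module k M] {t : H} (ht : ∀ a, a * t = ε a • t) (a : H)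
    (f : H → H → M) (h1 : ∀ y, IsLinearMap k (fun x => f x y) := by fun_prop)
    (h2 : ∀ x, IsLinearMap k (fun y => f x y) := by fun_prop) :
    sw k t (fun u v => f u (σ v * a)) = sw k t (fun u v => f (a * u) (σ v)) := by
  have e : ∀ x b : H, sw k x (fun u v => sw k t (fun u' v' => f (u * u') (σ (v * v') * b))) =
      ε x • sw k t (fun u v => f u (σ v * b)) := fun x b => by
    rw [← sw_mul x t (fun u v => f u (σ v * b)), ht,
      (lin_sw (fun u v => f u (σ v * b)) (by fun_prop) (by fun_prop)).map_smul]
  rw [← sw_counit_left a (fun a' => sw k t (fun u v => f u (σ v * a')))]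
  simp only [← e]
  rw [sw_assoc a (fun a1 a2 a3 => sw k t (fun u' v' => f (a1 * u') (σ (a2 * v') * a3)))]
  have e2 : ∀ a1 x : H, sw k x (fun a2 a3 => sw k t (fun u' v' => f (a1 * u') (σ (a2 * v') * a3))) =
      ε x • sw k t (fun u' v' => f (a1 * u') (σ v')) := fun a1 x => by
    simpa [antipode_mul, mul_assoc] using
      sw_antipode_mul x (fun s => sw k t (fun u' v' => f (a1 * u') (σ v' * s)))
  simp only [e2]
  rw [sw_counit_right a (fun a1 => sw k t (fun u' v' => f (a1 * u') (σ v')))]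

/-- Maschke's theorem. -/
theorem isSemisimpleRing_of_integral {t : H} (ht : ∀ a, a * t = ε a • t) (h0 : ε t ≠ 0) :
    IsSemisimpleRing H := by
  refine (isSemisimpleModule_iff H H).2 ⟨fun N => ?_⟩
  obtain ⟨π, hπ⟩ := LinearMap.exists_leftInverse_of_injective (N.restrictScalars k).subtype
    (Submodule.ker_subtype _)
  have hπ' : ∀ x (hx : x ∈ N), (π x : H) = x := fun x hx => congrArg Subtype.val (DFunLike.congr_fun hπ ⟨x, hx⟩)
  let q : H →ₗ[k] H := (N.restrictScalars k).subtype ∘ₗ π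
  have hqN : ∀ x, q x ∈ N := fun x => (π x).2
  let P : H →ₗ[H] H :=
    { toFun := fun m => (ε t)⁻¹ • sw k t (fun u v => u * q (σ v * m))
      map_add' := fun x y => by simp only [mul_add, map_add, sw_add, smul_add]
      map_smul' := fun a x => by
        have := integral_slide ht a (fun u v => u * q (v * x))
        simp only [smul_eq_mul, RingHom.id_apply, ← mul_assoc, this]
        rw [mul_smul_comm, ← sw_map (q := fun s => a * s) (by fun_prop)]
        simp only [mul_assoc] }
  have hP : ∀ m, P m = (ε t)⁻¹ • sw k t (fun u v => u * q (σ v * m)) := fun _ => rfl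
  have hPN : ∀ m, P m ∈ N := fun m => by
    rw [hP]
    exact (N.restrictScalars k).smul_mem _ (Submodule.sum_mem _ fun i _ => N.smul_mem _ (hqN _))
  refine ⟨LinearMap.ker (P.codRestrict N hPN), LinearMap.isCompl_of_proj fun x => Subtype.ext ?_⟩
  rw [LinearMap.codRestrict_apply, hP]
  have : ∀ v : H, q (σ v * x) = σ v * x := fun v => hπ' _ (N.smul_mem _ x.2)
  simp only [this, ← mul_assoc]
  rw [sw_mul_antipode t (fun s => s * (x : H))]
  simp [smul_smul, h0]

theorem Frob.isSemisimpleRing (F : Frob k H) (h : ε F.Lam ≠ 0) : IsSemisimpleRing H :=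
  isSemisimpleRing_of_integral F.mul_Lam h

theorem Frob.alpha_eq_one (F : Frob k H) (h : ε F.Lam ≠ 0) : F.alpha = 1 := by
  ext x
  have := congrArg (fun a => ε a) (F.Lam_mul x)
  simp only [Bialgebra.counit_mul, map_smul, smul_eq_mul] at this
  rw [HDual.one_apply]
  rw [mul_comm] at this
  exact (mul_right_cancel₀ h this).symm

theorem Frob.counit_Lam_ne_zero (F : Frob k H) {t : H} (ht : ∀ a, a * t = ε a • t) (h0 : ε t ≠ 0) :
    ε F.Lam ≠ 0 := by
  intro h
  rw [F.eq_smul_Lam ht] at h0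
  simp [h] at h0

end maschke
end Hopf

namespace Hopf
section prj
variable {k : Type*} [Field k] [CharZero k] {A : Type*} [Ring A] [Algebra k A]

/-- The spectral projection of `v` for the eigenvalue `ω ^ m`. -/
noncomputable def prj (ω : k) (M : ℕ) (v : A) (m : ℕ) : A :=
  (M : k)⁻¹ • ∑ j ∈ Finset.range M, ω⁻¹ ^ (m * j) • v ^ j

variable {ω : k} {M : ℕ} {v : A}

theorem mul_prj (hM : 0 < M) (hω : ω ^ M = 1) (hv : v ^ M = 1) (m : ℕ) :
    v * prj ω M v m = ω ^ m • prj ω M v m := by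
  have hω0 : ω ≠ 0 := by rintro rfl; simp [hM.ne'] at hω
  have h : ∑ j ∈ Finset.range M, ω⁻¹ ^ (m * (j + 1)) • v ^ (j + 1) =
      ∑ j ∈ Finset.range M, ω⁻¹ ^ (m * j) • v ^ j := by
    have h1 := Finset.sum_range_succ (fun j => ω⁻¹ ^ (m * j) • v ^ j) M
    rw [Finset.sum_range_succ', hv] at h1
    have : ω⁻¹ ^ (m * M) = 1 := by rw [mul_comm, pow_mul, inv_pow, hω]; simp
    rw [this] at h1
    simpa using h1
  rw [prj, mul_smul_comm, smul_comm (ω ^ m)]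
  conv_rhs => rw [← h]
  rw [Finset.mul_sum, Finset.smul_sum (r := ω ^ m)]
  congr 1
  refine Finset.sum_congr rfl fun j _ => ?_
  rw [mul_smul_comm, ← pow_succ', smul_smul]
  congr 1
  rw [mul_add, mul_one, pow_add, mul_left_comm, ← mul_pow, mul_inv_cancel₀ hω0, one_pow, mul_one]

theorem pow_mul_prj (hM : 0 < M) (hω : ω ^ M = 1) (hv : v ^ M = 1) (m i : ℕ) :
    v ^ i * prj ω M v m = ω ^ (m * i) • prj ω M v m := by
  induction i with
  | zero => simp
  | succ i ih => rw [pow_succ, mul_assoc, mul_prj hM hω hv, mul_smul_comm, ih, smul_smul]; ring_nf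

theorem prj_mul_prj (hM : 0 < M) (hω : ω ^ M = 1) (hv : v ^ M = 1) (m : ℕ) :
    prj ω M v m * prj ω M v m = prj ω M v m := by
  have hω0 : ω ≠ 0 := by rintro rfl; simp [hM.ne'] at hω
  conv_lhs => enter [1]; rw [prj]
  rw [smul_mul_assoc, Finset.sum_mul]
  have : ∀ j, (ω⁻¹ ^ (m * j) • v ^ j) * prj ω M v m = prj ω M v m := fun j => by
    rw [smul_mul_assoc, pow_mul_prj hM hω hv, smul_smul, ← mul_pow, inv_mul_cancel₀ hω0, one_pow, one_smul]
  simp only [this, Finset.sum_const, Finset.card_range]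
  rw [← Nat.cast_smul_eq_nsmul k, smul_smul, inv_mul_cancel₀ (by exact_mod_cast hM.ne'), one_smul]

theorem sum_prj (hM : 0 < M) (hω : IsPrimitiveRoot ω M) : ∑ m ∈ Finset.range M, prj ω M v m = 1 := by
  simp only [prj, ← Finset.smul_sum]
  rw [Finset.sum_comm, Finset.sum_eq_single_of_mem 0 (by simpa using hM)]
  · simp only [mul_zero, pow_zero, one_smul, Finset.sum_const, Finset.card_range]
    rw [← Nat.cast_smul_eq_nsmul k, smul_smul, inv_mul_cancel₀ (by exact_mod_cast hM.ne'), one_smul]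
  · intro j hj hj0
    rw [← Finset.sum_smul]
    have h1 : ω⁻¹ ^ j ≠ 1 := fun h => hj0 (hω.inv.pow_inj (Finset.mem_range.1 hj) hM (by simpa using h))
    have h2 : ∑ m ∈ Finset.range M, ω⁻¹ ^ (m * j) = 0 := by
      have := mul_geom_sum (ω⁻¹ ^ j) M
      rw [← pow_mul, mul_comm j M, pow_mul, hω.inv.pow_eq_one, one_pow, sub_self] at this
      rw [← (mul_eq_zero.1 this).resolve_left (sub_ne_zero.2 h1)]
      exact Finset.sum_congr rfl fun m _ => by rw [← pow_mul, mul_comm]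
    rw [h2, zero_smul]

theorem pow_eq_sum_prj (hM : 0 < M) (hω : IsPrimitiveRoot ω M) (hv : v ^ M = 1) (i : ℕ) :
    v ^ i = ∑ m ∈ Finset.range M, ω ^ (m * i) • prj ω M v m := by
  simp only [← pow_mul_prj hM hω.pow_eq_one hv, ← Finset.mul_sum, sum_prj hM hω, mul_one]

end prj

section trace
variable {k : Type*} [Field k] [CharZero k] {V : Type*} [AddCommGroup V] [Module k V] [FiniteDimensional k V]

theorem exists_trace_idem {f : Module.End k V} (hf : f * f = f) :
    ∃ n : ℕ, LinearMap.trace k V f = n :=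
  ⟨_, (LinearMap.IsIdempotentElem.isProj_range f hf).trace⟩

theorem exists_trace_pow {ω : k} {M : ℕ} (hM : 0 < M) (hω : IsPrimitiveRoot ω M) {f : Module.End k V}
    (hf : f ^ M = 1) : ∃ r : ℕ → ℕ, ∀ i,
      LinearMap.trace k V (f ^ i) = ∑ m ∈ Finset.range M, (r m : k) * ω ^ (m * i) := by
  choose r hr using fun m => exists_trace_idem (prj_mul_prj (v := f) hM hω.pow_eq_one hf m)
  refine ⟨r, fun i => ?_⟩
  conv_lhs => rw [pow_eq_sum_prj hM hω hf i, map_sum]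
  simp [hr, mul_comm]

end trace

section cyclotomic
variable {k : Type*} [Field k] [CharZero k]
open Polynomial

theorem aeval_eq_zero_transfer {L : Type*} [Field L] [CharZero L] {M : ℕ} (hM : 0 < M) {ω : k} {ζ : L}
    (hω : IsPrimitiveRoot ω M) (hζ : IsPrimitiveRoot ζ M) {P : ℤ[X]} (h : aeval ω P = 0) :
    aeval ζ P = 0 := by
  have := minpoly.isIntegrallyClosed_dvd (hω.isIntegral hM) h
  rw [← cyclotomic_eq_minpoly hω hM, cyclotomic_eq_minpoly hζ hM] at this
  exact (minpoly.isIntegrallyClosed_dvd_iff (hζ.isIntegral hM) P).2 this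

/-- Positivity: a vanishing sum of norms `P(ω) P(ω⁻¹)` has vanishing terms. -/
theorem eq_zero_of_sum_norm {ι : Type*} (s : Finset ι) {M : ℕ} (hM : 0 < M) {ω : k}
    (hω : IsPrimitiveRoot ω M) (P : ι → ℤ[X])
    (h : ∑ i ∈ s, aeval ω (P i) * aeval (ω ^ (M - 1)) (P i) = 0) : ∀ i ∈ s, aeval ω (P i) = 0 := by
  have hζ := Complex.isPrimitiveRoot_exp M hM.ne'
  set ζ := Complex.exp (2 * Real.pi * Complex.I / M)
  have h1 : aeval ω (∑ i ∈ s, P i * (P i).comp (X ^ (M - 1))) = 0 := by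
    rw [map_sum, ← h]
    exact Finset.sum_congr rfl fun i _ => by rw [map_mul, aeval_comp]; simp
  have h2 := aeval_eq_zero_transfer hM hω hζ h1
  have hconj : ζ ^ (M - 1) = (starRingEnd ℂ) ζ := by
    have h3 : ζ * ζ ^ (M - 1) = 1 := by rw [← pow_succ', Nat.sub_add_cancel hM, hζ.pow_eq_one]
    have h4 : ζ * (starRingEnd ℂ) ζ = 1 := by
      rw [Complex.mul_conj, Complex.normSq_eq_norm_sq, hζ.norm'_eq_one hM.ne']; simp
    exact mul_left_cancel₀ (hζ.ne_zero hM.ne') (h3.trans h4.symm)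
  have h5 : ∀ Q : ℤ[X], aeval ζ (Q * Q.comp (X ^ (M - 1))) = ((Complex.normSq (aeval ζ Q) : ℝ) : ℂ) := fun Q => by
    rw [map_mul, aeval_comp, ← Complex.mul_conj]
    congr 1
    simp only [map_pow, aeval_X]
    rw [hconj]
    simp only [aeval_eq_sum_range, map_sum, map_zsmul, map_pow]
  rw [map_sum] at h2
  simp only [h5] at h2
  rw [← Complex.ofReal_sum, Complex.ofReal_eq_zero, Finset.sum_eq_zero_iff_of_nonneg
    fun _ _ => Complex.normSq_nonneg _] at h2
  intro i hi
  exact aeval_eq_zero_transfer hM hζ hω (Complex.normSq_eq_zero.1 (h2 i hi))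

end cyclotomic
end Hopf

namespace Hopf
section matrix
variable {k : Type*} [Field k] {ι : Type*} [Fintype ι] [DecidableEq ι] {d : ι → ℕ}

/-- Matrix units of a product of matrix algebras. -/
def munit (k : Type*) [Field k] (d : ι → ℕ) (i : ι) (p q : Fin (d i)) : Π i, Matrix (Fin (d i)) (Fin (d i)) k :=
  Pi.single i (Matrix.single p q 1)

theorem munit_mul_same (i : ι) (p q r s : Fin (d i)) :
    munit k d i p q * munit k d i r s = if q = r then munit k d i p s else 0 := by
  rw [munit, munit, ← Pi.single_mul]
  split_ifs with h
  · subst h; simp [munit]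
  · simp [h]

theorem eq_sum_munit (x : Π i, Matrix (Fin (d i)) (Fin (d i)) k) :
    x = ∑ i, ∑ p, ∑ q, x i p q • munit k d i p q := by
  funext i
  conv_lhs => rw [Matrix.matrix_eq_sum_single (x i)]
  rw [Finset.sum_apply, Finset.sum_eq_single i]
  · simp [munit, Finset.sum_apply, Matrix.smul_single]
  · intro j _ hj
    simp [munit, Finset.sum_apply, Pi.single_apply, hj.symm]
  · simp

theorem tracial_eq_sum [∀ i, NeZero (d i)] (f : (Π i, Matrix (Fin (d i)) (Fin (d i)) k) →ₗ[k] k)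
    (hf : ∀ x y, f (x * y) = f (y * x)) (x : Π i, Matrix (Fin (d i)) (Fin (d i)) k) :
    f x = ∑ i, f (munit k d i 0 0) * (x i).trace := by
  have h : ∀ i p q, f (munit k d i p q) = if p = q then f (munit k d i 0 0) else 0 := fun i p q => by
    have h1 : munit k d i p q = munit k d i p 0 * munit k d i 0 q := by rw [munit_mul_same, if_pos rfl]
    rw [h1, hf, munit_mul_same]
    by_cases hpq : p = q
    · simp [hpq]
    · simp [hpq, Ne.symm hpq]
  generalize hc : (fun i => f (munit k d i 0 0)) = c at *
  replace h : ∀ i p q, f (munit k d i p q) = if p = q then c i else 0 := by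
    subst hc; exact h
  have hc' : ∀ i, f (munit k d i 0 0) = c i := fun i => by rw [← hc]
  conv_lhs => rw [eq_sum_munit x]
  simp only [map_sum, map_smul, h, hc']
  refine Finset.sum_congr rfl fun i _ => ?_
  simp [Matrix.trace, Finset.mul_sum, mul_comm]

/-- The basis of matrix units. -/
noncomputable def munitBasis (k : Type*) [Field k] (d : ι → ℕ) :
    Module.Basis (Σ i, Fin (d i) × Fin (d i)) k (Π i, Matrix (Fin (d i)) (Fin (d i)) k) :=
  Pi.basis fun i => Matrix.stdBasis k (Fin (d i)) (Fin (d i))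

theorem munitBasis_repr (x : Π i, Matrix (Fin (d i)) (Fin (d i)) k) (s : Σ i, Fin (d i) × Fin (d i)) :
    (munitBasis k d).repr x s = x s.1 s.2.1 s.2.2 := by
  simp [munitBasis, Pi.basis_repr, Matrix.stdBasis]

theorem munitBasis_apply (s : Σ i, Fin (d i) × Fin (d i)) :
    munitBasis k d s = munit k d s.1 s.2.1 s.2.2 := by
  rw [munitBasis, Pi.basis_apply, munit, Matrix.stdBasis_eq_single]

theorem trace_mul_mul (u v : Π i, Matrix (Fin (d i)) (Fin (d i)) k) :
    LinearMap.trace k _ (LinearMap.mulLeft k u ∘ₗ LinearMap.mulRight k v) =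
      ∑ i, (u i).trace * (v i).trace := by
  rw [LinearMap.trace_eq_matrix_trace k (munitBasis k d), Matrix.trace]
  simp only [Matrix.diag_apply, LinearMap.toMatrix_apply, munitBasis_repr, munitBasis_apply]
  rw [Fintype.sum_sigma]
  refine Finset.sum_congr rfl fun i _ => ?_
  rw [Fintype.sum_prod_type, Matrix.trace, Matrix.trace, Finset.sum_mul_sum]
  refine Finset.sum_congr rfl fun p _ => Finset.sum_congr rfl fun q _ => ?_
  simp only [LinearMap.comp_apply, LinearMap.mulLeft_apply, LinearMap.mulRight_apply, munit, Pi.mul_apply,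
    Pi.single_eq_same]
  simp [Matrix.mul_apply, Matrix.single_apply, Finset.sum_ite_eq, ite_and, Finset.sum_mul, Finset.mul_sum]
end matrix
end Hopf

namespace Hopf
section larson
variable {k : Type*} [Field k] {H : Type*} [Ring H] [HopfAlgebra k H] [FiniteDimensional k H]

local notation "ε" => Coalgebra.counit (R := k)
local notation "σ" => HopfAlgebra.antipode k

theorem exists_pow_eq_one {a : H} (ha : IsGroupLikeElem k a) : ∃ N, 0 < N ∧ a ^ N = 1 := by
  have hf : Finite (GroupLike k H) := (linearIndep_groupLikeVal (R := k) (A := H)).finite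
  obtain ⟨N, hN, h⟩ := (isOfFinOrder_of_finite (⟨a, ha⟩ : GroupLike k H)).exists_pow_eq_one
  refine ⟨N, hN, ?_⟩
  simpa using congrArg GroupLike.val h

theorem matrix_trace_root [IsAlgClosed k] [CharZero k] {m M : ℕ} (hm : NeZero m) (hM : 0 < M)
    {ω : k} (hω : IsPrimitiveRoot ω M) {u v : Matrix (Fin m) (Fin m) k} (huv : u * v = 1)
    (hc : ∀ y, u ^ M * y = y * u ^ M) :
    ∃ (r : k) (P : Polynomial ℤ), r ≠ 0 ∧ u.trace = r * Polynomial.aeval ω P ∧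
      v.trace = r⁻¹ * Polynomial.aeval (ω ^ (M - 1)) P := by
  obtain ⟨c, hc⟩ := Matrix.mem_range_scalar_of_commute_single (M := u ^ M) fun i j _ => (hc _).symm
  have hvu : v * u = 1 := mul_eq_one_comm.mp huv
  have hc0 : c ≠ 0 := by
    rintro rfl
    have h1 : u ^ M * v ^ M = 1 := by
      rw [← (show Commute u v from huv.trans hvu.symm).mul_pow, huv, one_pow]
    rw [← hc] at h1
    have h2 := congrFun (congrFun h1 0) 0
    simp at h2
  obtain ⟨r, hr⟩ := IsAlgClosed.exists_pow_nat_eq c hM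
  have hr0 : r ≠ 0 := by rintro rfl; rw [zero_pow hM.ne'] at hr; exact hc0 hr.symm
  set w := r⁻¹ • u with hw
  have hwM : w ^ M = 1 := by
    rw [hw, smul_pow, ← hc, ← hr, inv_pow, Matrix.scalar_apply, ← Matrix.smul_one_eq_diagonal, smul_smul,
      inv_mul_cancel₀ (pow_ne_zero _ hr0), one_smul]
  have hu : u = r • w := by rw [hw, smul_smul, mul_inv_cancel₀ hr0, one_smul]
  have hv : v = r⁻¹ • w ^ (M - 1) := by
    have h1 : u * (r⁻¹ • w ^ (M - 1)) = 1 := by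
      rw [hu, smul_mul_smul_comm, mul_inv_cancel₀ hr0, one_smul, ← pow_succ', Nat.sub_add_cancel hM, hwM]
    calc v = v * (u * (r⁻¹ • w ^ (M - 1))) := by rw [h1, mul_one]
      _ = _ := by rw [← mul_assoc, hvu, one_mul]
  have hf : (Matrix.toLinAlgEquiv' w : Module.End k (Fin m → k)) ^ M = 1 := by
    rw [← map_pow, hwM, map_one]
  obtain ⟨q, hq⟩ := exists_trace_pow hM hω hf
  have hq' : ∀ i, (w ^ i).trace = ∑ s ∈ Finset.range M, (q s : k) * ω ^ (s * i) := fun i => by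
    rw [← hq i, ← map_pow]
    exact (Matrix.trace_toLin'_eq _).symm
  refine ⟨r, ∑ s ∈ Finset.range M, (q s : Polynomial ℤ) * Polynomial.X ^ s, hr0, ?_, ?_⟩
  · rw [hu, Matrix.trace_smul, smul_eq_mul]
    congr 1
    simpa using hq' 1
  · rw [hv, Matrix.trace_smul, smul_eq_mul]
    congr 1
    rw [hq']
    simp [← pow_mul, mul_comm]

variable [IsAlgClosed k] [CharZero k]

theorem Frob.lam_one_ne_zero (F : Frob k H) (h : ε F.Lam ≠ 0) : F.lam 1 ≠ 0 := by
  intro h1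
  have := F.isSemisimpleRing h
  have hα := F.alpha_eq_one h
  obtain ⟨n, d, hd, ⟨E⟩⟩ := IsSemisimpleRing.exists_algEquiv_pi_matrix_of_isAlgClosed k H
  let τ : HDual k H := HDual.of (∑ i, Matrix.traceLinearMap (Fin (d i)) k k ∘ₗ LinearMap.proj i ∘ₗ E.toLinearMap)
  have hτ : ∀ x, τ x = ∑ i, (E x i).trace := fun x => by
    change (∑ i, Matrix.traceLinearMap (Fin (d i)) k k ∘ₗ LinearMap.proj i ∘ₗ E.toLinearMap) x = _
    simp [LinearMap.sum_apply]
  have hcy : ∀ x y, τ (x * y) = τ (y * x) := fun x y => by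
    rw [hτ, hτ]
    refine Finset.sum_congr rfl fun i _ => ?_
    rw [map_mul, map_mul, Pi.mul_apply, Pi.mul_apply, Matrix.trace_mul_comm]
  have hnd : ∀ b, (∀ a, τ (a * b) = 0) → b = 0 := fun b hb => by
    rw [← map_eq_zero_iff E E.injective]
    funext i
    ext s t
    have := hb (E.symm (munit k d i t s))
    rw [hτ, Finset.sum_eq_single i] at this
    · simpa [munit, Matrix.trace, Matrix.mul_apply, Matrix.single_apply, Finset.sum_ite_eq, ite_and] using this
    · intro j _ hj
      simp [munit, hj]
    · simp
  obtain ⟨u, hu⟩ := exists_of_nondeg τ hnd F.lam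
  have hsu : ∀ a, σ (σ a) * u = u * a := fun a => by
    obtain ⟨m, hm⟩ := F.exists_nakayama a
    have hm2 := F.ract_nakayama hm
    rw [hα, ract_one] at hm2
    subst hm2
    rw [← sub_eq_zero]
    refine hnd _ fun b => ?_
    rw [mul_sub, map_sub, ← mul_assoc, hu, hm, ← mul_assoc, hcy, ← mul_assoc, hu, sub_self]
  have hinj : ∀ x, u * x = 0 → x = 0 := fun x hx => F.nondeg_left fun b => by
    rw [← hu, hcy, ← mul_assoc, hx, zero_mul, map_zero]
  obtain ⟨v, huv⟩ : ∃ v, u * v = 1 :=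
    (LinearMap.injective_iff_surjective (f := LinearMap.mulLeft k u)).mp
      ((injective_iff_map_eq_zero _).mpr hinj) 1
  have hvu : v * u = 1 := by
    rw [← sub_eq_zero]
    refine hinj _ ?_
    rw [mul_sub, ← mul_assoc, huv, one_mul, mul_one, sub_self]
  have hS : ∀ a, σ (σ a) = u * a * v := fun a => by rw [← hsu, mul_assoc, huv, mul_one]
  obtain ⟨N, hN, hgN⟩ := exists_pow_eq_one F.isGroupLikeElem_g
  have hgu : Commute F.g (u ^ 2) := by
    refine Commute.pow_right ?_ 2
    have := hsu F.g
    rwa [_root_.IsGroupLikeElem.antipode_antipode F.isGroupLikeElem_g] at this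
  have hcen : ∀ a, Commute (F.g * u ^ 2) a := fun a => by
    have h2 : σ (σ (σ (σ a))) * u ^ 2 = u ^ 2 * a := by
      rw [pow_two, ← mul_assoc, hsu, mul_assoc, hsu, mul_assoc]
    have h3 := F.radford a
    rw [hα, ract_one, lactH_one] at h3
    symm
    calc a * (F.g * u ^ 2) = (F.g * σ (σ (σ (σ a))) * σ F.g) * (F.g * u ^ 2) := by rw [← h3]
      _ = F.g * σ (σ (σ (σ a))) * (σ F.g * F.g) * u ^ 2 := by simp only [mul_assoc]
      _ = F.g * (σ (σ (σ (σ a))) * u ^ 2) := by rw [F.antipode_g_mul, mul_one, mul_assoc]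
      _ = F.g * u ^ 2 * a := by rw [h2, mul_assoc]
  have hcM : ∀ a, u ^ (2 * N) * a = a * u ^ (2 * N) := fun a => by
    have := (hcen a).pow_left N
    rwa [hgu.mul_pow, hgN, one_mul, ← pow_mul] at this
  have hM : 0 < 2 * N := by omega
  have : NeZero (2 * N) := ⟨hM.ne'⟩
  obtain ⟨ω, hω⟩ := HasEnoughRootsOfUnity.exists_primitiveRoot k (2 * N)
  have hblock : ∀ i, ∃ (r : k) (P : Polynomial ℤ), r ≠ 0 ∧ (E u i).trace = r * Polynomial.aeval ω P ∧
      (E v i).trace = r⁻¹ * Polynomial.aeval (ω ^ (2 * N - 1)) P := fun i => by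
    refine matrix_trace_root (hd i) hM hω ?_ ?_
    · rw [← Pi.mul_apply, ← map_mul, huv, map_one, Pi.one_apply]
    · intro y
      have := congrFun (congrArg E (hcM (E.symm (Pi.single i y)))) i
      simpa using this
  choose r P hr hP hQ using hblock
  have hsum : ∑ i, Polynomial.aeval ω (P i) * Polynomial.aeval (ω ^ (2 * N - 1)) (P i) = 0 := by
    have h2 := F.trace_mul_antipode_sq 1
    rw [h1, zero_mul] at h2
    have h3 : (fun a : H => 1 * σ (σ a)) = fun a => (LinearMap.mulLeft k u ∘ₗ LinearMap.mulRight k v) a := by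
      funext a
      rw [one_mul, hS]
      simp [mul_assoc]
    rw [h3, Tr_eq_trace] at h2
    rw [← LinearMap.trace_conj' _ E.toLinearEquiv] at h2
    have h4 : E.toLinearEquiv.conj (LinearMap.mulLeft k u ∘ₗ LinearMap.mulRight k v) =
        LinearMap.mulLeft k (E u) ∘ₗ LinearMap.mulRight k (E v) := by
      refine LinearMap.ext fun x => ?_
      simp [LinearEquiv.conj_apply]
    rw [h4, trace_mul_mul] at h2
    rw [← h2]
    refine Finset.sum_congr rfl fun i _ => ?_
    rw [hP, hQ]
    have := hr i
    field_simp
  have hz := eq_zero_of_sum_norm Finset.univ hM hω P hsum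
  have hεu : ε u = 0 := by
    have h2 := tracial_eq_sum (d := d) ((Coalgebra.counit : H →ₗ[k] k) ∘ₗ E.symm.toLinearMap) (fun x y => by
      simp [mul_comm]) (E u)
    simp only [LinearMap.comp_apply, AlgEquiv.toLinearMap_apply, AlgEquiv.symm_apply_apply] at h2
    rw [h2]
    refine Finset.sum_eq_zero fun i hi => ?_
    rw [hP, hz i hi, mul_zero, mul_zero]
  have h5 : ε u * ε v = 1 := by rw [← Bialgebra.counit_mul, huv, Bialgebra.counit_one]
  rw [hεu, zero_mul] at h5
  exact zero_ne_one h5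

theorem Frob.lam_one_ne_zero_iff (F : Frob k H) : F.lam 1 ≠ 0 ↔ ε F.Lam ≠ 0 :=
  ⟨fun h => F.dual.lam_one_ne_zero h, F.lam_one_ne_zero⟩

end larson
end Hopf

namespace Hopf
section lift
variable {k : Type*} [Field k] {M N P : Type*} [AddCommGroup M] [Module k M] [AddCommGroup N] [Module k N]
  [AddCommGroup P] [Module k P]

/-- The linear map on a tensor product induced by a bilinear function. -/
noncomputable def tlift (f : M → N → P) (h1 : ∀ y, IsLinearMap k (fun x => f x y) := by fun_prop)
    (h2 : ∀ x, IsLinearMap k (fun y => f x y) := by fun_prop) : M ⊗[k] N →ₗ[k] P :=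
  TensorProduct.lift (LinearMap.mk₂ k f (fun x x' y => (h1 y).map_add x x') (fun c x y => (h1 y).map_smul c x)
    (fun x y y' => (h2 x).map_add y y') (fun c x y => (h2 x).map_smul c y))

@[simp] theorem tlift_tmul (f : M → N → P) (h1 : ∀ y, IsLinearMap k (fun x => f x y))
    (h2 : ∀ x, IsLinearMap k (fun y => f x y)) (x : M) (y : N) : tlift f h1 h2 (x ⊗ₜ y) = f x y := rfl

@[fun_prop] theorem lin_algHom {A B : Type*} [Ring A] [Algebra k A] [Ring B] [Algebra k B] (ρ : A →ₐ[k] B) :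
    IsLinearMap k (fun x => ρ x) := ρ.toLinearMap.isLinear

end lift

section chr
variable {k : Type*} [Field k] {H : Type*} [Ring H] [HopfAlgebra k H] [FiniteDimensional k H]
  {V : Type*} [AddCommGroup V] [Module k V] [FiniteDimensional k V]

local notation "ε" => Coalgebra.counit (R := k)
local notation "σ" => HopfAlgebra.antipode k

/-- The character of a representation. -/
noncomputable def chr (ρ : H →ₐ[k] Module.End k V) : HDual k H :=
  HDual.of (LinearMap.trace k V ∘ₗ ρ.toLinearMap)

theorem chr_apply (ρ : H →ₐ[k] Module.End k V) (x : H) : chr ρ x = LinearMap.trace k V (ρ x) := rfl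

theorem chr_one (ρ : H →ₐ[k] Module.End k V) : chr ρ 1 = Module.finrank k V := by
  rw [chr_apply, map_one]; exact LinearMap.trace_one k V

theorem chr_mul_comm (ρ : H →ₐ[k] Module.End k V) (x y : H) : chr ρ (x * y) = chr ρ (y * x) := by
  rw [chr_apply, chr_apply, map_mul ρ, map_mul ρ, LinearMap.trace_mul_comm]

theorem chr_lmul_apply (x : H) : chr (Algebra.lmul k H) x = LinearMap.trace k H (LinearMap.mulLeft k x) := rfl

/-- Tensoring any module with the regular module gives a free module. -/
theorem chr_lmul_mul (ρ : H →ₐ[k] Module.End k V) :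
    chr (Algebra.lmul k H) * chr ρ = (Module.finrank k V : k) • chr (Algebra.lmul k H) := by
  ext x
  let Φ : Module.End k (H ⊗[k] V) :=
    tlift (fun a v => sw k a fun u w => u ⊗ₜ[k] ρ w v) (by fun_prop) (by fun_prop)
  let Ψ : Module.End k (H ⊗[k] V) :=
    tlift (fun a v => sw k a fun u w => u ⊗ₜ[k] ρ (σ w) v) (by fun_prop) (by fun_prop)
  let D : Module.End k (H ⊗[k] V) := sw k x fun u w => TensorProduct.map (LinearMap.mulLeft k u) (ρ w)
  let L : Module.End k (H ⊗[k] V) := TensorProduct.map (LinearMap.mulLeft k x) LinearMap.id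
  have hD : ∀ t, D t = sw k x fun u w => TensorProduct.map (LinearMap.mulLeft k u) (ρ w) t := fun t =>
    map_sw (LinearMap.applyₗ t) x _
  have h1 : D * Φ = Φ * L := by
    refine TensorProduct.ext' fun a v => ?_
    rw [Module.End.mul_apply, Module.End.mul_apply, hD]
    simp only [Φ, L, tlift_tmul, map_sw, TensorProduct.map_tmul, LinearMap.mulLeft_apply, LinearMap.id_apply]
    rw [sw_mul x a (fun u w => u ⊗ₜ[k] ρ w v)]
    simp only [map_mul, Module.End.mul_apply]
  have h2 : Ψ * Φ = 1 := by
    refine TensorProduct.ext' fun a v => ?_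
    rw [Module.End.mul_apply]
    simp only [Φ, Ψ, tlift_tmul, map_sw]
    rw [sw_assoc a (fun u w z => u ⊗ₜ[k] ρ (σ w) (ρ z v))]
    simp only [← Module.End.mul_apply, ← map_mul]
    have h3 : ∀ u y : H, sw k y (fun w z => u ⊗ₜ[k] (ρ (σ w * z)) v) = ε y • (u ⊗ₜ[k] v) := fun u y => by
      rw [sw_antipode_mul (k := k) y (fun t => u ⊗ₜ[k] ρ t v)]; simp
    simp only [h3]
    exact sw_counit_right a (fun u => u ⊗ₜ[k] v)
  have h3 : Φ * Ψ = 1 := mul_eq_one_comm.mp h2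
  have h4 : LinearMap.trace k _ D = LinearMap.trace k _ L := by
    calc LinearMap.trace k _ D = LinearMap.trace k _ (D * Φ * Ψ) := by rw [mul_assoc, h3, mul_one]
      _ = _ := by rw [h1, LinearMap.trace_mul_comm, ← mul_assoc, h2, one_mul]
  have h5 : LinearMap.trace k _ D = sw k x fun u w => chr (Algebra.lmul k H) u * chr ρ w := by
    refine (map_sw (M := Module.End k (H ⊗[k] V)) (N := k) (LinearMap.trace k (H ⊗[k] V)) x _).trans ?_
    simp only [LinearMap.trace_tensorProduct', chr_apply]; rfl
  rw [HDual.mul_apply, ← h5, h4, LinearMap.trace_tensorProduct', HDual.smul_apply, mul_comm]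
  rw [LinearMap.trace_id]; rfl
end chr
end Hopf

namespace Hopf
section idem
variable {k : Type*} [Field k] [CharZero k] {V : Type*} [AddCommGroup V] [Module k V] [FiniteDimensional k V]

theorem eq_zero_of_idem_of_trace {f : Module.End k V} (hf : f * f = f) (h : LinearMap.trace k V f = 0) :
    f = 0 := by
  rw [(LinearMap.IsIdempotentElem.isProj_range f hf).trace, Nat.cast_eq_zero,
    Submodule.finrank_eq_zero] at h
  exact LinearMap.range_eq_bot.mp h

theorem half_add_idem {A : Type*} [Ring A] [Algebra k A] {e s : A} (he : e * e = e) (h1 : e * s = s) (h2 : s * e = s)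
    (hs : s * s = e) : ((2 : k)⁻¹ • (e + s)) * ((2 : k)⁻¹ • (e + s)) = (2 : k)⁻¹ • (e + s) := by
  rw [smul_mul_smul_comm, mul_add, add_mul, add_mul, he, h1, h2, hs, add_comm s e, ← two_smul k (e + s), smul_smul]
  congr 1
  norm_num

theorem half_sub_idem {A : Type*} [Ring A] [Algebra k A] {e s : A} (he : e * e = e) (h1 : e * s = s) (h2 : s * e = s)
    (hs : s * s = e) : ((2 : k)⁻¹ • (e - s)) * ((2 : k)⁻¹ • (e - s)) = (2 : k)⁻¹ • (e - s) := by
  have := half_add_idem (k := k) (e := e) (s := -s) he (by rw [mul_neg, h1]) (by rw [neg_mul, h2])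
    (by rw [neg_mul_neg, hs])
  simpa only [sub_eq_add_neg] using this
end idem

section antipode
variable {k : Type*} [Field k] {H : Type*} [Ring H] [HopfAlgebra k H] [FiniteDimensional k H]

local notation "ε" => Coalgebra.counit (R := k)
local notation "σ" => HopfAlgebra.antipode k

theorem exists_ev (φ : HDual k (HDual k H)) : ∃ x, ∀ q, φ q = q x := by
  obtain ⟨x, hx⟩ := (Module.evalEquiv k H).surjective φ.toLin
  exact ⟨x, fun q => (LinearMap.congr_fun hx q.toLin).symm⟩

theorem eq_of_hdual {x y : H} (h : ∀ q : HDual k H, q x = q y) : x = y :=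
  eq_of_dual (k := k) fun q => h (HDual.of q)

theorem chr_lmul_antipode_antipode (h4 : ∀ a : H, σ (σ (σ (σ a))) = a) (a : H) :
    chr (Algebra.lmul k H) (σ (σ a)) = chr (Algebra.lmul k H) a := by
  let e : Module.End k H := (HopfAlgebra.antipode k) ∘ₗ (HopfAlgebra.antipode k)
  have he : e * e = 1 := LinearMap.ext h4
  have h5 : LinearMap.mulLeft k (σ (σ a)) = e * LinearMap.mulLeft k a * e := LinearMap.ext fun r => by
    simp [e, antipode_antipode_mul, h4]
  rw [chr_lmul_apply, chr_lmul_apply, h5, LinearMap.trace_mul_comm, ← mul_assoc, he, one_mul]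

variable [IsAlgClosed k] [CharZero k] (F : Frob k H)

theorem Frob.g_eq_one (h : ε F.Lam ≠ 0) : F.g = 1 := by
  refine eq_of_hdual (k := k) fun q => ?_
  have h1 := congrArg (fun r : HDual k H => r 1) (F.lam_mul q)
  simp only [HDual.smul_apply, HDual.mul_apply] at h1
  rw [sw_one (k := k) (fun u v => F.lam u * q v), mul_comm] at h1
  exact (mul_right_cancel₀ (F.lam_one_ne_zero h) h1).symm

theorem Frob.antipode_pow_four (h1 : F.alpha = 1) (h2 : F.g = 1) (a : H) : σ (σ (σ (σ a))) = a := by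
  have h3 := F.radford a
  rw [h1, h2, ract_one, lactH_one, one_mul, HopfAlgebra.antipode_one, mul_one] at h3
  exact h3.symm

theorem Frob.antipode_antipode (h : ε F.Lam ≠ 0) (a : H) : σ (σ a) = a := by
  have h4 := F.antipode_pow_four (F.alpha_eq_one h) (F.g_eq_one h)
  set n := Module.finrank k H with hn
  have hn0 : (n : k) ≠ 0 := by
    rw [Nat.cast_ne_zero, hn]
    have : Nontrivial H := ⟨F.Lam, 0, fun h0 => h (by rw [h0, map_zero])⟩
    exact Module.finrank_pos.ne'
  obtain ⟨x, hx⟩ := exists_ev (chr (Algebra.lmul k (HDual k H)))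
  have hxx : x * x = (n : k) • x := eq_of_hdual (k := k) fun q => by
    rw [map_smul]
    rw [← HDual.sw_ev_ev]
    simp only [← hx]
    rw [← HDual.mul_apply, chr_lmul_mul, HDual.finrank_eq]
    simp [hn]
  let s : Module.End k H := (HopfAlgebra.antipode k) ∘ₗ (HopfAlgebra.antipode k)
  have hs : ∀ y, s y = σ (σ y) := fun y => rfl
  have hss : s * s = 1 := LinearMap.ext fun y => h4 y
  have hsx : σ (σ x) = x := eq_of_hdual (k := k) fun q => by
    rw [← HDual.antipode_apply, ← HDual.antipode_apply, ← hx, ← hx]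
    exact chr_lmul_antipode_antipode (fun r => HDual.ext fun z => by simp [h4]) q
  have hlx : F.lam x = F.lam 1 := by
    rw [← hx, chr_lmul_apply, ← Tr_eq_trace]
    have : (fun q => LinearMap.mulLeft k F.lam q) = fun q : HDual k H => q 1 • F.lam := by
      funext q
      rw [LinearMap.mulLeft_apply, F.lam_mul, F.g_eq_one h]
    rw [this, Tr_smul (fun q : HDual k H => q 1) (by fun_prop)]
  set L := LinearMap.mulLeft k x with hL
  have hT1 : LinearMap.trace k H (L * s) = F.lam 1 * ε F.Lam := by
    rw [← hlx, ← F.trace_mul_antipode_sq x, ← Tr_eq_trace]; rfl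
  have hT2 : LinearMap.trace k H s = F.lam 1 * ε F.Lam := by
    rw [← F.trace_mul_antipode_sq 1, ← Tr_eq_trace]
    simp only [one_mul]; rfl
  have hT0 : F.lam 1 * ε F.Lam ≠ 0 := mul_ne_zero (F.lam_one_ne_zero h) h
  have hLs : L * s = s * L := LinearMap.ext fun y => by
    simp [hL, hs, antipode_antipode_mul, hsx]
  have hLL : L * L = (n : k) • L := LinearMap.ext fun y => by
    simp [hL, ← mul_assoc, hxx]
  set π := (n : k)⁻¹ • L with hπ
  have hππ : π * π = π := by
    rw [hπ, smul_mul_smul_comm, hLL, smul_smul, mul_assoc, inv_mul_cancel₀ hn0, mul_one]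
  have hπs : π * s = s * π := by rw [hπ, smul_mul_assoc, mul_smul_comm, hLs]
  have i1 := half_add_idem (k := k) (e := π) (s := π * s) hππ (by rw [← mul_assoc, hππ])
    (by rw [hπs, mul_assoc, hππ]) (by rw [mul_assoc, ← mul_assoc s, ← hπs, mul_assoc, hss, mul_one, hππ])
  have i2 := half_add_idem (k := k) (e := (1 : Module.End k H)) (s := s) (one_mul _) (one_mul _) (mul_one _) hss
  have i3 := half_sub_idem (k := k) (e := (1 : Module.End k H)) (s := s) (one_mul _) (one_mul _) (mul_one _) hss
  obtain ⟨a0, ha0⟩ := exists_trace_idem hππ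
  obtain ⟨a1, ha1⟩ := exists_trace_idem i1
  obtain ⟨r, hr⟩ := exists_trace_idem i2
  obtain ⟨r', hr'⟩ := exists_trace_idem i3
  have htr1 : LinearMap.trace k H 1 = n := LinearMap.trace_one k H
  have h6 : LinearMap.trace k H (π * s) = (n : k)⁻¹ * (F.lam 1 * ε F.Lam) := by
    rw [hπ, smul_mul_assoc, map_smul, hT1, smul_eq_mul]
  rw [map_smul, map_add, smul_eq_mul] at ha1 hr
  rw [map_smul, map_sub, smul_eq_mul] at hr'
  rw [ha0, h6] at ha1
  rw [htr1, hT2] at hr hr'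
  generalize F.lam 1 * ε F.Lam = T at *
  have e1 : ((r : ℤ) + r' : ℤ) = (n : ℤ) := by
    have : ((r + r' : ℕ) : k) = (n : ℕ) := by push_cast; rw [← hr, ← hr']; ring
    exact_mod_cast this
  have e2 : ((r : ℤ) - r') = n * (2 * a1 - a0) := by
    have : (((r : ℤ) - r' : ℤ) : k) = ((n * (2 * a1 - a0) : ℤ) : k) := by
      push_cast
      rw [← hr, ← hr', ← ha1]
      field_simp
      ring
    exact_mod_cast this
  have e3 : (r : ℤ) - r' ≠ 0 := fun h0 => hT0 (by
    have : (((r : ℤ) - r' : ℤ) : k) = T := by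
      push_cast
      rw [← hr, ← hr']; ring
    rw [← this, h0, Int.cast_zero])
  have e4 : r = 0 ∨ r' = 0 := by
    rw [e2] at e3
    rcases lt_trichotomy (2 * a1 - a0 : ℤ) 0 with h0 | h0 | h0
    · left; nlinarith
    · exact absurd (by rw [h0, mul_zero]) e3
    · right; nlinarith
  have h2 : (2 : k)⁻¹ ≠ 0 := by norm_num
  rcases e4 with rfl | rfl
  · have := eq_zero_of_idem_of_trace i2 (by rw [map_smul, map_add, smul_eq_mul, htr1, hT2, hr, Nat.cast_zero])
    rw [smul_eq_zero_iff_right h2] at this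
    have h1 := LinearMap.congr_fun this 1
    rw [LinearMap.add_apply, hs, HopfAlgebra.antipode_one, HopfAlgebra.antipode_one, Module.End.one_apply,
      LinearMap.zero_apply, ← two_smul k, smul_eq_zero_iff_right (by norm_num)] at h1
    exact absurd (by rw [← mul_one F.Lam, h1, mul_zero, map_zero]) h
  · have := eq_zero_of_idem_of_trace i3 (by rw [map_smul, map_sub, smul_eq_mul, htr1, hT2, hr', Nat.cast_zero])
    rw [smul_eq_zero_iff_right h2, sub_eq_zero] at this
    exact (LinearMap.congr_fun this a).symm
end antipode
end Hopf

namespace Hopf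
section pull
variable {k : Type*} [Field k] {K H : Type*} [Ring K] [HopfAlgebra k K] [FiniteDimensional k K]
  [Ring H] [HopfAlgebra k H] [FiniteDimensional k H]

local notation "ε" => Coalgebra.counit (R := k)
local notation "σ" => HopfAlgebra.antipode k

theorem sw_hom (ι : K →ₐc[k] H) {M : Type*} [AddCommGroup M] [Module k M] (x : K) (f : H → H → M)
    (h1 : ∀ y, IsLinearMap k (fun x => f x y) := by fun_prop)
    (h2 : ∀ x, IsLinearMap k (fun y => f x y) := by fun_prop) :
    sw k (ι x) f = sw k x (fun u v => f (ι u) (ι v)) := by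
  rw [sw_eq_bil _ f h1 h2, ← CoalgHomClass.map_comp_comul_apply ι x, ← sw_tmul x, map_sw, map_sw]
  rfl

/-- Restriction of functionals along a bialgebra map. -/
noncomputable def pull (ι : K →ₐc[k] H) (q : HDual k H) : HDual k K := HDual.of (q.toLin ∘ₗ (ι : K →ₐ[k] H).toLinearMap)

@[simp] theorem pull_apply (ι : K →ₐc[k] H) (q : HDual k H) (x : K) : pull ι q x = q (ι x) := rfl

theorem pull_mul (ι : K →ₐc[k] H) (q r : HDual k H) : pull ι (q * r) = pull ι q * pull ι r := by
  ext x
  rw [pull_apply, HDual.mul_apply, HDual.mul_apply, sw_hom ι x (fun u v => q u * r v)]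
  rfl

theorem pull_one (ι : K →ₐc[k] H) : pull ι (1 : HDual k H) = 1 := by
  ext x
  exact CoalgHomClass.counit_comp_apply ι x

theorem pull_smul (ι : K →ₐc[k] H) (c : k) (q : HDual k H) : pull ι (c • q) = c • pull ι q := rfl

end pull

section chr
variable {k : Type*} [Field k] {H : Type*} [Ring H] [HopfAlgebra k H] [FiniteDimensional k H]
  {V : Type*} [AddCommGroup V] [Module k V] [FiniteDimensional k V]
  {W : Type*} [AddCommGroup W] [Module k W] [FiniteDimensional k W]

local notation "ε" => Coalgebra.counit (R := k)
local notation "σ" => HopfAlgebra.antipode k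

/-- The tensor product of two representations. -/
noncomputable def tensorRep (ρ : H →ₐ[k] Module.End k V) (τ : H →ₐ[k] Module.End k W) :
    H →ₐ[k] Module.End k (V ⊗[k] W) :=
  (Module.endTensorEndAlgHom.comp (Algebra.TensorProduct.map ρ τ)).comp (Bialgebra.comulAlgHom k H)

theorem tensorRep_apply (ρ : H →ₐ[k] Module.End k V) (τ : H →ₐ[k] Module.End k W) (x : H) :
    tensorRep ρ τ x = sw k x fun u w => TensorProduct.map (ρ u) (τ w) := by
  change (Module.endTensorEndAlgHom (R := k) (S := k) (A := k) (M := V) (N := W)).toLinearMap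
    ((Algebra.TensorProduct.map ρ τ).toLinearMap (Coalgebra.comul x)) = _
  rw [← sw_tmul x, map_sw, map_sw]
  rfl

theorem chr_tensorRep (ρ : H →ₐ[k] Module.End k V) (τ : H →ₐ[k] Module.End k W) :
    chr (tensorRep ρ τ) = chr ρ * chr τ := by
  ext x
  rw [chr_apply, tensorRep_apply, HDual.mul_apply]
  refine (map_sw (M := Module.End k (V ⊗[k] W)) (N := k) (LinearMap.trace k (V ⊗[k] W)) x _).trans ?_
  simp only [LinearMap.trace_tensorProduct', chr_apply]

theorem sw_mul_antipode_op (hS : ∀ a : H, σ (σ a) = a) {M : Type*} [AddCommGroup M] [Module k M]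
    (a : H) (f : H → M) (hf : IsLinearMap k f := by fun_prop) :
    sw k a (fun x y => f (y * σ x)) = ε a • f 1 := by
  have := sw_mul_antipode a (fun t => f (σ t)) (by fun_prop)
  simpa only [antipode_mul, hS, HopfAlgebra.antipode_one] using this

theorem chr_mul_chr_lmul (hS : ∀ a : H, σ (σ a) = a) (ρ : H →ₐ[k] Module.End k V) :
    chr ρ * chr (Algebra.lmul k H) = (Module.finrank k V : k) • chr (Algebra.lmul k H) := by
  ext x
  let Φ : Module.End k (V ⊗[k] H) :=
    tlift (fun v a => sw k a fun u w => ρ u v ⊗ₜ[k] w) (by fun_prop) (by fun_prop)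
  let Ψ : Module.End k (V ⊗[k] H) :=
    tlift (fun v a => sw k a fun u w => ρ (σ u) v ⊗ₜ[k] w) (by fun_prop) (by fun_prop)
  let L : Module.End k (V ⊗[k] H) := TensorProduct.map LinearMap.id (LinearMap.mulLeft k x)
  let D := tensorRep ρ (Algebra.lmul k H) x
  have hD : ∀ t, D t = sw k x fun u w => TensorProduct.map (ρ u) (LinearMap.mulLeft k w) t := fun t => by
    simp only [D, tensorRep_apply]
    exact map_sw (LinearMap.applyₗ t) x _
  have h1 : D * Φ = Φ * L := by
    refine TensorProduct.ext' fun v a => ?_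
    rw [Module.End.mul_apply, Module.End.mul_apply, hD]
    simp only [Φ, L, tlift_tmul, map_sw, TensorProduct.map_tmul, LinearMap.mulLeft_apply, LinearMap.id_apply]
    rw [sw_mul x a (fun u w => ρ u v ⊗ₜ[k] w)]
    simp only [map_mul, Module.End.mul_apply]
  have h2 : Φ * Ψ = 1 := by
    refine TensorProduct.ext' fun v a => ?_
    rw [Module.End.mul_apply]
    simp only [Φ, Ψ, tlift_tmul, map_sw]
    rw [← sw_assoc a (fun u w z => ρ w (ρ (σ u) v) ⊗ₜ[k] z)]
    simp only [← Module.End.mul_apply, ← map_mul]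
    have h3 : ∀ y z : H, sw k y (fun u w => (ρ (w * σ u)) v ⊗ₜ[k] z) = ε y • (v ⊗ₜ[k] z) := fun y z => by
      rw [sw_mul_antipode_op hS y (fun t => ρ t v ⊗ₜ[k] z)]; simp
    simp only [h3]
    exact sw_counit_left a (fun z => v ⊗ₜ[k] z)
  have h3 : Ψ * Φ = 1 := mul_eq_one_comm.mp h2
  have h4 : LinearMap.trace k _ D = LinearMap.trace k _ L := by
    calc LinearMap.trace k _ D = LinearMap.trace k _ (D * Φ * Ψ) := by rw [mul_assoc, h2, mul_one]
      _ = _ := by rw [h1, LinearMap.trace_mul_comm, ← mul_assoc, h3, one_mul]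
  rw [← chr_tensorRep, chr_apply, h4, LinearMap.trace_tensorProduct', HDual.smul_apply]
  rw [LinearMap.trace_id]; rfl

end chr
end Hopf

namespace Hopf

/-- A Wedderburn decomposition of a split semisimple algebra. -/
structure Blocks (k K : Type*) [Field k] [Ring K] [Algebra k K] where
  n : ℕ
  d : Fin n → ℕ
  ne : ∀ i, NeZero (d i)
  E : K ≃ₐ[k] Π i, Matrix (Fin (d i)) (Fin (d i)) k

namespace Blocks
variable {k : Type*} [Field k] {K : Type*} [Ring K] [HopfAlgebra k K] [FiniteDimensional k K]

local notation "ε" => Coalgebra.counit (R := k)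
local notation "σ" => HopfAlgebra.antipode k

theorem nonempty [IsAlgClosed k] [IsSemisimpleRing K] : Nonempty (Blocks k K) := by
  obtain ⟨n, d, hd, ⟨E⟩⟩ := IsSemisimpleRing.exists_algEquiv_pi_matrix_of_isAlgClosed k K
  exact ⟨⟨n, d, hd, E⟩⟩

variable (B : Blocks k K)

instance (i : Fin B.n) : NeZero (B.d i) := B.ne i

/-- A primitive idempotent of the block `i`. -/
noncomputable def P (i : Fin B.n) : K := B.E.symm (munit k B.d i 0 0)

/-- The irreducible representation of the block `i`. -/
noncomputable def rep (i : Fin B.n) : K →ₐ[k] Module.End k (Fin (B.d i) → k) :=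
  (Matrix.toLinAlgEquiv' (R := k) (n := Fin (B.d i))).toAlgHom.comp
    ((Pi.evalAlgHom k (fun i => Matrix (Fin (B.d i)) (Fin (B.d i)) k) i).comp B.E.toAlgHom)

/-- The irreducible character of the block `i`. -/
noncomputable def psi (i : Fin B.n) : HDual k K := chr (B.rep i)

theorem psi_apply (i : Fin B.n) (x : K) : B.psi i x = (B.E x i).trace :=
  Matrix.trace_toLin'_eq _

theorem psi_one (i : Fin B.n) : B.psi i 1 = B.d i := by
  rw [psi, chr_one]; simp

theorem psi_P (i j : Fin B.n) : B.psi i (B.P j) = if i = j then 1 else 0 := by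
  rw [psi_apply, P, AlgEquiv.apply_symm_apply, munit]
  split_ifs with h
  · subst h; simp
  · simp [h]

theorem eq_sum_psi {f : HDual k K} (hf : ∀ x y, f (x * y) = f (y * x)) : f = ∑ i, f (B.P i) • B.psi i := by
  ext x
  rw [HDual.sum_apply]
  have := tracial_eq_sum (d := B.d) (f.toLin ∘ₗ B.E.symm.toLinearMap) (fun x y => by simp [hf]) (B.E x)
  simpa [P, psi_apply] using this

theorem P_mul_P (i : Fin B.n) : B.P i * B.P i = B.P i := by
  rw [P, ← map_mul, munit_mul_same, if_pos rfl]

theorem P_ne_zero (i : Fin B.n) : B.P i ≠ 0 := fun h => by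
  have := B.psi_P i i
  rw [h, map_zero, if_pos rfl] at this
  exact zero_ne_one this

theorem chr_lmul_P (i : Fin B.n) : chr (Algebra.lmul k K) (B.P i) = B.d i := by
  rw [chr_lmul_apply, ← LinearMap.trace_conj' _ B.E.toLinearEquiv]
  have h4 : B.E.toLinearEquiv.conj (LinearMap.mulLeft k (B.P i)) =
      LinearMap.mulLeft k (munit k B.d i 0 0) ∘ₗ LinearMap.mulRight k 1 := by
    refine LinearMap.ext fun x => ?_
    simp [LinearEquiv.conj_apply, P]
  rw [h4, trace_mul_mul, Finset.sum_eq_single i]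
  · simp [munit]
  · intro j _ hj
    simp [munit, hj]
  · simp

theorem chr_lmul_eq : chr (Algebra.lmul k K) = ∑ i, (B.d i : k) • B.psi i := by
  conv_lhs => rw [B.eq_sum_psi (chr_mul_comm _)]
  simp only [chr_lmul_P]

theorem exists_chr_P [CharZero k] {V : Type*} [AddCommGroup V] [Module k V] [FiniteDimensional k V]
    (ρ : K →ₐ[k] Module.End k V) (i : Fin B.n) : ∃ m : ℕ, chr ρ (B.P i) = m ∧ (m = 0 → ρ (B.P i) = 0) := by
  have h : ρ (B.P i) * ρ (B.P i) = ρ (B.P i) := by rw [← map_mul, P_mul_P]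
  obtain ⟨m, hm⟩ := exists_trace_idem h
  exact ⟨m, hm, fun h0 => eq_zero_of_idem_of_trace h (by rw [hm, h0, Nat.cast_zero])⟩

end Blocks

section nz
variable {k : Type*} [Field k] [CharZero k] {K H : Type*} [Ring K] [HopfAlgebra k K] [FiniteDimensional k K]
  [Ring H] [HopfAlgebra k H] [FiniteDimensional k H]

local notation "ε" => Coalgebra.counit (R := k)
local notation "σ" => HopfAlgebra.antipode k

theorem pull_chr (ι : K →ₐc[k] H) {V : Type*} [AddCommGroup V] [Module k V] (ρ : H →ₐ[k] Module.End k V)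
    [FiniteDimensional k V] : pull ι (chr ρ) = chr (ρ.comp (ι : K →ₐ[k] H)) := rfl

/-- A Hopf algebra restricts to a multiple of the regular module over a semisimple Hopf subalgebra. -/
theorem finrank_smul_pull_chr_lmul [IsAlgClosed k] (ι : K →ₐc[k] H) (hι : Function.Injective ι) (F : Frob k K)
    (hF : ε F.Lam ≠ 0) :
    (Module.finrank k K : k) • pull ι (chr (Algebra.lmul k H)) =
      (Module.finrank k H : k) • chr (Algebra.lmul k K) := by
  have := F.isSemisimpleRing hF
  have hnt : Nontrivial K := ⟨F.Lam, 0, fun h0 => hF (by rw [h0, map_zero])⟩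
  obtain ⟨B⟩ := Blocks.nonempty (k := k) (K := K)
  have hne : Nonempty (Fin B.n) := by
    by_contra h
    rw [not_nonempty_iff] at h
    exact zero_ne_one (B.E.injective (funext fun i => h.elim i) : (0 : K) = 1)
  set ρ := (Algebra.lmul k H).comp (ι : K →ₐ[k] H) with hρ
  set n := Module.finrank k H
  rw [pull_chr, ← hρ]
  choose m hm hm0 using B.exists_chr_P ρ
  have hm1 : ∀ i, 1 ≤ m i := fun i => Nat.one_le_iff_ne_zero.mpr fun h => B.P_ne_zero i (hι (by
    have := LinearMap.congr_fun (hm0 i h) 1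
    simpa [hρ] using this))
  choose N hN _ using fun j => B.exists_chr_P (tensorRep ρ (B.rep j))
  choose A hA _ using fun l j => B.exists_chr_P (tensorRep (B.rep l) (B.rep j))
  have hρs : chr ρ = ∑ l, (m l : k) • B.psi l := by
    conv_lhs => rw [B.eq_sum_psi (chr_mul_comm _)]
    simp only [hm]
  have hNA : ∀ j i, N j i = ∑ l, m l * A l j i := fun j i => by
    have h := hN j i
    rw [chr_tensorRep, hρs, Finset.sum_mul, HDual.sum_apply] at h
    have h' : ∀ l, ((m l : k) • B.psi l * chr (B.rep j)) (B.P i) = m l * A l j i := fun l => by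
      rw [smul_mul_assoc, HDual.smul_apply, ← hA l j i, chr_tensorRep]; rfl
    simp only [h'] at h
    exact_mod_cast h.symm
  have hdA : ∀ j i, B.d j * B.d i = ∑ l, B.d l * A l j i := fun j i => by
    have h := congrArg (fun q : HDual k K => q (B.P i)) (chr_lmul_mul (B.rep j))
    simp only [HDual.smul_apply, B.chr_lmul_P] at h
    rw [B.chr_lmul_eq, Finset.sum_mul, HDual.sum_apply] at h
    have h' : ∀ l, ((B.d l : k) • B.psi l * chr (B.rep j)) (B.P i) = B.d l * A l j i := fun l => by
      rw [smul_mul_assoc, HDual.smul_apply, ← hA l j i, chr_tensorRep]; rfl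
    simp only [h', Module.finrank_fin_fun] at h
    exact_mod_cast h.symm
  have hNpos : ∀ j i, 0 < N j i := fun j i => by
    rw [Nat.pos_iff_ne_zero, hNA]
    intro h
    rw [Finset.sum_eq_zero_iff] at h
    have h2 : B.d j * B.d i = 0 := by
      rw [hdA]
      refine Finset.sum_eq_zero fun l hl => ?_
      rcases Nat.mul_eq_zero.mp (h l hl) with h3 | h3
      · exact absurd h3 (by have := hm1 l; omega)
      · rw [h3, mul_zero]
    exact mul_ne_zero (NeZero.ne _) (NeZero.ne _) h2
  have hNd : ∀ i, ∑ j, N j i * B.d j = n * B.d i := fun i => by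
    have h := congrArg (fun q : HDual k K => q (B.P i)) (chr_mul_chr_lmul (F.antipode_antipode hF) ρ)
    simp only [HDual.smul_apply, B.chr_lmul_P] at h
    rw [B.chr_lmul_eq, Finset.mul_sum, HDual.sum_apply] at h
    have h' : ∀ l, (chr ρ * ((B.d l : k) • B.psi l)) (B.P i) = N l i * B.d l := fun l => by
      rw [mul_smul_comm, HDual.smul_apply, ← hN l i, chr_tensorRep, mul_comm]; rfl
    simp only [h'] at h
    exact_mod_cast h
  have hNm : ∀ i, ∑ j, N j i * m j = n * m i := fun i => by
    have h0 : chr ρ * ∑ l, (m l : k) • B.psi l = (n : k) • chr ρ := by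
      rw [← hρs, hρ, ← pull_chr, ← pull_mul, chr_lmul_mul, pull_smul]
    have h := congrArg (fun q : HDual k K => q (B.P i)) h0
    simp only [HDual.smul_apply, hm] at h
    rw [Finset.mul_sum, HDual.sum_apply] at h
    have h' : ∀ l, (chr ρ * ((m l : k) • B.psi l)) (B.P i) = N l i * m l := fun l => by
      rw [mul_smul_comm, HDual.smul_apply, ← hN l i, chr_tensorRep, mul_comm]; rfl
    simp only [h'] at h
    exact_mod_cast h
  obtain ⟨j, hj⟩ := Finite.exists_max fun i => (m i : ℚ) / B.d i
  have hdpos : ∀ i, 0 < B.d i := fun i => Nat.pos_of_ne_zero (NeZero.ne _)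
  have hj' : ∀ i, m i * B.d j ≤ m j * B.d i := fun i => by
    have := hj i
    rw [div_le_div_iff₀ (by exact_mod_cast hdpos i) (by exact_mod_cast hdpos j)] at this
    exact_mod_cast this
  have hsum : ∑ i, (N i j : ℤ) * (m j * B.d i - m i * B.d j) = 0 := by
    have h1 : ∑ i, (N i j : ℤ) * B.d i = n * B.d j := by exact_mod_cast hNd j
    have h2 : ∑ i, (N i j : ℤ) * m i = n * m j := by exact_mod_cast hNm j
    calc _ = m j * ∑ i, (N i j : ℤ) * B.d i - B.d j * ∑ i, (N i j : ℤ) * m i := by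
          rw [Finset.mul_sum, Finset.mul_sum, ← Finset.sum_sub_distrib]
          exact Finset.sum_congr rfl fun i _ => by ring
      _ = 0 := by rw [h1, h2]; ring
  have hprop : ∀ i, m j * B.d i = m i * B.d j := fun i => by
    have h1 := (Finset.sum_eq_zero_iff_of_nonneg (fun i _ => mul_nonneg (Int.natCast_nonneg _)
      (sub_nonneg.mpr (by exact_mod_cast hj' i)))).mp hsum i (Finset.mem_univ _)
    rcases mul_eq_zero.mp h1 with h2 | h2
    · exact absurd h2 (by exact_mod_cast (hNpos i j).ne')
    · have := sub_eq_zero.mp h2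
      exact_mod_cast this
  have hmain : (B.d j : k) • chr ρ = (m j : k) • chr (Algebra.lmul k K) := by
    rw [hρs, B.chr_lmul_eq, Finset.smul_sum, Finset.smul_sum]
    refine Finset.sum_congr rfl fun i _ => ?_
    rw [smul_smul, smul_smul]
    congr 1
    rw [mul_comm (B.d j : k)]
    exact_mod_cast (hprop i).symm
  have hone := congrArg (fun q : HDual k K => q 1) hmain
  simp only [HDual.smul_apply, chr_one] at hone
  have hd0 : (B.d j : k) ≠ 0 := by exact_mod_cast (hdpos j).ne'
  refine smul_right_injective _ hd0 ?_
  simp only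
  rw [smul_comm, hmain, smul_smul, smul_smul, hone, mul_comm]

end nz
end Hopf

namespace Hopf

section sub
variable {k : Type*} [Field k] {H : Type*} [Ring H] [HopfAlgebra k H]

/-- A subalgebra that is a Hopf subalgebra. -/
class IsHopfSub (K : Subalgebra k H) : Prop where
  comul_mem : ∀ x ∈ K, Coalgebra.comul (R := k) x ∈
    LinearMap.range (TensorProduct.map K.val.toLinearMap K.val.toLinearMap)
  antipode_mem : ∀ x ∈ K, HopfAlgebra.antipode k x ∈ K

variable (K : Subalgebra k H)

theorem map_val_injective : Function.Injective (TensorProduct.map K.val.toLinearMap K.val.toLinearMap) :=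
  TensorProduct.map_injective_of_flat_flat _ _ Subtype.val_injective Subtype.val_injective

theorem map_val_val_injective : Function.Injective (TensorProduct.map K.val.toLinearMap
    (TensorProduct.map K.val.toLinearMap K.val.toLinearMap)) :=
  TensorProduct.map_injective_of_flat_flat _ _ Subtype.val_injective (map_val_injective K)

variable [hK : IsHopfSub K]

/-- The comultiplication of a Hopf subalgebra. -/
noncomputable def subComul : K →ₗ[k] K ⊗[k] K :=
  (LinearEquiv.ofInjective _ (map_val_injective K)).symm.toLinearMap ∘ₗ
    LinearMap.codRestrict _ (Coalgebra.comul ∘ₗ K.val.toLinearMap) fun x => hK.comul_mem x x.2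

theorem map_subComul (x : K) : TensorProduct.map K.val.toLinearMap K.val.toLinearMap (subComul K x) =
    Coalgebra.comul (R := k) (x : H) :=
  congrArg Subtype.val ((LinearEquiv.ofInjective _ (map_val_injective K)).apply_symm_apply
    (LinearMap.codRestrict _ (Coalgebra.comul ∘ₗ K.val.toLinearMap) (fun x => hK.comul_mem x x.2) x))

set_option synthInstance.maxHeartbeats 200000 in
noncomputable instance : Coalgebra k K where
  comul := subComul K
  counit := Coalgebra.counit ∘ₗ K.val.toLinearMap
  coassoc := by
    refine LinearMap.ext fun x => map_val_val_injective K ?_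
    have h1 : ∀ t : K ⊗[k] K, TensorProduct.map K.val.toLinearMap (TensorProduct.map K.val.toLinearMap K.val.toLinearMap)
        (TensorProduct.assoc k K K K ((subComul K).rTensor K t)) =
        TensorProduct.assoc k H H H ((Coalgebra.comul).rTensor H
          (TensorProduct.map K.val.toLinearMap K.val.toLinearMap t)) := fun t => by
      induction t with
      | zero => simp
      | add a b ha hb => simp only [map_add, ha, hb]
      | tmul a b =>
        simp only [LinearMap.rTensor_tmul, TensorProduct.map_tmul]
        have := map_subComul K a
        simp only [AlgHom.toLinearMap_apply, Subalgebra.coe_val] at this ⊢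
        rw [← this]
        generalize subComul K a = s
        induction s with
        | zero => simp
        | add a b ha hb => simp only [map_add, ha, hb, TensorProduct.add_tmul]
        | tmul => simp
    have h2 : ∀ t : K ⊗[k] K, TensorProduct.map K.val.toLinearMap (TensorProduct.map K.val.toLinearMap K.val.toLinearMap)
        ((subComul K).lTensor K t) =
        (Coalgebra.comul).lTensor H (TensorProduct.map K.val.toLinearMap K.val.toLinearMap t) := fun t => by
      induction t with
      | zero => simp
      | add a b ha hb => simp only [map_add, ha, hb]
      | tmul a b =>
        simp only [LinearMap.lTensor_tmul, TensorProduct.map_tmul, map_subComul]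
        simp
    simp only [LinearMap.comp_apply, LinearEquiv.coe_coe, h1, h2, map_subComul]
    exact Coalgebra.coassoc_apply _
  rTensor_counit_comp_comul := by
    refine LinearMap.ext fun x => ?_
    have hinj : Function.Injective (K.val.toLinearMap.lTensor k) :=
      Module.Flat.lTensor_preserves_injective_linearMap _ Subtype.val_injective
    refine hinj ?_
    have h : ∀ t : K ⊗[k] K, K.val.toLinearMap.lTensor k ((Coalgebra.counit ∘ₗ K.val.toLinearMap).rTensor K t) =
        (Coalgebra.counit).rTensor H (TensorProduct.map K.val.toLinearMap K.val.toLinearMap t) := fun t => by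
      induction t with
      | zero => simp
      | add a b ha hb => simp only [map_add, ha, hb]
      | tmul a b => simp
    rw [LinearMap.comp_apply, h, map_subComul, Coalgebra.rTensor_counit_comul]
    simp
  lTensor_counit_comp_comul := by
    refine LinearMap.ext fun x => ?_
    have hinj : Function.Injective (K.val.toLinearMap.rTensor k) :=
      Module.Flat.rTensor_preserves_injective_linearMap _ Subtype.val_injective
    refine hinj ?_
    have h : ∀ t : K ⊗[k] K, K.val.toLinearMap.rTensor k ((Coalgebra.counit ∘ₗ K.val.toLinearMap).lTensor K t) =
        (Coalgebra.counit).lTensor H (TensorProduct.map K.val.toLinearMap K.val.toLinearMap t) := fun t => by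
      induction t with
      | zero => simp
      | add a b ha hb => simp only [map_add, ha, hb]
      | tmul a b => simp
    rw [LinearMap.comp_apply, h, map_subComul, Coalgebra.lTensor_counit_comul]
    simp

theorem map_comul_sub (x : K) : TensorProduct.map K.val.toLinearMap K.val.toLinearMap (Coalgebra.comul (R := k) x) =
    Coalgebra.comul (R := k) (x : H) := map_subComul K x

theorem counit_sub (x : K) : Coalgebra.counit (R := k) x = Coalgebra.counit (R := k) (x : H) := rfl

noncomputable instance : Bialgebra k K := Bialgebra.mk' k K
  (by rw [counit_sub]; simp)
  (fun {a b} => by simp only [counit_sub]; simp)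
  (map_val_injective K (by
    rw [map_comul_sub]
    simp [Algebra.TensorProduct.one_def]))
  (fun {a b} => map_val_injective K (by
    have h : ∀ s t : K ⊗[k] K, TensorProduct.map K.val.toLinearMap K.val.toLinearMap (s * t) =
        TensorProduct.map K.val.toLinearMap K.val.toLinearMap s * TensorProduct.map K.val.toLinearMap K.val.toLinearMap t :=
      fun s t => map_mul (Algebra.TensorProduct.map K.val K.val) s t
    rw [h]
    simp only [map_comul_sub, MulMemClass.coe_mul, Bialgebra.comul_mul]))

/-- The inclusion of a Hopf subalgebra. -/
noncomputable def subHom : K →ₐc[k] H := BialgHom.ofAlgHom K.val (by ext x; simp [counit_sub])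
  (by
    refine AlgHom.ext fun x => ?_
    exact map_comul_sub K x)

@[simp] theorem subHom_apply (x : K) : subHom K x = x := rfl

noncomputable instance : HopfAlgebra k K where
  antipode := (HopfAlgebra.antipode k ∘ₗ K.val.toLinearMap).codRestrict (Subalgebra.toSubmodule K)
    (fun x => hK.antipode_mem x x.2)
  mul_antipode_rTensor_comul := by
    refine LinearMap.ext fun x => Subtype.ext ?_
    have h : ∀ t : K ⊗[k] K, ((LinearMap.mul' k K (((HopfAlgebra.antipode k ∘ₗ K.val.toLinearMap).codRestrict
        (Subalgebra.toSubmodule K) (fun x => hK.antipode_mem x x.2)).rTensor K t) : K) : H) =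
        LinearMap.mul' k H ((HopfAlgebra.antipode k).rTensor H
          (TensorProduct.map K.val.toLinearMap K.val.toLinearMap t)) := fun t => by
      induction t with
      | zero => simp
      | add a b ha hb => simp only [map_add, Subalgebra.coe_add, ha, hb]
      | tmul a b => simp; rfl
    simp only [LinearMap.comp_apply]
    refine (h _).trans ?_
    rw [map_comul_sub, HopfAlgebra.mul_antipode_rTensor_comul_apply]
    rfl
  mul_antipode_lTensor_comul := by
    refine LinearMap.ext fun x => Subtype.ext ?_
    have h : ∀ t : K ⊗[k] K, ((LinearMap.mul' k K (((HopfAlgebra.antipode k ∘ₗ K.val.toLinearMap).codRestrict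
        (Subalgebra.toSubmodule K) (fun x => hK.antipode_mem x x.2)).lTensor K t) : K) : H) =
        LinearMap.mul' k H ((HopfAlgebra.antipode k).lTensor H
          (TensorProduct.map K.val.toLinearMap K.val.toLinearMap t)) := fun t => by
      induction t with
      | zero => simp
      | add a b ha hb => simp only [map_add, Subalgebra.coe_add, ha, hb]
      | tmul a b => simp; rfl
    simp only [LinearMap.comp_apply]
    refine (h _).trans ?_
    rw [map_comul_sub, HopfAlgebra.mul_antipode_lTensor_comul_apply]
    rfl

theorem subHom_injective : Function.Injective (subHom K) := Subtype.val_injective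

end sub
end Hopf

namespace Hopf

section nint
variable {k : Type*} [Field k] [CharZero k] [IsAlgClosed k] {K : Type*} [Ring K] [HopfAlgebra k K] [FiniteDimensional k K]
  {H : Type*} [Ring H] [HopfAlgebra k H] [FiniteDimensional k H]

local notation "ε" => Coalgebra.counit (R := k)
local notation "σ" => HopfAlgebra.antipode k

@[fun_prop] theorem lin_bialgHom (ι : K →ₐc[k] H) : IsLinearMap k (fun x => ι x) :=
  (ι : K →ₐ[k] H).toLinearMap.isLinear

namespace Frob
variable (F : Frob k K)

/-- The normalised integral. -/
noncomputable def nint : K := (ε F.Lam)⁻¹ • F.Lam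

theorem mul_nint (x : K) : x * F.nint = ε x • F.nint := by
  rw [nint, mul_smul_comm, F.mul_Lam, smul_comm]

variable (hF : ε F.Lam ≠ 0)

theorem nint_mul (hF : ε F.Lam ≠ 0) (x : K) : F.nint * x = ε x • F.nint := by
  rw [nint, smul_mul_assoc, F.Lam_mul, F.alpha_eq_one hF, smul_comm]; rfl

theorem counit_nint (hF : ε F.Lam ≠ 0) : ε F.nint = 1 := by
  rw [nint, map_smul, smul_eq_mul, inv_mul_cancel₀ hF]

theorem nint_mul_nint (hF : ε F.Lam ≠ 0) : F.nint * F.nint = F.nint := by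
  rw [F.mul_nint, F.counit_nint hF, one_smul]

theorem antipode_nint (hF : ε F.Lam ≠ 0) : σ F.nint = F.nint := by
  have h1 : σ (σ F.nint * F.nint) = ε F.nint • σ F.nint := by
    rw [F.mul_nint, HopfAlgebra.counit_antipode, map_smul]
  rw [antipode_mul, F.antipode_antipode hF, F.counit_nint hF, one_smul, F.mul_nint,
    HopfAlgebra.counit_antipode, F.counit_nint hF, one_smul] at h1
  exact h1.symm

theorem chr_lmul_nint (hF : ε F.Lam ≠ 0) : chr (Algebra.lmul k K) F.nint = 1 := by
  rw [chr_lmul_apply, ← Tr_eq_trace]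
  simp only [LinearMap.mulLeft_apply, F.nint_mul hF]
  rw [Tr_smul (fun x => ε x) (by fun_prop), F.counit_nint hF]

theorem sw_nint_swap (hF : ε F.Lam ≠ 0) {M : Type*} [AddCommGroup M] [Module k M] (f : K → K → M)
    (h1 : ∀ y, IsLinearMap k (fun x => f x y) := by fun_prop)
    (h2 : ∀ x, IsLinearMap k (fun y => f x y) := by fun_prop) :
    sw k F.nint f = sw k F.nint (fun u v => f (σ v) (σ u)) := by
  conv_lhs => rw [← F.antipode_nint hF]
  exact sw_antipode _ f

/-- The left legs of the coproduct of the integral span. -/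
theorem exists_lactH_nint (hF : ε F.Lam ≠ 0) (a : K) : ∃ q : HDual k K, lactH q F.nint = a := by
  let q : HDual k K := HDual.of (IsLinearMap.mk' (fun u => ε F.Lam * F.lam (a * σ u)) (by fun_prop))
  have hq : ∀ u, q u = ε F.Lam * F.lam (a * σ u) := fun _ => rfl
  refine ⟨q, ?_⟩
  have h2 : F.Lam = ε F.Lam • F.nint := by rw [nint, smul_smul, mul_inv_cancel₀ hF, one_smul]
  have h1 := F.antipode_eq a
  rw [h2, (lin_sw (fun u v => F.lam (a * v) • u) (by fun_prop) (by fun_prop)).map_smul,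
    F.sw_nint_swap hF (fun u v => F.lam (a * v) • u)] at h1
  rw [lactH_apply, ← F.antipode_antipode hF a, h1, smul_sw,
    ← sw_map (q := fun t => σ t) (by fun_prop)]
  simp only [hq, map_smul, F.antipode_antipode hF, smul_smul]

end Frob

variable (ι : K →ₐc[k] H) (hι : Function.Injective ι) (F : Frob k K) (hF : ε F.Lam ≠ 0)

theorem antipode_hom (ι : K →ₐc[k] H) (x : K) : σ (ι x) = ι (σ x) := by
  have h := sw_assoc (k := k) x (fun u v b => σ (ι u) * (ι v * ι (σ b)))
  have h1 : ∀ a b : K, sw k a (fun u v => σ (ι u) * (ι v * ι (σ b))) = ε a • ι (σ b) := fun a b => by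
    have := sw_antipode_mul (k := k) (ι a) (fun y => y * ι (σ b))
    rw [sw_hom ι a (fun u v => σ u * v * ι (σ b)), one_mul, CoalgHomClass.counit_comp_apply] at this
    simpa only [mul_assoc] using this
  have h2 : ∀ u w : K, sw k w (fun v b => σ (ι u) * (ι v * ι (σ b))) = ε w • σ (ι u) := fun u w => by
    have := sw_mul_antipode (k := k) w (fun y => σ (ι u) * ι y)
    simpa only [map_mul, map_one, mul_one] using this
  simp only [h1, h2] at h
  rw [sw_counit_left x (fun y => ι (σ y)), sw_counit_right x (fun y => σ (ι y))] at h
  exact h.symm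

theorem exists_trace_nint (hι : Function.Injective ι) (hF : ε F.Lam ≠ 0) :
    ∃ r : ℕ, LinearMap.trace k H (LinearMap.mulLeft k (ι F.nint)) = r ∧
      Module.finrank k K * r = Module.finrank k H := by
  have hid : LinearMap.mulLeft k (ι F.nint) * LinearMap.mulLeft k (ι F.nint) = LinearMap.mulLeft k (ι F.nint) := by
    rw [Module.End.mul_eq_comp, ← LinearMap.mulLeft_mul, ← map_mul, F.nint_mul_nint hF]
  obtain ⟨r, hr⟩ := exists_trace_idem hid
  refine ⟨r, hr, ?_⟩
  have h := congrArg (fun q : HDual k K => q F.nint) (finrank_smul_pull_chr_lmul ι hι F hF)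
  simp only [HDual.smul_apply, pull_apply, F.chr_lmul_nint hF, chr_lmul_apply, hr, mul_one] at h
  exact_mod_cast h

theorem finrank_range_mulRight_nint (FH : Frob k H) (hι : Function.Injective ι) (hF : ε F.Lam ≠ 0) :
    Module.finrank k K * Module.finrank k (LinearMap.range (LinearMap.mulRight k (ι F.nint))) =
      Module.finrank k H := by
  obtain ⟨r, hr, hr'⟩ := exists_trace_nint ι F hι hF
  have hid : LinearMap.mulRight k (ι F.nint) * LinearMap.mulRight k (ι F.nint) = LinearMap.mulRight k (ι F.nint) := by
    rw [Module.End.mul_eq_comp, ← LinearMap.mulRight_mul, ← map_mul, F.nint_mul_nint hF]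
  have h1 := (LinearMap.IsIdempotentElem.isProj_range _ hid).trace
  let S : H ≃ₗ[k] H := LinearEquiv.ofInjectiveEndo (HopfAlgebra.antipode k) FH.antipode_injective
  have h2 : S.conj (LinearMap.mulLeft k (ι F.nint)) = LinearMap.mulRight k (ι F.nint) := by
    refine LinearMap.ext fun x => ?_
    rw [LinearEquiv.conj_apply_apply]
    change σ (ι F.nint * S.symm x) = x * ι F.nint
    rw [antipode_mul, antipode_hom, F.antipode_nint hF]
    congr 1
    exact S.apply_symm_apply x
  rw [← h2, LinearMap.trace_conj', hr, h2] at h1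
  rw [← hr']
  congr 1
  exact_mod_cast h1.symm

end nint

section cyc
variable {k : Type*} [Field k] [CharZero k] [IsAlgClosed k] 
  {H : Type*} [Ring H] [HopfAlgebra k H] [FiniteDimensional k H]

local notation "ε" => Coalgebra.counit (R := k)
local notation "σ" => HopfAlgebra.antipode k

theorem antipode_eq_pow {a : H} (ha : IsGroupLikeElem k a) : ∃ n, σ a = a ^ n := by
  obtain ⟨N, hN, h⟩ := exists_pow_eq_one ha
  refine ⟨N - 1, ?_⟩
  calc σ a = σ a * (a * a ^ (N - 1)) := by rw [← pow_succ', Nat.sub_add_cancel hN, h, mul_one]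
    _ = _ := by rw [← mul_assoc, ha.antipode_mul_cancel, one_mul]

theorem isHopfSub_adjoin {a : H} (ha : IsGroupLikeElem k a) : IsHopfSub (Algebra.adjoin k {a}) where
  comul_mem x hx := by
    have h : Algebra.adjoin k {a} ≤ (Algebra.TensorProduct.map (Algebra.adjoin k {a}).val
        (Algebra.adjoin k {a}).val).range.comap (Bialgebra.comulAlgHom k H) := by
      refine Algebra.adjoin_le ?_
      rintro _ rfl
      exact ⟨⟨_, Algebra.self_mem_adjoin_singleton k _⟩ ⊗ₜ ⟨_, Algebra.self_mem_adjoin_singleton k _⟩,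
        ha.comul_eq_tmul_self.symm⟩
    exact h hx
  antipode_mem x hx := by
    induction hx using Algebra.adjoin_induction with
    | mem x hx =>
      obtain rfl : x = a := hx
      obtain ⟨n, hn⟩ := antipode_eq_pow ha
      rw [hn]
      exact Subalgebra.pow_mem _ (Algebra.self_mem_adjoin_singleton k _) _
    | algebraMap r => 
      rw [Algebra.algebraMap_eq_smul_one, map_smul, HopfAlgebra.antipode_one]
      exact Subalgebra.smul_mem _ (Subalgebra.one_mem _) _
    | add x y _ _ hx hy => rw [map_add]; exact Subalgebra.add_mem _ hx hy
    | mul x y _ _ hx hy => rw [antipode_mul]; exact Subalgebra.mul_mem _ hy hx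

theorem orderOf_pos_of_isGroupLikeElem {a : H} (ha : IsGroupLikeElem k a) : 0 < orderOf a := by
  obtain ⟨N, hN, h⟩ := exists_pow_eq_one ha
  exact orderOf_pos_iff.mpr (isOfFinOrder_iff_pow_eq_one.mpr ⟨N, hN, h⟩)

theorem span_pow_eq {a : H} (ha : IsGroupLikeElem k a) :
    Subalgebra.toSubmodule (Algebra.adjoin k {a}) = Submodule.span k (Set.range fun i : Fin (orderOf a) => a ^ (i : ℕ)) := by
  have hN := orderOf_pos_of_isGroupLikeElem ha
  rw [Algebra.adjoin_eq_span, ← Submonoid.powers_eq_closure]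
  congr 1
  ext x
  constructor
  · rintro ⟨n, rfl⟩
    exact ⟨⟨n % orderOf a, Nat.mod_lt _ hN⟩, pow_mod_orderOf a n⟩
  · rintro ⟨i, rfl⟩
    exact ⟨i, rfl⟩

theorem linearIndependent_pow {a : H} (ha : IsGroupLikeElem k a) :
    LinearIndependent k fun i : Fin (orderOf a) => a ^ (i : ℕ) := by
  have h := (linearIndep_groupLikeVal (R := k) (A := H)).comp
    (fun i : Fin (orderOf a) => (⟨a ^ (i : ℕ), ha.pow⟩ : GroupLike k H)) (fun i j hij => by
      have h1 : a ^ (i : ℕ) = a ^ (j : ℕ) := congrArg GroupLike.val hij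
      exact Fin.ext (pow_injOn_Iio_orderOf i.2 j.2 h1))
  exact h

theorem finrank_adjoin {a : H} (ha : IsGroupLikeElem k a) :
    Module.finrank k (Algebra.adjoin k {a}) = orderOf a := by
  change Module.finrank k (Subalgebra.toSubmodule (Algebra.adjoin k {a})) = _
  rw [span_pow_eq ha, finrank_span_eq_card (linearIndependent_pow ha), Fintype.card_fin]

/-- Average of a cyclic group of group-likes. -/
noncomputable def avg (a : H) : H := (orderOf a : k)⁻¹ • ∑ i ∈ Finset.range (orderOf a), a ^ i

theorem avg_mem (a : H) : avg (k := k) a ∈ Algebra.adjoin k {a} :=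
  Subalgebra.smul_mem _ (Subalgebra.sum_mem _ fun _ _ => Subalgebra.pow_mem _ (Algebra.self_mem_adjoin_singleton k _) _) _

theorem mul_avg {a : H} : a * avg (k := k) a = avg (k := k) a := by
  rw [avg, mul_smul_comm]
  congr 1
  have := mul_geom_sum a (orderOf a)
  rw [pow_orderOf_eq_one, sub_self, sub_mul, one_mul] at this
  exact sub_eq_zero.mp this

theorem counit_avg {a : H} (ha : IsGroupLikeElem k a) : ε (avg (k := k) a) = 1 := by
  have hN := orderOf_pos_of_isGroupLikeElem ha
  rw [avg, map_smul, map_sum]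
  simp [ha.pow.counit_eq_one, hN.ne']

theorem mul_avg_of_mem {a : H} (ha : IsGroupLikeElem k a) {x : H} (hx : x ∈ Algebra.adjoin k {a}) :
    x * avg (k := k) a = ε x • avg (k := k) a := by
  induction hx using Algebra.adjoin_induction with
  | mem x hx =>
    obtain rfl : x = a := hx
    rw [mul_avg, ha.counit_eq_one, one_smul]
  | algebraMap r => rw [Algebra.algebraMap_eq_smul_one]; simp
  | add x y _ _ hx hy => rw [add_mul, hx, hy, map_add, add_smul]
  | mul x y _ _ hx hy => rw [mul_assoc, hy, mul_smul_comm, hx, Bialgebra.counit_mul, smul_smul, mul_comm]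

theorem exists_frob_adjoin {a : H} (ha : IsGroupLikeElem k a) : ∀ _ : IsHopfSub (Algebra.adjoin k {a}),
    ∃ F : Frob k (Algebra.adjoin k {a}), ε F.Lam ≠ 0 ∧ (F.nint : H) = avg (k := k) a := by
  intro hS
  have hnt : Nontrivial H := ⟨a, 0, ha.ne_zero⟩
  obtain ⟨F⟩ := exists_frob k (Algebra.adjoin k {a})
  have hF : ε F.Lam ≠ 0 := F.counit_Lam_ne_zero (t := ⟨_, avg_mem a⟩)
    (fun x => Subtype.ext (mul_avg_of_mem ha x.2)) (by rw [counit_sub, counit_avg ha]; exact one_ne_zero)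
  refine ⟨F, hF, ?_⟩
  have h := F.nint_mul hF ⟨_, avg_mem a⟩
  rw [counit_sub, counit_avg ha, one_smul] at h
  rw [← h, Subalgebra.coe_mul, mul_avg_of_mem ha F.nint.2, ← counit_sub, F.counit_nint hF, one_smul]

theorem exists_trace_avg {a : H} (ha : IsGroupLikeElem k a) :
    ∃ r : ℕ, LinearMap.trace k H (LinearMap.mulLeft k (avg (k := k) a)) = r ∧
      orderOf a * r = Module.finrank k H := by
  have hS := isHopfSub_adjoin ha
  obtain ⟨F, hF, he⟩ := exists_frob_adjoin ha hS
  obtain ⟨r, hr, h⟩ := exists_trace_nint (subHom _) F (subHom_injective _) hF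
  rw [finrank_adjoin ha] at h
  refine ⟨r, ?_, h⟩
  rw [← hr, subHom_apply, he]

theorem orderOf_dvd_finrank {a : H} (ha : IsGroupLikeElem k a) : orderOf a ∣ Module.finrank k H := by
  obtain ⟨r, _, h⟩ := exists_trace_avg ha
  exact ⟨r, h.symm⟩

end cyc
end Hopf

namespace Hopf

section index
variable {k : Type*} [Field k] [CharZero k] [IsAlgClosed k] {K : Type*} [Ring K] [HopfAlgebra k K] [FiniteDimensional k K]
  {H : Type*} [Ring H] [HopfAlgebra k H] [FiniteDimensional k H]

local notation "ε" => Coalgebra.counit (R := k)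
local notation "σ" => HopfAlgebra.antipode k

/-- The two-dimensional module generated by an idempotent `e`. -/
structure TwoDim (e l : H) (chi f : HDual k H) : Prop where
  counit_e : ε e = 1
  counit_l : ε l = 0
  l_ne : l ≠ 0
  l_mul_e : l * e = l
  mul_e : ∀ h, h * e = ε h • e + f h • l
  mul_l : ∀ h, h * l = chi h • l

theorem exists_span_ker {V : Type*} [AddCommGroup V] [Module k V] (hd : Module.finrank k V = 2) (φ : V →ₗ[k] k)
    {x : V} (hx : φ x ≠ 0) : ∃ l, l ≠ 0 ∧ φ l = 0 ∧ ∀ y, φ y = 0 → ∃ c : k, y = c • l := by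
  have hfin : FiniteDimensional k V := FiniteDimensional.of_finrank_pos (by omega)
  have hsurj : LinearMap.range φ = ⊤ := LinearMap.range_eq_top.2 fun c => ⟨(c * (φ x)⁻¹) • x, by
    rw [map_smul, smul_eq_mul, inv_mul_cancel_right₀ hx]⟩
  have hk := LinearMap.finrank_range_add_finrank_ker φ
  rw [hsurj, finrank_top, Module.finrank_self, hd] at hk
  obtain ⟨l, hl0, hl⟩ := (finrank_eq_one_iff' (K := k) (V := LinearMap.ker φ)).1 (by omega)
  refine ⟨l, fun h => hl0 (Subtype.ext h), l.2, fun y hy => ?_⟩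
  obtain ⟨c, hc⟩ := hl ⟨y, hy⟩
  exact ⟨c, congrArg Subtype.val hc.symm⟩

theorem exists_twoDim {e : H} (h1 : ε e = 1) (he : e * e = e)
    (hd : Module.finrank k (LinearMap.range (LinearMap.mulRight k e)) = 2) :
    ∃ l chi f, TwoDim (k := k) e l chi f := by
  obtain ⟨M, hM⟩ : ∃ M : Submodule k H, M = LinearMap.range (LinearMap.mulRight k e) := ⟨_, rfl⟩
  rw [← hM] at hd
  have hmem : ∀ x, x ∈ M ↔ x * e = x := fun x => by
    rw [hM]
    exact ⟨by rintro ⟨y, rfl⟩; simp [mul_assoc, he], fun h => ⟨x, h⟩⟩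
  have heM : e ∈ M := (hmem e).2 he
  let φ : M →ₗ[k] k := (Coalgebra.counit : H →ₗ[k] k) ∘ₗ M.subtype
  have hφ : ∀ x : M, φ x = ε (x : H) := fun _ => rfl
  obtain ⟨l, hl0, hle', hl⟩ := exists_span_ker hd φ (x := ⟨e, heM⟩) (by rw [hφ, h1]; exact one_ne_zero)
  have hspan : ∀ x : H, x ∈ M → ε x = 0 → ∃ c : k, x = c • (l : H) := fun x hx h0 => by
    obtain ⟨c, hc⟩ := hl ⟨x, hx⟩ h0
    exact ⟨c, congrArg Subtype.val hc⟩
  have hl0' : (l : H) ≠ 0 := fun h => hl0 (Subtype.ext h)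
  obtain ⟨q, hq⟩ := Module.Projective.exists_dual_eq_one k hl0'
  have hlM : (l : H) * e = (l : H) := (hmem _).1 l.2
  have hle : ε (l : H) = 0 := hle'
  have hq' : ∀ x : H, x ∈ M → ε x = 0 → x = q x • (l : H) := fun x hx h0 => by
    obtain ⟨c, hc⟩ := hspan x hx h0
    rw [hc, map_smul, hq, smul_eq_mul, mul_one]
  refine ⟨(l : H), HDual.of (IsLinearMap.mk' (fun h => q (h * (l : H))) (by fun_prop)),
    HDual.of (IsLinearMap.mk' (fun h => q (h * e - ε h • e)) (by fun_prop)), h1, hle, hl0', hlM, fun h => ?_, fun h => ?_⟩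
  · have := hq' (h * e - ε h • e) (M.sub_mem ((hmem _).2 (by rw [mul_assoc, he])) (M.smul_mem _ heM)) (by simp [h1])
    exact sub_eq_iff_eq_add'.1 this
  · exact hq' (h * (l : H)) ((hmem _).2 (by rw [mul_assoc, hlM])) (by simp [hle])

namespace TwoDim
variable {e l : H} {chi f : HDual k H}

theorem f_l (T : TwoDim e l chi f) : f l = 1 := by
  have := T.mul_e l
  rw [T.l_mul_e, T.counit_l, zero_smul, zero_add] at this
  exact smul_left_injective k T.l_ne (by simpa using this.symm)

theorem chi_one (T : TwoDim e l chi f) : chi 1 = 1 := by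
  have := T.mul_l 1
  exact smul_left_injective k T.l_ne (by simpa using this.symm)

theorem chi_mul (T : TwoDim e l chi f) (a b : H) : chi (a * b) = chi a * chi b := by
  have := T.mul_l (a * b)
  rw [mul_assoc, T.mul_l b, mul_smul_comm, T.mul_l a, smul_smul] at this
  rw [mul_comm (chi a)]
  exact smul_left_injective k T.l_ne this.symm

theorem f_mul (T : TwoDim e l chi f) (a b : H) : f (a * b) = f a * ε b + chi a * f b := by
  have := T.mul_e (a * b)
  rw [mul_assoc, T.mul_e b, mul_add, mul_smul_comm, mul_smul_comm, T.mul_l a, T.mul_e a, smul_add, smul_smul,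
    smul_smul, smul_smul (f b), Bialgebra.counit_mul, mul_comm (ε a), add_assoc, ← add_smul, add_right_inj] at this
  rw [← smul_left_injective k T.l_ne this]
  ring

theorem isGroupLikeElem (T : TwoDim e l chi f) : IsGroupLikeElem k chi :=
  isGroupLikeElem_dual_iff.2 ⟨T.chi_one, T.chi_mul⟩

theorem f_ne (T : TwoDim e l chi f) : f ≠ 0 := fun h => by
  have := T.f_l
  rw [h] at this
  exact zero_ne_one this

theorem sw_f (T : TwoDim e l chi f) {M : Type*} [AddCommGroup M] [Module k M] (G : HDual k H → HDual k H → M)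
    (h1 : ∀ y, IsLinearMap k (fun x => G x y) := by fun_prop)
    (h2 : ∀ x, IsLinearMap k (fun y => G x y) := by fun_prop) :
    sw k f G = G f 1 + G chi f := by
  have h : Coalgebra.comul (R := k) f = f ⊗ₜ 1 + chi ⊗ₜ f := (HDual.tensorHom _).injective (by
    ext a b
    rw [HDual.tensorHom_comul, map_add]
    simp only [LinearMap.add_apply, HDual.tensorHom_tmul]
    exact T.f_mul a b)
  rw [sw_eq_bil _ G h1 h2, h, map_add]
  rfl

theorem f_mul_f_mul (T : TwoDim e l chi f) (a b : H) : (f * f) (a * b) =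
    (f * f) a * ε b + (f * chi + chi * f) a * f b + (chi * chi) a * (f * f) b := by
  rw [← HDual.sw_ev_ev, sw_mul f f (fun q1 q2 : HDual k H => q1 a * q2 b)]
  rw [T.sw_f (fun x y => sw k f fun x' y' => (x * x') a * (y * y') b),
    T.sw_f (fun x' y' => (f * x') a * (1 * y') b), T.sw_f (fun x' y' => (chi * x') a * (f * y') b)]
  simp only [one_mul, mul_one, HDual.add_apply, HDual.one_apply]
  ring

variable {ι : K →ₐc[k] H} {F : Frob k K} (hF : ε F.Lam ≠ 0)

theorem pull_f (T : TwoDim (ι F.nint) l chi f) : pull ι f = 0 := by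
  ext x
  have := T.mul_e (ι x)
  rw [← map_mul, F.mul_nint, map_smul, CoalgHomClass.counit_comp_apply] at this
  exact (smul_eq_zero.1 (left_eq_add.1 this)).resolve_right T.l_ne

theorem f_hom (T : TwoDim (ι F.nint) l chi f) (x : K) : f (ι x) = 0 :=
  congrArg (fun q : HDual k K => q x) T.pull_f

theorem eq_of_invariant (T : TwoDim (ι F.nint) l chi f) (hF : ε F.Lam ≠ 0) {b : HDual k H}
    (hb : ∀ h x, b (h * ι x) = b h * ε x) : b = b 1 • 1 + b l • f := by
  have h1 : ∀ h, b (h * ι F.nint) = b h := fun h => by rw [hb, F.counit_nint hF, mul_one]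
  have h2 := h1 1
  rw [one_mul] at h2
  ext h
  rw [← h1 h, T.mul_e, map_add, map_smul, map_smul, h2]
  simp [mul_comm, HDual.one_apply]

theorem f_mul_f_eq (T : TwoDim (ι F.nint) l chi f) (hF : ε F.Lam ≠ 0) : f * f = (f * f) l • f := by
  have hff : ∀ x, (f * f) (ι x) = 0 := fun x => by
    have := congrArg (fun q : HDual k K => q x) (pull_mul ι f f)
    simpa [T.pull_f] using this
  have h := T.eq_of_invariant hF (b := f * f) fun h x => by
    rw [T.f_mul_f_mul, hff, T.f_hom, CoalgHomClass.counit_comp_apply]; ring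
  have h1 : (f * f) 1 = 0 := by simpa using hff 1
  rwa [h1, zero_smul, zero_add] at h

theorem f_mul_chi_add (T : TwoDim (ι F.nint) l chi f) (hF : ε F.Lam ≠ 0) :
    f * chi + chi * f = (f * f) l • (chi - chi * chi) := by
  set c := (f * f) l with hc
  have hff := T.f_mul_f_eq hF
  rw [← hc] at hff
  ext h
  have h1 := T.f_mul_f_mul h l
  rw [hff, HDual.smul_apply, HDual.smul_apply, HDual.smul_apply, T.f_mul, T.counit_l, T.f_l] at h1
  rw [HDual.smul_apply, HDual.sub_apply]
  linear_combination -h1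

theorem f_mul_f_and_pull_chi (T : TwoDim (ι F.nint) l chi f) (hF : ε F.Lam ≠ 0) (FH : Frob k H) (hFH : ε FH.Lam = 0) :
    (f * f) l = 0 ∧ pull ι chi ≠ 1 := by
  have hne : pull ι chi ≠ 1 := fun h1 => by
    have hb := T.eq_of_invariant hF (b := chi) fun h x => by
      rw [T.chi_mul]
      congr 1
      exact congrArg (fun q : HDual k K => q x) h1
    rw [T.chi_one, one_smul] at hb
    by_cases h0 : chi l = 0
    · rw [h0, zero_smul, add_zero] at hb
      have h2 := T.f_mul_chi_add hF
      rw [hb, mul_one, one_mul, mul_one, sub_self, smul_zero] at h2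
      refine T.f_ne (by
        have : (2 : k) • f = 0 := by rw [two_smul, h2]
        exact (smul_eq_zero.1 this).resolve_left two_ne_zero)
    · refine FH.counit_Lam_ne_zero (t := ι F.nint - (chi l)⁻¹ • l) (fun a => ?_) ?_ hFH
      · have h3 : chi a = ε a + chi l * f a := by
          conv_lhs => rw [hb]
          rfl
        rw [mul_sub, mul_smul_comm, T.mul_e, T.mul_l, smul_sub, smul_smul, smul_smul, h3, mul_add,
          inv_mul_cancel_left₀ h0, add_smul, mul_comm (ε a)]
        abel
      · rw [map_sub, map_smul, T.counit_e, T.counit_l]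
        simp
  refine ⟨?_, hne⟩
  have h4 := congrArg (pull ι) (T.f_mul_chi_add hF)
  have h5 : pull ι (f * chi + chi * f) = 0 := by
    change pull ι (f * chi) + pull ι (chi * f) = 0
    rw [pull_mul, pull_mul, T.pull_f, zero_mul, mul_zero, add_zero]
  rw [h5, pull_smul] at h4
  refine (smul_eq_zero.1 h4.symm).resolve_right fun h6 => hne ?_
  have h7 : pull ι chi - pull ι chi * pull ι chi = 0 := by rw [← pull_mul]; exact h6
  have h8 : HopfAlgebra.antipode k chi * chi = 1 := T.isGroupLikeElem.antipode_mul_cancel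
  have h9 : pull ι (HopfAlgebra.antipode k chi) * pull ι chi = 1 := by rw [← pull_mul, h8, pull_one]
  calc pull ι chi = pull ι (HopfAlgebra.antipode k chi) * (pull ι chi * pull ι chi) := by
        rw [← mul_assoc, h9, one_mul]
    _ = 1 := by rw [← sub_eq_zero.1 h7, h9]

end TwoDim
end index
end Hopf

namespace Hopf

section index
variable {k : Type*} [Field k] [CharZero k] [IsAlgClosed k] {K : Type*} [Ring K] [HopfAlgebra k K] [FiniteDimensional k K]
  {H : Type*} [Ring H] [HopfAlgebra k H] [FiniteDimensional k H]

local notation "ε" => Coalgebra.counit (R := k)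
local notation "σ" => HopfAlgebra.antipode k

theorem pull_surjective {ι : K →ₐc[k] H} (hι : Function.Injective ι) (q : HDual k K) : ∃ r : HDual k H, pull ι r = q := by
  obtain ⟨g, hg⟩ := LinearMap.exists_leftInverse_of_injective (ι : K →ₗ[k] H) (LinearMap.ker_eq_bot.2 hι)
  refine ⟨HDual.of (IsLinearMap.mk' (fun h => q (g h)) (by fun_prop)), HDual.ext fun x => ?_⟩
  exact congrArg q (congrArg (fun j : K →ₗ[k] K => j x) hg)

/-- The skew-primitive functional attached to a Hopf subalgebra of index two. -/
structure Index2 (ι : K →ₐc[k] H) (chi f : HDual k H) : Prop where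
  isGroupLikeElem : IsGroupLikeElem k chi
  f_ne : f ≠ 0
  f_mul_f : f * f = 0
  chi_mul_f : chi * f = -(f * chi)
  pull_f : pull ι f = 0
  pull_chi_ne : pull ι chi ≠ 1
  chi_pow : ∀ m : ℕ, pull ι (chi ^ m) = 1 → chi ^ m = 1
  mul_f_eq_zero : ∀ u, u * f = 0 ↔ pull ι u = 0
  exists_mul_f : ∀ q, pull ι q = 0 → ∃ u, q = u * f

namespace TwoDim
variable {ι : K →ₐc[k] H} {F : Frob k K} {l : H} {chi f : HDual k H}

theorem antipode_chi (T : TwoDim (ι F.nint) l chi f) (FH : Frob k H) (hFH : ε FH.Lam = 0) : σ chi = FH.alpha := by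
  obtain ⟨R, hR⟩ : ∃ R, R = σ FH.Lam := ⟨_, rfl⟩
  have hsurj : Function.Surjective (σ : H →ₗ[k] H) := LinearMap.injective_iff_surjective.1 FH.antipode_injective
  have hRm : ∀ y, R * y = ε y • R := fun y => by
    obtain ⟨x, rfl⟩ := hsurj y
    rw [hR, ← antipode_mul, FH.mul_Lam, map_smul]
    simp
  have hR0 : R ≠ 0 := fun h => by
    have h2 := FH.antipode_injective (hR.symm.trans (h.trans (map_zero _).symm))
    have h3 := FH.lam_Lam
    rw [h2, map_zero] at h3
    exact zero_ne_one h3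
  have hRl : R = f R • l := by
    have h1 := T.mul_e R
    rw [hRm, T.counit_e, one_smul] at h1
    have h2 : ε R = 0 := by rw [hR]; simpa using hFH
    rwa [h2, zero_smul, zero_add] at h1
  ext h
  rw [HDual.antipode_apply]
  have h1 : σ h * R = FH.alpha h • R := by rw [hR, ← antipode_mul, FH.Lam_mul, map_smul]
  have h2 : σ h * R = chi (σ h) • R := by rw [hRl, mul_smul_comm, T.mul_l, smul_comm]
  exact smul_left_injective k hR0 (h2.symm.trans h1)

theorem ract_l (T : TwoDim (ι F.nint) l chi f) (hff : f * f = 0) : ract f l = ι F.nint := by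
  have h1 : ract f l = ract f l * ι F.nint := by
    conv_lhs => rw [← T.l_mul_e]
    rw [ract_apply, ract_apply]
    rw [sw_mul l (ι F.nint) (fun x y => f y • x)]
    rw [← sw_map (k := k) (q := fun x => x * ι F.nint) (by fun_prop) l (fun x y => f y • x)]
    refine congrArg _ (funext₂ fun x y => ?_)
    rw [sw_hom ι F.nint (fun u v => f (y * v) • (x * u))]
    have h2 : ∀ u v : K, f (y * ι v) • (x * ι u) = f y • (x * ι (ε v • u)) := fun u v => by
      rw [T.f_mul, T.f_hom, CoalgHomClass.counit_comp_apply, mul_zero, add_zero, map_smul, mul_smul_comm, smul_smul]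
    simp only [h2]
    rw [sw_map (k := k) (q := fun w => f y • (x * ι w)) (by fun_prop) F.nint (fun u v => ε v • u),
      sw_counit_right F.nint (fun u => u), smul_mul_assoc]
  have h3 : ε (ract f l) = 1 := by
    have := apply_ract f 1 l
    rw [one_mul, HDual.one_apply, T.f_l] at this
    exact this
  have h4 : f (ract f l) = 0 := by rw [apply_ract, hff]; rfl
  rw [h1, T.mul_e, h3, h4]
  simp

theorem index2 (T : TwoDim (ι F.nint) l chi f) (hι : Function.Injective ι) (hF : ε F.Lam ≠ 0) (FH : Frob k H)
    (hFH : ε FH.Lam = 0) (hdim : Module.finrank k H = 2 * Module.finrank k K) : Index2 ι chi f := by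
  obtain ⟨h0, hne⟩ := T.f_mul_f_and_pull_chi hF FH hFH
  have hff : f * f = 0 := by rw [T.f_mul_f_eq hF, h0, zero_smul]
  have hanti : f * chi + chi * f = 0 := by rw [T.f_mul_chi_add hF, h0, zero_smul]
  have hchi : chi * f = -(f * chi) := eq_neg_of_add_eq_zero_right hanti
  have hinv : σ chi * chi = 1 := T.isGroupLikeElem.antipode_mul_cancel
  obtain ⟨j, hj⟩ : ∃ j : K →ₗ[k] H, ∀ x, j x = ι x := ⟨ι.toLinearMap, fun _ => rfl⟩
  have hjinj : Function.Injective j := fun x y h => hι (by rw [← hj, ← hj, h])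
  have hsub : LinearMap.range j ≤ LinearMap.range (ract f : H →ₗ[k] H) := by
    rintro _ ⟨a, rfl⟩
    obtain ⟨q, hq⟩ := F.exists_lactH_nint hF a
    obtain ⟨r, rfl⟩ := pull_surjective hι q
    refine ⟨lactH r l, ?_⟩
    rw [ract_lactH, T.ract_l hff, ← hq, lactH_apply, lactH_apply, sw_hom ι F.nint (fun x y => r x • y)]
    rw [hj, ← sw_map (k := k) (q := fun w => ι w) (by fun_prop) F.nint (fun x y => pull ι r x • y)]
    exact congrArg _ (funext₂ fun x y => (map_smul ι _ _).symm)
  have hker : LinearMap.range (ract f : H →ₗ[k] H) ≤ LinearMap.ker (ract f : H →ₗ[k] H) := by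
    rintro _ ⟨a, rfl⟩
    rw [LinearMap.mem_ker, ract_ract, hff, ract_apply]
    change sw k a (fun x y => (0 : k) • x) = 0
    simp only [zero_smul]
    exact sw_zero a
  have hrn := LinearMap.finrank_range_add_finrank_ker (ract f : H →ₗ[k] H)
  have hle := Submodule.finrank_mono hsub
  have hle2 := Submodule.finrank_mono hker
  rw [LinearMap.finrank_range_of_inj hjinj] at hle
  have heq1 : LinearMap.range j = LinearMap.range (ract f : H →ₗ[k] H) :=
    Submodule.eq_of_le_of_finrank_le hsub (by rw [LinearMap.finrank_range_of_inj hjinj]; omega)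
  have heq2 : LinearMap.range (ract f : H →ₗ[k] H) = LinearMap.ker (ract f : H →ₗ[k] H) :=
    Submodule.eq_of_le_of_finrank_le hker (by omega)
  refine ⟨T.isGroupLikeElem, T.f_ne, hff, hchi, T.pull_f, hne, fun m hm => ?_, fun u => ⟨fun h => HDual.ext fun x => ?_, fun h => HDual.ext fun y => ?_⟩, fun q hq => ?_⟩
  · have hb := T.eq_of_invariant hF (b := chi ^ m) fun h x => by
      rw [(isGroupLikeElem_dual_iff.1 (T.isGroupLikeElem.pow (n := m))).2 h (ι x)]
      congr 1
      exact congrArg (fun q : HDual k K => q x) hm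
    have h1 : (chi ^ m) 1 = 1 := (isGroupLikeElem_dual_iff.1 (T.isGroupLikeElem.pow (n := m))).1
    rw [h1, one_smul] at hb
    have hc : chi * chi ^ m = chi ^ m * chi := (pow_succ' chi m).symm.trans (pow_succ chi m)
    have hfl : f * chi ≠ 0 := fun h => T.f_ne (by
      have h2 : chi * f = 0 := by rw [hchi, h, neg_zero]
      rw [← one_mul f, ← hinv, mul_assoc, h2, mul_zero])
    by_cases hs : (chi ^ m) l = 0
    · rw [hs, zero_smul, add_zero] at hb
      exact hb
    · exfalso
      rw [hb, mul_add, add_mul, mul_one, one_mul, mul_smul_comm, smul_mul_assoc, hchi, add_right_inj, smul_neg,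
        neg_eq_iff_add_eq_zero, ← two_smul k, smul_smul] at hc
      exact (smul_ne_zero (mul_ne_zero two_ne_zero hs) hfl) hc
  · obtain ⟨y, hy⟩ : ι x ∈ LinearMap.range (ract f : H →ₗ[k] H) := hsub ⟨x, hj x⟩
    change u (ι x) = 0
    rw [← hy, apply_ract, h]; rfl
  · rw [← apply_ract]
    obtain ⟨x, hx⟩ : ract f y ∈ LinearMap.range j := heq1 ▸ ⟨y, rfl⟩
    rw [← hx, hj]
    exact congrArg (fun q : HDual k K => q x) h
  · have h1 : HDual.toLin q ∈ (LinearMap.ker (ract f : H →ₗ[k] H)).dualAnnihilator := by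
      rw [Submodule.mem_dualAnnihilator, ← heq2, ← heq1]
      rintro _ ⟨x, rfl⟩
      rw [hj]
      exact congrArg (fun q : HDual k K => q x) hq
    rw [← LinearMap.range_dualMap_eq_dualAnnihilator_ker] at h1
    obtain ⟨u, hu⟩ := h1
    refine ⟨HDual.of u, HDual.ext fun y => ?_⟩
    rw [← apply_ract]
    exact (congrArg (fun j : H →ₗ[k] k => j y) hu).symm

end TwoDim

namespace Index2
variable {ι : K →ₐc[k] H} {chi f : HDual k H}

theorem chi_pow_mul_f (D : Index2 ι chi f) (m : ℕ) : chi ^ m * f = (-1) ^ m * (f * chi ^ m) := by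
  induction m with
  | zero => simp
  | succ m ih => rw [pow_succ, mul_assoc, D.chi_mul_f, mul_neg, ← mul_assoc, ih, pow_succ, mul_assoc, mul_assoc]; simp

theorem even_of_chi_pow (D : Index2 ι chi f) {m : ℕ} (h : chi ^ m = 1) : Even m := by
  by_contra hm
  have h1 := D.chi_pow_mul_f m
  rw [h, Odd.neg_one_pow (Nat.not_even_iff_odd.1 hm), one_mul, mul_one, neg_one_mul, eq_neg_iff_add_eq_zero, ← two_smul k] at h1
  exact D.f_ne ((smul_eq_zero.1 h1).resolve_left two_ne_zero)

theorem mul_eq_zero (D : Index2 ι chi f) {q r : HDual k H} (hq : pull ι q = 0) (hr : pull ι r = 0) : q * r = 0 := by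
  obtain ⟨u, rfl⟩ := D.exists_mul_f q hq
  obtain ⟨w, rfl⟩ := D.exists_mul_f r hr
  obtain ⟨v, hv⟩ := D.exists_mul_f (f * w) (by rw [pull_mul, D.pull_f, zero_mul])
  rw [mul_assoc, ← mul_assoc f, hv, mul_assoc v, D.f_mul_f, mul_zero, mul_zero]

end Index2

theorem exists_index2 (ι : K →ₐc[k] H) (hι : Function.Injective ι) (F : Frob k K) (hF : ε F.Lam ≠ 0) (FH : Frob k H)
    (hFH : ε FH.Lam = 0) (hdim : Module.finrank k H = 2 * Module.finrank k K) :
    ∃ chi f : HDual k H, Index2 ι chi f ∧ σ chi = FH.alpha := by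
  have : Nontrivial K := ⟨F.Lam, 0, fun h => hF (by rw [h, map_zero])⟩
  have hpos : 0 < Module.finrank k K := Module.finrank_pos
  have h1 : ε (ι F.nint) = 1 := by rw [CoalgHomClass.counit_comp_apply, F.counit_nint hF]
  have h2 : ι F.nint * ι F.nint = ι F.nint := by rw [← map_mul, F.nint_mul_nint hF]
  have h3 := finrank_range_mulRight_nint ι F FH hι hF
  rw [hdim, mul_comm 2] at h3
  obtain ⟨l, chi, f, T⟩ := exists_twoDim h1 h2 (Nat.eq_of_mul_eq_mul_left hpos h3)
  exact ⟨chi, f, T.index2 hι hF FH hFH hdim, T.antipode_chi FH hFH⟩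

end index
end Hopf

namespace Hopf

section linalg
variable {k : Type*} [Field k] [CharZero k] [IsAlgClosed k] {V : Type*} [AddCommGroup V] [Module k V] [FiniteDimensional k V]

theorem even_of_trace_eq_zero {E X : Module.End k V} (hE : E * E = E) (hc : Commute E X) (hX : X ^ 4 = 1)
    (h0 : LinearMap.trace k V (E * X) = 0) {r : ℕ} (hr : LinearMap.trace k V E = r) : Even r := by
  have : NeZero 4 := ⟨by norm_num⟩
  obtain ⟨ω, hω⟩ := HasEnoughRootsOfUnity.exists_primitiveRoot k 4
  have hω2 : ω ^ 2 = -1 := by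
    have h1 : ω ^ 2 * ω ^ 2 = 1 := by rw [← pow_add]; exact hω.pow_eq_one
    exact (mul_self_eq_one_iff.1 h1).resolve_left (hω.pow_ne_one_of_pos_of_lt two_ne_zero (by norm_num))
  have hcp : ∀ m, Commute E (prj ω 4 X m) := fun m =>
    Commute.smul_right (Commute.sum_right _ _ _ fun j _ => (hc.pow_right j).smul_right _) _
  have hid : ∀ m, (E * prj ω 4 X m) * (E * prj ω 4 X m) = E * prj ω 4 X m := fun m => by
    rw [(hcp m).symm.mul_mul_mul_comm, hE, prj_mul_prj (by norm_num) hω.pow_eq_one hX]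
  choose r' hr' using fun m => exists_trace_idem (hid m)
  have h : ∀ i, LinearMap.trace k V (E * X ^ i) = ∑ m ∈ Finset.range 4, (r' m : k) * ω ^ (m * i) := fun i => by
    rw [pow_eq_sum_prj (by norm_num) hω hX i, Finset.mul_sum, map_sum]
    simp [hr', mul_comm]
  have h1 := h 0
  have h2 := h 1
  rw [pow_zero, mul_one, hr] at h1
  rw [pow_one, h0] at h2
  simp only [Finset.sum_range_succ, Finset.sum_range_zero, mul_zero, pow_zero, mul_one, pow_one, zero_add, hω2] at h1 h2
  have hω3 : ω ^ 3 = -ω := by rw [pow_succ, hω2]; ring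
  rw [hω3] at h2
  set a : ℤ := r' 0 - r' 2 with ha
  set b : ℤ := r' 1 - r' 3 with hb
  have h3 : (a : k) + b * ω = 0 := by rw [ha, hb]; push_cast; linear_combination -h2
  have h4 : ((a * a + b * b : ℤ) : k) = 0 := by
    push_cast
    linear_combination ((a : k) - b * ω) * h3 + (b : k) ^ 2 * hω2
  have h5 : a * a + b * b = 0 := by exact_mod_cast h4
  have h6 : a = 0 := by nlinarith [mul_self_nonneg a, mul_self_nonneg b]
  have h7 : b = 0 := by nlinarith [mul_self_nonneg a, mul_self_nonneg b]
  have h8 : r = r' 0 + r' 1 + r' 2 + r' 3 := by exact_mod_cast h1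
  exact ⟨r' 0 + r' 1, by omega⟩

theorem exists_radical_of_odd (hd : Odd (Module.finrank k V)) (B : V →ₗ[k] V →ₗ[k] k) (hB : ∀ x y, B x y = -B y x) :
    ∃ x, x ≠ 0 ∧ ∀ y, B x y = 0 := by
  let b := Module.finBasis k V
  let A : Matrix (Fin (Module.finrank k V)) (Fin (Module.finrank k V)) k := Matrix.of fun i j => B (b i) (b j)
  have hA : A.transpose = -A := Matrix.ext fun i j => hB _ _
  have hdet : A.det = 0 := by
    have h1 := congrArg Matrix.det hA
    rw [Matrix.det_transpose, Matrix.det_neg, Fintype.card_fin, hd.neg_one_pow, neg_one_mul, eq_neg_iff_add_eq_zero, ← two_mul] at h1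
    exact (mul_eq_zero.1 h1).resolve_left two_ne_zero
  obtain ⟨v, hv0, hv⟩ := Matrix.exists_vecMul_eq_zero_iff.2 hdet
  refine ⟨∑ i, v i • b i, fun h => hv0 (funext fun i => ?_), fun y => ?_⟩
  · exact Fintype.linearIndependent_iff.1 b.linearIndependent v h i
  · have h2 : B (∑ i, v i • b i) = 0 := b.ext fun j => by
      have := congrFun hv j
      simpa [Matrix.vecMul, dotProduct, A] using this
    rw [h2]; rfl

end linalg

section ng
variable {k : Type*} [Field k] [CharZero k] [IsAlgClosed k]

local notation "ε" => Coalgebra.counit (R := k)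
local notation "σ" => HopfAlgebra.antipode k

theorem isGroupLikeElem_pull {K H : Type*} [Ring K] [HopfAlgebra k K] [FiniteDimensional k K] [Ring H] [HopfAlgebra k H]
    [FiniteDimensional k H] (ι : K →ₐc[k] H) {χ : HDual k H} (h : IsGroupLikeElem k χ) : IsGroupLikeElem k (pull ι χ) := by
  obtain ⟨h1, h2⟩ := isGroupLikeElem_dual_iff.1 h
  refine isGroupLikeElem_dual_iff.2 ⟨?_, fun a b => ?_⟩
  · rw [pull_apply, map_one, h1]
  · simp only [pull_apply, map_mul, h2]

theorem pull_pow {K H : Type*} [Ring K] [HopfAlgebra k K] [FiniteDimensional k K] [Ring H] [HopfAlgebra k H]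
    [FiniteDimensional k H] (ι : K →ₐc[k] H) (χ : HDual k H) (m : ℕ) : pull ι (χ ^ m) = pull ι χ ^ m := by
  induction m with
  | zero => rw [pow_zero, pow_zero, pull_one]
  | succ m ih => rw [pow_succ, pow_succ, pull_mul, ih]

theorem sq_eq_one_of_not_semisimple {H : Type*} [Ring H] [HopfAlgebra k H] [FiniteDimensional k H] {p : ℕ} (hp : p.Prime) (hodd : Odd p)
    (hd : Module.finrank k H = 2 * p) (F : Frob k H) (hF : ε F.Lam = 0) {a : H} (ha : IsGroupLikeElem k a) : a ^ 2 = 1 := by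
  have hdvd := orderOf_dvd_finrank ha
  have hfr := finrank_adjoin ha
  rw [hd] at hdvd
  rw [← orderOf_dvd_iff_pow_eq_one]
  obtain ⟨d, e, hd2, hep, hde⟩ := (Nat.dvd_mul).1 hdvd
  rcases (Nat.dvd_prime hp).1 hep with he | he
  · rw [← hde, he, mul_one]; exact hd2
  exfalso
  rcases (Nat.dvd_prime Nat.prime_two).1 hd2 with hd1 | hd1
  · have hS := isHopfSub_adjoin ha
    obtain ⟨FK, hFK, -⟩ := exists_frob_adjoin ha hS
    have hord : orderOf a = p := by rw [← hde, he, hd1, one_mul]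
    obtain ⟨chi, f, D, -⟩ := exists_index2 (subHom (k := k) (Algebra.adjoin k {a})) (subHom_injective _) FK hFK F hF
      (by rw [hfr, hd, hord])
    have h1 : (pull (subHom (k := k) (Algebra.adjoin k {a})) chi) ^ p = 1 := by
      have h2 := orderOf_dvd_finrank (isGroupLikeElem_pull (subHom (k := k) (Algebra.adjoin k {a})) D.isGroupLikeElem)
      rw [HDual.finrank_eq, hfr, hord] at h2
      exact orderOf_dvd_iff_pow_eq_one.1 h2
    have h2 := D.even_of_chi_pow (D.chi_pow p (by rw [pull_pow, h1]))
    exact (Nat.not_even_iff_odd.2 hodd) h2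
  · have htop : Algebra.adjoin k {a} = ⊤ := by
      rw [← Algebra.toSubmodule_eq_top]
      refine Submodule.eq_top_of_finrank_eq ?_
      change Module.finrank k (Algebra.adjoin k {a}) = _
      rw [hfr, hd, ← hde, he, hd1]
    exact F.counit_Lam_ne_zero (t := avg (k := k) a) (fun x => mul_avg_of_mem ha (htop ▸ Algebra.mem_top))
      (by rw [counit_avg ha]; exact one_ne_zero) hF

theorem antipode_pow_eight {H : Type*} [Ring H] [HopfAlgebra k H] [FiniteDimensional k H] (F : Frob k H)
    (hg : F.g ^ 2 = 1) (hα : F.alpha ^ 2 = 1) (a : H) : σ (σ (σ (σ (σ (σ (σ (σ a))))))) = a := by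
  have hG := F.isGroupLikeElem_g
  have hA := F.isGroupLikeElem_alpha
  have hσg : σ F.g = F.g := by
    have := hG.antipode_mul_cancel
    calc σ F.g = σ F.g * F.g ^ 2 := by rw [hg, mul_one]
      _ = F.g := by rw [pow_two, ← mul_assoc, this, one_mul]
  have hαg : F.alpha F.g * F.alpha F.g = 1 := by
    rw [← Hopf.IsGroupLikeElem.apply_mul hG, ← pow_two, hα, HDual.one_apply, hG.counit_eq_one]
  have h4 : ∀ b, σ (σ (σ (σ b))) = F.g * ract F.alpha (lactH F.alpha b) * F.g := fun b => by
    have h1 := F.radford (lactH F.alpha b)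
    rw [lactH_lactH, ← pow_two, hα, lactH_one, hσg] at h1
    rw [h1, mul_assoc, mul_assoc, mul_assoc, ← pow_two, hg, mul_one, ← mul_assoc, ← pow_two, hg, one_mul]
  rw [h4, h4]
  rw [lactH_mul hA, lactH_mul hA, ract_mul hA, ract_mul hA, lactH_grouplike hG, map_smul, ract_grouplike hG,
    ← ract_lactH F.alpha F.alpha (lactH F.alpha a), lactH_lactH, ract_lactH, ract_lactH, ract_ract, ← pow_two, hα, lactH_one, ract_one]
  simp only [smul_mul_assoc, mul_smul_comm, smul_smul]
  rw [hαg, one_mul, one_smul]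
  rw [mul_assoc, mul_assoc, mul_assoc, ← pow_two, hg, mul_one, ← mul_assoc, ← pow_two, hg, one_mul]

theorem antipode_antipode_avg {H : Type*} [Ring H] [HopfAlgebra k H] [FiniteDimensional k H] {a : H}
    (ha : IsGroupLikeElem k a) : σ (σ (avg (k := k) a)) = avg (k := k) a := by
  rw [avg, map_smul, map_smul, map_sum, map_sum]
  congr 1
  exact Finset.sum_congr rfl fun i _ => _root_.IsGroupLikeElem.antipode_antipode ha.pow

theorem eq_one_of_not_semisimple {H : Type*} [Ring H] [HopfAlgebra k H] [FiniteDimensional k H] {p : ℕ} (hp : p.Prime) (hodd : Odd p)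
    (hd : Module.finrank k H = 2 * p) (F : Frob k H) (hF : ε F.Lam = 0) {a : H} (ha : IsGroupLikeElem k a) : a = 1 := by
  have h1 : F.lam 1 = 0 := by
    by_contra h
    exact F.lam_one_ne_zero_iff.1 h hF
  have hg := sq_eq_one_of_not_semisimple hp hodd hd F hF F.isGroupLikeElem_g
  have hα := sq_eq_one_of_not_semisimple hp hodd ((HDual.finrank_eq (k := k)).trans hd) F.dual h1 F.isGroupLikeElem_alpha
  by_contra hne
  have ha2 := sq_eq_one_of_not_semisimple hp hodd hd F hF ha
  have hord : orderOf a = 2 := orderOf_eq_prime ha2 hne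
  obtain ⟨r, hr, hr2⟩ := exists_trace_avg ha
  rw [hord, hd] at hr2
  have hrp : r = p := by omega
  refine Nat.not_even_iff_odd.2 hodd (hrp ▸ even_of_trace_eq_zero (E := LinearMap.mulLeft k (avg (k := k) a))
    (X := (HopfAlgebra.antipode k : H →ₗ[k] H) ∘ₗ (HopfAlgebra.antipode k : H →ₗ[k] H)) ?_ ?_ ?_ ?_ hr)
  · refine LinearMap.ext fun x => ?_
    change avg (k := k) a * (avg (k := k) a * x) = avg (k := k) a * x
    rw [← mul_assoc, mul_avg_of_mem ha (avg_mem a), counit_avg ha, one_smul]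
  · refine LinearMap.ext fun x => ?_
    change avg (k := k) a * (σ (σ x)) = σ (σ (avg (k := k) a * x))
    rw [antipode_antipode_mul, antipode_antipode_avg ha]
  · exact LinearMap.ext fun x => antipode_pow_eight F hg hα x
  · rw [← Tr_eq_trace]
    refine (F.trace_mul_antipode_sq (avg (k := k) a)).trans ?_
    rw [hF, mul_zero]

/-- A Hopf algebra of dimension `2p`, with `p` an odd prime, is semisimple. -/
theorem counit_Lam_ne_zero_of_two_mul_prime {H : Type*} [Ring H] [HopfAlgebra k H] [FiniteDimensional k H] {p : ℕ}
    (hp : p.Prime) (hodd : Odd p) (hd : Module.finrank k H = 2 * p) (F : Frob k H) : ε F.Lam ≠ 0 := by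
  intro hF
  have h1 : F.lam 1 = 0 := by
    by_contra h
    exact F.lam_one_ne_zero_iff.1 h hF
  have hg := eq_one_of_not_semisimple hp hodd hd F hF F.isGroupLikeElem_g
  have hα := eq_one_of_not_semisimple hp hodd ((HDual.finrank_eq (k := k)).trans hd) F.dual h1 F.isGroupLikeElem_alpha
  have h4 := F.antipode_pow_four hα hg
  have hsw : ∀ a b, F.lam (b * σ (σ a)) = F.lam (a * b) := fun a b => by
    obtain ⟨n, hn⟩ := F.exists_nakayama a
    have h5 := F.ract_nakayama hn
    rw [hα, ract_one] at h5
    rw [← h5, hn]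
  have hinv : ∀ a, F.lam (σ (σ a)) = F.lam a := fun a => by simpa using hsw a 1
  let X : Module.End k H := (HopfAlgebra.antipode k : H →ₗ[k] H) ∘ₗ (HopfAlgebra.antipode k : H →ₗ[k] H)
  have hX : X * X = 1 := LinearMap.ext h4
  have hE := half_sub_idem (k := k) (A := Module.End k H) (e := 1) (s := X) (mul_one 1) (one_mul X) (mul_one X) hX
  obtain ⟨E, hEdef⟩ : ∃ E : Module.End k H, E = (2 : k)⁻¹ • (1 - X) := ⟨_, rfl⟩
  rw [← hEdef] at hE
  have htr : LinearMap.trace k H X = 0 := by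
    rw [← Tr_eq_trace]
    have := F.trace_mul_antipode_sq 1
    rw [hF, mul_zero] at this
    rw [← this]
    exact congrArg (Tr k) (funext fun x => (one_mul _).symm)
  have htrE : LinearMap.trace k H E = p := by
    rw [hEdef, map_smul, map_sub, htr, LinearMap.trace_one, hd]
    simp
  have hrk : Module.finrank k (LinearMap.range E) = p := by
    have := (LinearMap.IsIdempotentElem.isProj_range E hE).trace
    rw [htrE] at this
    exact_mod_cast this.symm
  have hmem : ∀ x ∈ LinearMap.range E, σ (σ x) = -x := by
    rintro _ ⟨x, rfl⟩
    have h6 : X * E = -E := by rw [hEdef, mul_smul_comm, mul_sub, mul_one, hX, ← neg_sub 1 X, smul_neg]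
    exact congrArg (fun j : Module.End k H => j x) h6
  let B : LinearMap.range E →ₗ[k] LinearMap.range E →ₗ[k] k :=
    LinearMap.mk₂ k (fun x y => F.lam ((x : H) * y)) (fun x y z => by simp [add_mul]) (fun c x y => by simp)
      (fun x y z => by simp [mul_add]) (fun c x y => by simp)
  obtain ⟨x, hx0, hx⟩ := exists_radical_of_odd (by rw [hrk]; exact hodd) B fun x y => by
    change F.lam ((x : H) * y) = -F.lam ((y : H) * x)
    rw [← hsw, hmem _ x.2, mul_neg, map_neg]
  have hx1 : ∀ y, F.lam (y * (x : H)) = 0 := fun y => by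
    have h7 : F.lam ((x : H) * E y) = 0 := hx ⟨E y, y, rfl⟩
    have h8 : F.lam (σ (σ ((x : H) * σ (σ y)))) = F.lam ((x : H) * σ (σ y)) := hinv _
    rw [antipode_antipode_mul, h4, hmem _ x.2, neg_mul, map_neg] at h8
    have h9 : E y = (2 : k)⁻¹ • (y - σ (σ y)) := by rw [hEdef]; rfl
    rw [h9, mul_smul_comm, mul_sub, map_smul, map_sub, ← h8, sub_neg_eq_add, ← two_mul, smul_eq_mul,
      inv_mul_cancel_left₀ two_ne_zero] at h7
    have h10 := hsw (x : H) y
    rw [hmem _ x.2, mul_neg, map_neg, h7, neg_eq_zero] at h10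
    exact h10
  exact hx0 (Subtype.ext (F.nondeg_right hx1))

end ng
end Hopf

namespace Hopf

section reduction
variable {k : Type*} [Field k] [CharZero k] [IsAlgClosed k] {K : Type*} [Ring K] [HopfAlgebra k K] [FiniteDimensional k K]
  {H : Type*} [Ring H] [HopfAlgebra k H] [FiniteDimensional k H]

local notation "ε" => Coalgebra.counit (R := k)
local notation "σ" => HopfAlgebra.antipode k

/-- The dual of the group algebra of a finite cyclic group is again one. -/
theorem exists_isGroupLikeElem_of_dual {c : HDual k K} (hc : IsGroupLikeElem k c) (hord : orderOf c = Module.finrank k K) :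
    ∃ a : K, IsGroupLikeElem k a ∧ orderOf a = Module.finrank k K := by
  obtain ⟨n, hn⟩ : ∃ n, n = Module.finrank k K := ⟨_, rfl⟩
  rw [← hn] at hord ⊢
  have hn0 : 0 < n := hord ▸ orderOf_pos_of_isGroupLikeElem hc
  have : NeZero n := ⟨hn0.ne'⟩
  obtain ⟨ζ, hζ⟩ := HasEnoughRootsOfUnity.exists_primitiveRoot k n
  have hspan : Submodule.span k (Set.range fun i : Fin (orderOf c) => c ^ (i : ℕ)) = ⊤ := by
    refine Submodule.eq_top_of_finrank_eq ?_
    rw [finrank_span_eq_card (linearIndependent_pow hc), Fintype.card_fin, hord, hn, HDual.finrank_eq]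
  let b := Module.Basis.mk (linearIndependent_pow hc) hspan.ge
  obtain ⟨a, ha⟩ := exists_ev (k := k) (H := K) (HDual.of (b.constr k fun i => ζ ^ (i : ℕ)))
  have h1 : ∀ m : ℕ, (c ^ m) a = ζ ^ m := fun m => by
    have hlt : m % orderOf c < orderOf c := Nat.mod_lt _ (hord ▸ hn0)
    rw [← pow_mod_orderOf c m, ← ha]
    have h2 := b.constr_basis k (fun i : Fin (orderOf c) => ζ ^ (i : ℕ)) ⟨m % orderOf c, hlt⟩
    rw [Module.Basis.mk_apply] at h2
    refine h2.trans ?_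
    change ζ ^ (m % orderOf c) = ζ ^ m
    rw [hord, hζ.eq_orderOf, pow_mod_orderOf]
  have hG : IsGroupLikeElem k a := by
    refine isGroupLikeElem_of_apply ?_ fun q r => ?_
    · have := h1 0
      rwa [pow_zero, pow_zero, HDual.one_apply] at this
    · have hq : q ∈ Submodule.span k (Set.range fun i : Fin (orderOf c) => c ^ (i : ℕ)) := hspan ▸ Submodule.mem_top
      have hr : r ∈ Submodule.span k (Set.range fun i : Fin (orderOf c) => c ^ (i : ℕ)) := hspan ▸ Submodule.mem_top
      induction hq using Submodule.span_induction with
      | zero => rw [zero_mul, HDual.zero_apply, zero_mul]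
      | add x y _ _ hx hy => rw [add_mul, HDual.add_apply, HDual.add_apply, hx, hy, add_mul]
      | smul t x _ hx => rw [smul_mul_assoc, HDual.smul_apply, HDual.smul_apply, hx, mul_assoc]
      | mem x hx =>
        obtain ⟨i, rfl⟩ := hx
        induction hr using Submodule.span_induction with
        | zero => rw [mul_zero, HDual.zero_apply, mul_zero]
        | add x y _ _ hx hy => rw [mul_add, HDual.add_apply, HDual.add_apply, hx, hy, mul_add]
        | smul t x _ hx => rw [mul_smul_comm, HDual.smul_apply, HDual.smul_apply, hx, mul_left_comm]
        | mem x hx =>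
          obtain ⟨j, rfl⟩ := hx
          change (c ^ (i : ℕ) * c ^ (j : ℕ)) a = (c ^ (i : ℕ)) a * (c ^ (j : ℕ)) a
          rw [← pow_add, h1, h1, h1, pow_add]
  refine ⟨a, hG, Nat.dvd_antisymm ((orderOf_dvd_finrank hG).trans hn.symm.dvd) ?_⟩
  have h2 := (isGroupLikeElem_dual_iff.1 hc).1
  have h3 : ∀ m : ℕ, c (a ^ m) = ζ ^ m := fun m => by
    induction m with
    | zero => simpa using h2
    | succ m ih =>
      have := h1 1
      rw [pow_one, pow_one] at this
      rw [pow_succ, (isGroupLikeElem_dual_iff.1 hc).2, ih, this, pow_succ]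
  refine hζ.dvd_of_pow_eq_one _ ?_
  rw [← h3, pow_orderOf_eq_one, h2]

theorem isGroupLikeElem_of_hom {ι : K →ₐc[k] H} (hι : Function.Injective ι) {a : K} (ha : IsGroupLikeElem k (ι a)) :
    IsGroupLikeElem k a := by
  refine isGroupLikeElem_of_apply ?_ fun q r => ?_
  · rw [← CoalgHomClass.counit_comp_apply (F := K →ₐc[k] H) ι]; exact ha.counit_eq_one
  · obtain ⟨q, rfl⟩ := pull_surjective hι q
    obtain ⟨r, rfl⟩ := pull_surjective hι r
    rw [← pull_mul]
    exact Hopf.IsGroupLikeElem.apply_mul ha q r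

theorem mem_range_of_pull {ι : K →ₐc[k] H} {a : H} (h : ∀ q, pull ι q = 0 → q a = 0) : ∃ x, ι x = a := by
  have h1 : a ∈ LinearMap.range ι.toLinearMap := by
    rw [← Subspace.forall_mem_dualAnnihilator_apply_eq_zero_iff]
    intro φ hφ
    exact h (HDual.of φ) (HDual.ext fun x => (Submodule.mem_dualAnnihilator φ).1 hφ _ ⟨x, rfl⟩)
  exact h1

theorem ract_hom (ι : K →ₐc[k] H) (q : HDual k H) (x : K) : ract q (ι x) = ι (ract (pull ι q) x) := by
  rw [ract_apply, ract_apply, sw_hom ι x (fun u v => q v • u), ← sw_map (k := k) (q := fun w => ι w) (by fun_prop) x (fun u v => pull ι q v • u)]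
  exact congrArg _ (funext₂ fun u v => (map_smul ι _ _).symm)

theorem lactH_hom (ι : K →ₐc[k] H) (q : HDual k H) (x : K) : lactH q (ι x) = ι (lactH (pull ι q) x) := by
  rw [lactH_apply, lactH_apply, sw_hom ι x (fun u v => q u • v), ← sw_map (k := k) (q := fun w => ι w) (by fun_prop) x (fun u v => pull ι q u • v)]
  exact congrArg _ (funext₂ fun u v => (map_smul ι _ _).symm)

namespace Index2
variable {ι : K →ₐc[k] H} {chi f : HDual k H} {F : Frob k K} {FH : Frob k H}

theorem pull_lam (hι : Function.Injective ι) (hF : ε F.Lam ≠ 0) (hFH : ε FH.Lam = 0) : pull ι FH.lam = 0 := by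
  have h0 : FH.lam 1 = 0 := by
    by_contra h
    exact FH.lam_one_ne_zero_iff.1 h hFH
  have h1 := F.eq_smul_lam (l := pull ι FH.lam) fun q => by
    obtain ⟨r, rfl⟩ := pull_surjective hι q
    rw [← pull_mul, FH.mul_lam, pull_smul, pull_apply, map_one ι]
  have h2 := congrArg (fun q : HDual k K => q 1) h1
  have h3 : pull ι FH.lam 1 = 0 := by rw [pull_apply, map_one ι, h0]
  simp only [h3, HDual.smul_apply] at h2
  have h4 : pull ι FH.lam F.Lam = 0 := (_root_.mul_eq_zero.1 h2.symm).resolve_right (F.lam_one_ne_zero hF)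
  rw [h1, h4, zero_smul]

theorem chi_g (D : Index2 ι chi f) (hι : Function.Injective ι) (hF : ε F.Lam ≠ 0) (hFH : ε FH.Lam = 0) : chi FH.g = -1 := by
  obtain ⟨u, hu⟩ := D.exists_mul_f _ (pull_lam hι hF hFH)
  have hlne : FH.lam ≠ 0 := fun h => by
    have := FH.lam_Lam
    rw [h] at this
    exact zero_ne_one this
  have h1 := F.eq_smul_lam (l := pull ι u) fun q => by
    obtain ⟨r, rfl⟩ := pull_surjective hι q
    have h2 : (r * u - r 1 • u) * f = 0 := by rw [sub_mul, smul_mul_assoc, mul_assoc, ← hu, FH.mul_lam, sub_self]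
    have h3 := (D.mul_f_eq_zero _).1 h2
    have h4 : pull ι (r * u) - r 1 • pull ι u = 0 := h3
    rw [pull_mul] at h4
    rw [sub_eq_zero.1 h4, pull_apply, map_one ι]
  have h5 : pull ι (u * chi - u) = 0 := by
    have h6 : pull ι u * pull ι chi = pull ι u := by
      rw [h1, smul_mul_assoc, F.lam_mul, F.g_eq_one hF, (isGroupLikeElem_dual_iff.1 (isGroupLikeElem_pull ι D.isGroupLikeElem)).1, one_smul]
    change pull ι (u * chi) - pull ι u = 0
    rw [pull_mul, h6, sub_self]
  have h7 := (D.mul_f_eq_zero _).2 h5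
  have h8 : FH.lam * chi = -FH.lam := by
    rw [sub_mul, mul_assoc, D.chi_mul_f, mul_neg, ← mul_assoc, ← hu] at h7
    exact neg_eq_iff_eq_neg.1 (sub_eq_zero.1 h7)
  rw [FH.lam_mul, ← neg_one_smul k FH.lam] at h8
  exact smul_left_injective k hlne h8

theorem exists_g (D : Index2 ι chi f) (hι : Function.Injective ι) (hF : ε F.Lam ≠ 0) (hFH : ε FH.Lam = 0) : ∃ x, ι x = FH.g := by
  refine mem_range_of_pull fun q hq => ?_
  have hlne : FH.lam ≠ 0 := fun h => by
    have := FH.lam_Lam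
    rw [h] at this
    exact zero_ne_one this
  have h1 := D.mul_eq_zero (pull_lam hι hF hFH) hq
  rw [FH.lam_mul] at h1
  exact (smul_eq_zero.1 h1).resolve_right hlne

theorem exists_generator_or (D : Index2 ι chi f) (hα : σ chi = FH.alpha) (hι : Function.Injective ι) (hF : ε F.Lam ≠ 0) (hFH : ε FH.Lam = 0)
    {p : ℕ} (hp : p.Prime) (hd : Module.finrank k K = 2 * p) :
    (∃ a : K, IsGroupLikeElem k a ∧ orderOf a = 2 * p) ∨
    ∃ (g : K) (c : HDual k K), IsGroupLikeElem k g ∧ IsGroupLikeElem k c ∧ g * g = 1 ∧ c * c = 1 ∧ c g = -1 ∧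
      ∀ x, ract c x = g * lactH c x * g := by
  have hp2 : ∀ m : ℕ, Even m → m ∣ 2 * p → m = 2 ∨ m = 2 * p := fun m hm hm2 => by
    obtain ⟨d, rfl⟩ := hm
    rw [← two_mul] at hm2 ⊢
    rcases (Nat.dvd_prime hp).1 (Nat.dvd_of_mul_dvd_mul_left two_pos hm2) with h | h
    · left; rw [h, mul_one]
    · right; rw [h]
  have hcG := isGroupLikeElem_pull ι D.isGroupLikeElem
  have hcpow : chi ^ orderOf (pull ι chi) = 1 := D.chi_pow _ (by rw [pull_pow, pow_orderOf_eq_one])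
  have hdvd := orderOf_dvd_finrank hcG
  rw [HDual.finrank_eq, hd] at hdvd
  rcases hp2 _ (D.even_of_chi_pow hcpow) hdvd with h2 | h2
  swap
  · left
    rw [← hd] at h2 ⊢
    exact exists_isGroupLikeElem_of_dual hcG h2
  rw [h2, pow_two] at hcpow
  have hαchi : FH.alpha = chi := by
    have h3 := D.isGroupLikeElem.antipode_mul_cancel
    rw [← hα]
    calc σ chi = σ chi * (chi * chi) := by rw [hcpow, mul_one]
      _ = chi := by rw [← mul_assoc, h3, one_mul]
  obtain ⟨g, hg⟩ := D.exists_g hι hF hFH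
  have hgG : IsGroupLikeElem k g := isGroupLikeElem_of_hom hι (hg ▸ FH.isGroupLikeElem_g)
  have hcg : pull ι chi g = -1 := by rw [pull_apply, hg, D.chi_g hι hF hFH]
  have hcgm : ∀ m : ℕ, pull ι chi (g ^ m) = (-1) ^ m := fun m => by
    induction m with
    | zero => rw [pow_zero, pow_zero, (isGroupLikeElem_dual_iff.1 hcG).1]
    | succ m ih => rw [pow_succ, (isGroupLikeElem_dual_iff.1 hcG).2, ih, hcg, pow_succ]
  have hev : Even (orderOf g) := by
    have := hcgm (orderOf g)
    rw [pow_orderOf_eq_one, (isGroupLikeElem_dual_iff.1 hcG).1] at this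
    by_contra h
    rw [(Nat.not_even_iff_odd.1 h).neg_one_pow] at this
    exact one_ne_zero (α := k) (by linear_combination (2 : k)⁻¹ * this)
  have hdvd2 := orderOf_dvd_finrank hgG
  rw [hd] at hdvd2
  rcases hp2 _ hev hdvd2 with h4 | h4
  swap
  · exact Or.inl ⟨g, hgG, h4⟩
  have hgg : g * g = 1 := by rw [← pow_two, ← h4, pow_orderOf_eq_one]
  have hσg : σ g = g := by
    calc σ g = σ g * (g * g) := by rw [hgg, mul_one]
      _ = g := by rw [← mul_assoc, hgG.antipode_mul_cancel, one_mul]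
  refine Or.inr ⟨g, pull ι chi, hgG, hcG, hgg, by rw [← pull_mul, hcpow, pull_one], hcg, fun x => hι ?_⟩
  have h5 := FH.radford (ι x)
  rw [hαchi, ract_hom, lactH_hom, ← hg] at h5
  simp only [antipode_hom] at h5
  rw [F.antipode_antipode hF, F.antipode_antipode hF, hσg] at h5
  rw [h5, map_mul, map_mul]

end Index2
end reduction
end Hopf

namespace Hopf
section algebra
variable {k : Type*} [Field k] {A : Type*} [Ring A] [Algebra k A]

/-- An algebra with a nondegenerate functional killing nilpotents is semisimple. -/
theorem isSemisimpleRing_of_trace [FiniteDimensional k A] (t : A → k) (h0 : ∀ a, IsNilpotent a → t a = 0)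
    (h1 : ∀ a, (∀ b, t (a * b) = 0) → a = 0) : IsSemisimpleRing A := by
  have hart : IsArtinianRing A := IsArtinianRing.of_finite k A
  rw [IsArtinianRing.isSemisimpleRing_iff_jacobson, eq_bot_iff]
  intro a ha
  obtain ⟨n, hn⟩ := IsSemiprimaryRing.isNilpotent (R := A)
  rw [Ideal.mem_bot]
  refine h1 a fun b => h0 _ ⟨n, ?_⟩
  have hab : a * b ∈ Ring.jacobson A := Ideal.IsTwoSided.mul_mem_of_left b ha
  have h2 := Ideal.pow_mem_pow hab n
  rw [hn] at h2
  exact h2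

/-- Below every idempotent of a split semisimple algebra there is a minimal one. -/
theorem exists_minimal_idem (B : Blocks k A) {f : A} (hf : f * f = f) (hf0 : f ≠ 0) :
    ∃ e : A, e ≠ 0 ∧ e * e = e ∧ f * e = e ∧ e * f = e ∧ ∃ t : A → k, ∀ x, e * x * e = t x • e := by
  have h1 : ∃ i p q, B.E f i p q ≠ 0 := by
    by_contra! h
    exact hf0 (B.E.injective (by rw [map_zero]; funext i; ext p q; exact h i p q))
  obtain ⟨i, p, q, hc⟩ := h1
  set c := B.E f i p q with hcdef
  set m := B.E.symm (munit k B.d i q p) with hm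
  have hmx : ∀ x, m * x * m = B.E x i p q • m := fun x => by
    apply B.E.injective
    rw [map_mul, map_mul, map_smul, hm, B.E.apply_symm_apply]
    funext j
    by_cases hj : j = i
    · subst hj
      simp [munit, Matrix.single_mul_mul_single]
    · simp [munit, hj]
  have hee : ∀ x, (c⁻¹ • (f * m * f)) * x * (c⁻¹ • (f * m * f)) =
      (c⁻¹ * B.E (f * x * f) i p q) • (c⁻¹ • (f * m * f)) := fun x => by
    calc (c⁻¹ • (f * m * f)) * x * (c⁻¹ • (f * m * f)) = c⁻¹ • c⁻¹ • (f * (m * (f * x * f) * m) * f) := by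
          simp only [smul_mul_assoc, mul_smul_comm, mul_assoc]
      _ = _ := by
          rw [hmx, mul_smul_comm, smul_mul_assoc, smul_smul, smul_smul, smul_smul]
          congr 1
          ring
  refine ⟨c⁻¹ • (f * m * f), ?_, ?_, ?_, ?_, _, hee⟩
  · intro h
    have h2 : m * (c⁻¹ • (f * m * f)) * m = c • m := by
      calc m * (c⁻¹ • (f * m * f)) * m = c⁻¹ • (m * f * m * f * m) := by
            simp only [smul_mul_assoc, mul_smul_comm, mul_assoc]
        _ = c • m := by
            rw [hmx, smul_mul_assoc, smul_mul_assoc, hmx, smul_smul, ← hcdef, smul_smul,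
              inv_mul_cancel₀ hc, one_mul]
    rw [h, mul_zero, zero_mul] at h2
    have h3 := (smul_eq_zero.1 h2.symm).resolve_left hc
    have h4 := congrFun (congrArg B.E h3) i
    rw [hm, B.E.apply_symm_apply, map_zero, munit, Pi.single_eq_same] at h4
    have h5 := congrFun (congrFun h4 q) p
    simp at h5
  · have := hee 1
    rw [mul_one, mul_one, hf, ← hcdef, inv_mul_cancel₀ hc, one_smul] at this
    exact this
  · rw [mul_smul_comm, ← mul_assoc, ← mul_assoc, hf]
  · rw [smul_mul_assoc, mul_assoc, hf]

/-- The class equation for a symmetric algebra with dual bases `b` and `b'`. -/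
theorem sum_sum_dual {ι : Type*} [Fintype ι] (t : A →ₗ[k] k) (b b' : ι → A)
    (h1 : ∀ f, f = ∑ i, t (f * b' i) • b i) (h2 : ∀ f, f = ∑ i, t (b i * f) • b' i)
    (ht : ∀ x y, t (x * y) = t (y * x))
    {e : A} (hee : e * e = e) (hte : t e ≠ 0) {s : A → k} (hs : ∀ x, e * x * e = s x • e) :
    ∑ i, ∑ j, b i * b j * e * b' i * b' j = (t e)⁻¹ ^ 2 • e := by
  have hz : ∀ x y, ∑ i, b i * (x * y) * b' i = ∑ i, b i * (y * x) * b' i := fun x y => by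
    calc ∑ i, b i * (x * y) * b' i = ∑ i, ∑ j, t (b j * (y * b' i)) • (b i * x * b' j) := by
          refine Finset.sum_congr rfl fun i _ => ?_
          rw [show b i * (x * y) * b' i = b i * x * (y * b' i) by simp only [mul_assoc]]
          conv_lhs => rw [h2 (y * b' i)]
          simp only [Finset.mul_sum, mul_smul_comm]
      _ = ∑ j, b j * (y * x) * b' j := by
          rw [Finset.sum_comm]
          refine Finset.sum_congr rfl fun j _ => ?_
          rw [show b j * (y * x) * b' j = b j * y * (x * b' j) by simp only [mul_assoc]]
          conv_rhs => rw [h1 (b j * y)]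
          simp only [Finset.sum_mul, smul_mul_assoc, mul_assoc]
  have hcomm : ∀ f x, (∑ i, b i * x * b' i) * f = f * ∑ i, b i * x * b' i := fun f x => by
    calc (∑ i, b i * x * b' i) * f = ∑ i, ∑ j, t (b j * (b' i * f)) • (b i * x * b' j) := by
          rw [Finset.sum_mul]
          refine Finset.sum_congr rfl fun i _ => ?_
          rw [mul_assoc]
          conv_lhs => rw [h2 (b' i * f)]
          simp only [Finset.mul_sum, mul_smul_comm]
      _ = f * ∑ i, b i * x * b' i := by
          rw [Finset.sum_comm, Finset.mul_sum]
          refine Finset.sum_congr rfl fun j _ => ?_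
          rw [← mul_assoc, ← mul_assoc]
          conv_rhs => rw [h1 (f * b j)]
          simp only [Finset.sum_mul, smul_mul_assoc]
          refine Finset.sum_congr rfl fun i _ => ?_
          rw [ht (b j), mul_assoc, ht (b' i), mul_assoc]
  have hts : ∀ x, t (x * e) = s x * t e := fun x => by
    have h3 := map_smul t (s x) e
    rw [smul_eq_mul] at h3
    rw [← h3, ← hs, mul_assoc, ht e, mul_assoc, hee]
  have hse : ∑ j, s (b j) • b' j = (t e)⁻¹ • e := by
    conv_rhs => arg 2; rw [h2 e]
    rw [Finset.smul_sum]
    refine Finset.sum_congr rfl fun j _ => ?_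
    rw [hts, smul_smul, mul_comm, mul_assoc, mul_inv_cancel₀ hte, mul_one]
  have hse' : ∑ j, s (b j) • (e * b' j) = (t e)⁻¹ • e := by
    have := congrArg (e * ·) hse
    simpa only [Finset.mul_sum, mul_smul_comm, hee] using this
  calc ∑ i, ∑ j, b i * b j * e * b' i * b' j = ∑ j, (∑ i, b i * (b j * e) * b' i) * b' j := by
        rw [Finset.sum_comm]
        simp only [Finset.sum_mul, mul_assoc]
    _ = ∑ j, s (b j) • ((∑ i, b i * e * b' i) * b' j) := by
        refine Finset.sum_congr rfl fun j _ => ?_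
        have h3 : ∑ i, b i * (b j * e) * b' i = s (b j) • ∑ i, b i * e * b' i := by
          calc ∑ i, b i * (b j * e) * b' i = ∑ i, b i * ((b j * e) * e) * b' i := by
                simp only [mul_assoc, hee]
            _ = _ := by
                rw [hz, ← mul_assoc, hs]
                simp only [mul_smul_comm, smul_mul_assoc, Finset.smul_sum]
        rw [h3, smul_mul_assoc]
    _ = (∑ i, b i * e * b' i) * ((t e)⁻¹ • e) := by
        rw [← hse]
        simp only [Finset.mul_sum, mul_smul_comm]
    _ = (t e)⁻¹ ^ 2 • e := by
        have h4 : (∑ i, b i * e * b' i) * e = (t e)⁻¹ • e := by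
          rw [hcomm]
          conv_rhs => rw [← hse']
          rw [Finset.mul_sum]
          refine Finset.sum_congr rfl fun i _ => ?_
          rw [← mul_assoc, ← mul_assoc, hs, smul_mul_assoc]
        rw [mul_smul_comm, h4, smul_smul, pow_two]

/-- A sum over an involution which is anti-invariant at the fixed points. -/
theorem sum_involution {n : ℕ} (s : Fin n → Fin n) (hs : ∀ i, s (s i) = i) {M : Type*} [AddCommMonoid M] (f : Fin n → M)
    (hf : ∀ i, f (s i) = f i) (h0 : ∀ i, s i = i → f i = 0) :
    ∑ i, f i = 2 • ∑ i with i < s i, f i := by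
  rw [← Finset.sum_filter_add_sum_filter_not _ (fun i => i < s i), two_nsmul]
  congr 1
  have h1 : ∑ i with ¬ i < s i, f i = ∑ i with s i < i, f i := by
    refine (Finset.sum_subset (fun i hi => ?_) fun i hi hi' => h0 i ?_).symm
    · simp only [Finset.mem_filter, Finset.mem_univ, true_and] at hi ⊢
      exact not_lt.2 hi.le
    · simp only [Finset.mem_filter, Finset.mem_univ, true_and] at hi hi'
      exact le_antisymm (not_lt.1 hi) (not_lt.1 hi')
  rw [h1]
  refine Finset.sum_bij' (fun i _ => s i) (fun i _ => s i) ?_ ?_ ?_ ?_ ?_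
  · intro i hi; simp only [Finset.mem_filter, Finset.mem_univ, true_and, hs] at hi ⊢; exact hi
  · intro i hi; simp only [Finset.mem_filter, Finset.mem_univ, true_and, hs] at hi ⊢; exact hi
  · intro i _; exact hs i
  · intro i _; exact hs i
  · intro i _; exact (hf i).symm

/-- An eigenvalue of an integral operator is integral. -/
theorem isIntegral_of_eigen [CharZero k] {ι : Type*} [Fintype ι] (N : ι → ι → ℤ) (μ : k) (v : ι → k) (hv : v ≠ 0)
    (h : ∀ l, μ * v l = ∑ i, (N l i : k) * v i) : IsIntegral ℤ μ := by
  refine isIntegral_of_smul_mem_submodule (Submodule.span ℤ (Set.range v)) ?_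
    (Submodule.fg_span (Set.finite_range v)) μ fun n hn => ?_
  · intro h0
    refine hv (funext fun i => ?_)
    have : v i ∈ Submodule.span ℤ (Set.range v) := Submodule.subset_span ⟨i, rfl⟩
    rwa [h0, Submodule.mem_bot] at this
  · induction hn using Submodule.span_induction with
    | mem x hx =>
      obtain ⟨l, rfl⟩ := hx
      rw [smul_eq_mul, h]
      refine Submodule.sum_mem _ fun i _ => ?_
      rw [← zsmul_eq_mul]
      exact Submodule.smul_mem _ _ (Submodule.subset_span ⟨i, rfl⟩)
    | zero => rw [smul_zero]; exact Submodule.zero_mem _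
    | add x y _ _ hx hy => rw [smul_add]; exact Submodule.add_mem _ hx hy
    | smul a x _ hx => rw [smul_comm]; exact Submodule.smul_mem _ _ hx

theorem dvd_of_isIntegral [CharZero k] {p d : ℕ} (hd : d ≠ 0) (h : IsIntegral ℤ (((p : k) / d) ^ 2)) : d ∣ p := by
  have h1 : ((p : k) / d) ^ 2 = algebraMap ℚ k (((p : ℚ) / d) ^ 2) := by simp
  rw [h1, isIntegral_algebraMap_iff (algebraMap ℚ k).injective, IsIntegrallyClosed.isIntegral_iff] at h
  obtain ⟨z, hz⟩ := h
  have hd' : (d : ℚ) ≠ 0 := by exact_mod_cast hd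
  have h2 : (z : ℚ) * d ^ 2 = p ^ 2 := by
    rw [show (z : ℚ) = _ from hz]
    field_simp
  have h3 : (d : ℤ) ^ 2 ∣ (p : ℤ) ^ 2 := ⟨z, by rw [mul_comm]; exact_mod_cast h2.symm⟩
  have h4 := (Int.pow_dvd_pow_iff two_ne_zero).1 h3
  exact_mod_cast h4

end algebra
end Hopf

namespace Hopf
section chars
variable {k : Type*} [Field k] [CharZero k] [IsAlgClosed k] {K : Type*} [Ring K] [HopfAlgebra k K] [FiniteDimensional k K]

local notation "ε" => Coalgebra.counit (R := k)
local notation "σ" => HopfAlgebra.antipode k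

/-- The subalgebra of tracial functionals. -/
noncomputable def chrAlg (k K : Type*) [Field k] [Ring K] [HopfAlgebra k K] [FiniteDimensional k K] :
    Subalgebra k (HDual k K) where
  carrier := {f | ∀ x y, f (x * y) = f (y * x)}
  mul_mem' {f q} hf hq := fun x y => by
    rw [HDual.mul_apply, HDual.mul_apply, sw_mul x y (fun u v => f u * q v), sw_mul y x (fun u v => f u * q v), sw_comm]
    change ∀ x y, f (x * y) = f (y * x) at hf
    change ∀ x y, q (x * y) = q (y * x) at hq
    congr! 6 with a b c d
    rw [hf, hq]
  add_mem' {f q} hf hq := fun x y => by rw [HDual.add_apply, HDual.add_apply, hf, hq]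
  algebraMap_mem' r := fun x y => by
    rw [Algebra.algebraMap_eq_smul_one, HDual.smul_apply, HDual.smul_apply, HDual.one_apply, HDual.one_apply,
      Bialgebra.counit_mul, Bialgebra.counit_mul, mul_comm (Coalgebra.counit x)]

theorem antipode_mem_chrAlg {f : HDual k K} (hf : f ∈ chrAlg k K) : σ f ∈ chrAlg k K := fun x y => by
  rw [HDual.antipode_apply, HDual.antipode_apply, antipode_mul, antipode_mul, hf]

namespace Frob
variable (F : Frob k K)

theorem chr_lmul_eq_lam (hF : ε F.Lam ≠ 0) : chr (Algebra.lmul k K) = ε F.Lam • F.lam := by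
  ext x
  rw [chr_lmul_apply, ← Tr_eq_trace, HDual.smul_apply, mul_comm, ← F.trace_mul_antipode_sq]
  simp only [F.antipode_antipode hF, LinearMap.mulLeft_apply]

theorem lam_mul_comm (hF : ε F.Lam ≠ 0) (x y : K) : F.lam (x * y) = F.lam (y * x) := by
  have h := chr_mul_comm (Algebra.lmul k K) x y
  rw [F.chr_lmul_eq_lam hF] at h
  exact mul_left_cancel₀ hF h

theorem chr_lmul_mul_right (hF : ε F.Lam ≠ 0) (q : HDual k K) :
    chr (Algebra.lmul k K) * q = q 1 • chr (Algebra.lmul k K) := by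
  rw [F.chr_lmul_eq_lam hF, smul_mul_assoc, F.lam_mul, F.g_eq_one hF, smul_comm]

/-- The normalised integral is a trace on the dual. -/
theorem mul_nint_comm (hF : ε F.Lam ≠ 0) (q r : HDual k K) : (q * r) F.nint = (r * q) F.nint := by
  have hd : ε F.dual.Lam ≠ 0 := by
    rw [dual_Lam, HDual.counit_apply]
    exact F.lam_one_ne_zero_iff.2 hF
  have h := F.dual.lam_mul_comm hd q r
  rw [dual_lam, dual_lam] at h
  rw [nint, map_smul, map_smul, h]

theorem trace_mulLeft_dual (hF : ε F.Lam ≠ 0) (q : HDual k K) :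
    LinearMap.trace k (HDual k K) (LinearMap.mulLeft k q) = Module.finrank k K * q F.nint := by
  have hd : ε F.dual.Lam ≠ 0 := by
    rw [dual_Lam, HDual.counit_apply]
    exact F.lam_one_ne_zero_iff.2 hF
  have h : ∀ q : HDual k K, LinearMap.trace k (HDual k K) (LinearMap.mulLeft k q) = q F.Lam * F.lam 1 := fun q => by
    have h2 := F.dual.trace_mul_antipode_sq q
    rw [dual_lam, dual_Lam, HDual.counit_apply] at h2
    rw [← h2, ← Tr_eq_trace]
    simp only [F.dual.antipode_antipode hd, LinearMap.mulLeft_apply]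
  have h1 : LinearMap.trace k (HDual k K) (LinearMap.mulLeft k 1) = Module.finrank k K := by
    rw [LinearMap.mulLeft_one, LinearMap.trace_id, HDual.finrank_eq]
  rw [h, HDual.one_apply] at h1
  rw [h, ← h1, nint, map_smul, smul_eq_mul]
  field_simp

theorem nint_of_isNilpotent (hF : ε F.Lam ≠ 0) {q : HDual k K} (hq : IsNilpotent q) : q F.nint = 0 := by
  have h := F.trace_mulLeft_dual hF q
  have h1 : IsNilpotent (LinearMap.mulLeft k q) := by
    obtain ⟨n, hn⟩ := hq
    refine ⟨n, ?_⟩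
    rw [LinearMap.pow_mulLeft, hn, LinearMap.mulLeft_zero_eq_zero]
  rw [(LinearMap.isNilpotent_trace_of_isNilpotent h1).eq_zero] at h
  have hnt : Nontrivial K := ⟨F.Lam, 0, fun h0 => hF (by rw [h0, map_zero])⟩
  exact (_root_.mul_eq_zero.1 h.symm).resolve_left (by exact_mod_cast Module.finrank_pos.ne')

/-- The trace of an idempotent of the dual is a dimension. -/
theorem nint_of_idem (hF : ε F.Lam ≠ 0) {e : HDual k K} (he : e * e = e) :
    Module.finrank k K * e F.nint = (Module.finrank k (LinearMap.range (LinearMap.mulLeft k e)) : k) := by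
  rw [← F.trace_mulLeft_dual hF]
  have h : IsIdempotentElem (LinearMap.mulLeft k e) := by
    change _ * _ = _
    rw [Module.End.mul_eq_comp, ← LinearMap.mulLeft_mul, he]
  exact (LinearMap.IsIdempotentElem.isProj_range _ h).trace

end Frob

namespace Blocks
variable (B : Blocks k K)

/-- The central idempotent of the block `i`. -/
noncomputable def u (i : Fin B.n) : K := B.E.symm (Pi.single i 1)

theorem E_u (i : Fin B.n) : B.E (B.u i) = Pi.single i 1 := B.E.apply_symm_apply _

theorem psi_u_mul (i j : Fin B.n) (x : K) : B.psi j (B.u i * x) = if i = j then B.psi j x else 0 := by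
  rw [psi_apply, psi_apply, map_mul, E_u]
  split_ifs with h
  · subst h; simp
  · simp [Ne.symm h]

theorem psi_mem (i : Fin B.n) : B.psi i ∈ chrAlg k K := chr_mul_comm _

variable (F : Frob k K)

theorem sw_nint_of_ne {i j : Fin B.n} (h : i ≠ j) (a b : K) :
    sw k F.nint (fun x y => B.psi i (a * x) * B.psi j (σ y * b)) = 0 := by
  have h1 := integral_slide F.mul_nint (B.u i) (fun x y => B.psi i (a * x) * B.psi j (b * y))
  have h2 : ∀ y, B.psi j (b * (σ y * B.u i)) = 0 := fun y => by
    rw [← mul_assoc, B.psi_mem j, psi_u_mul, if_neg h]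
  have h3 : ∀ x, B.psi i (a * (B.u i * x)) = B.psi i (a * x) := fun x => by
    rw [B.psi_mem i, mul_assoc, psi_u_mul, if_pos rfl, B.psi_mem i]
  simp only [h2, h3, mul_zero] at h1
  rw [sw_zero] at h1
  rw [h1]
  simp only [B.psi_mem j b]

theorem sw_nint_self (hF : ε F.Lam ≠ 0) (i : Fin B.n) (a b : K) :
    sw k F.nint (fun x y => B.psi i (a * x) * B.psi i (σ y * b)) = (B.d i : k)⁻¹ * B.psi i (b * a) := by
  have h0 : (B.d i : k) ≠ 0 := by exact_mod_cast NeZero.ne (B.d i)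
  have h1 := integral_slide F.mul_nint a (fun x y => B.psi i x * B.psi i (b * y))
  have h2 : sw k F.nint (fun x y => B.psi i (a * x) * B.psi i (σ y * b)) =
      sw k F.nint (fun x y => B.psi i (1 * x) * B.psi i (σ y * (a * b))) := by
    simp only [one_mul, fun y => B.psi_mem i (σ y) b]
    rw [← h1]
    simp only [← mul_assoc, fun y => B.psi_mem i (b * σ y) a, fun y => B.psi_mem i (σ y * a) b]
  have h3 : sw k F.nint (fun x y => chr (Algebra.lmul k K) x * B.psi i (σ y * (a * b))) = B.psi i (a * b) := by
    let q : HDual k K := HDual.of (IsLinearMap.mk' (fun y => B.psi i (σ y * (a * b))) (by fun_prop))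
    have h4 := congrArg (fun t : HDual k K => t F.nint) (F.chr_lmul_mul_right hF q)
    simp only [HDual.smul_apply, F.chr_lmul_nint hF] at h4
    rw [HDual.mul_apply] at h4
    refine h4.trans ?_
    change B.psi i (σ 1 * (a * b)) * 1 = _
    rw [HopfAlgebra.antipode_one, one_mul, mul_one]
  rw [B.chr_lmul_eq] at h3
  simp only [HDual.sum_apply, HDual.smul_apply, Finset.sum_mul] at h3
  rw [sw_finsum, Finset.sum_eq_single i] at h3
  · simp only [mul_assoc] at h3
    rw [sw_map (k := k) (q := fun t : k => (B.d i : k) * t) (by fun_prop) F.nint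
      (fun x y => B.psi i x * B.psi i (σ y * (a * b)))] at h3
    rw [h2, B.psi_mem i b, ← h3]
    simp only [one_mul]
    rw [inv_mul_cancel_left₀ h0]
  · intro j _ hj
    simp only [mul_assoc]
    rw [sw_map (k := k) (q := fun t : k => (B.d j : k) * t) (by fun_prop) F.nint
      (fun x y => B.psi j x * B.psi i (σ y * (a * b)))]
    have h5 := B.sw_nint_of_ne F hj 1 (a * b)
    simp only [one_mul] at h5
    rw [h5, mul_zero]
  · simp

/-- Orthogonality of characters. -/
theorem psi_mul_antipode_psi (hF : ε F.Lam ≠ 0) (i j : Fin B.n) :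
    (B.psi i * σ (B.psi j)) F.nint = if i = j then 1 else 0 := by
  rw [HDual.mul_apply]
  simp only [HDual.antipode_apply]
  split_ifs with h
  · subst h
    have h0 : (B.d i : k) ≠ 0 := by exact_mod_cast NeZero.ne (B.d i)
    have h1 := B.sw_nint_self F hF i 1 1
    simp only [one_mul, mul_one] at h1
    rw [h1, psi_one, inv_mul_cancel₀ h0]
  · have h1 := B.sw_nint_of_ne F h 1 1
    simpa only [one_mul, mul_one] using h1

theorem eq_sum_left (hF : ε F.Lam ≠ 0) {f : HDual k K} (hf : f ∈ chrAlg k K) :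
    f = ∑ i, (f * σ (B.psi i)) F.nint • B.psi i := by
  conv_lhs => rw [B.eq_sum_psi hf]
  refine Finset.sum_congr rfl fun i _ => ?_
  congr 1
  conv_rhs => rw [B.eq_sum_psi hf]
  simp only [Finset.sum_mul, HDual.sum_apply, smul_mul_assoc, HDual.smul_apply, B.psi_mul_antipode_psi F hF]
  simp

theorem apply_P (hF : ε F.Lam ≠ 0) {f : HDual k K} (hf : f ∈ chrAlg k K) (i : Fin B.n) :
    f (B.P i) = (f * σ (B.psi i)) F.nint := by
  have h := congrArg (fun q : HDual k K => q (B.P i)) (B.eq_sum_left F hF hf)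
  simpa [HDual.sum_apply, B.psi_P] using h

theorem eq_sum_right (hF : ε F.Lam ≠ 0) {f : HDual k K} (hf : f ∈ chrAlg k K) :
    f = ∑ i, (B.psi i * f) F.nint • σ (B.psi i) := by
  have hss : ∀ q : HDual k K, σ (σ q) = q := fun q => by
    ext x
    rw [HDual.antipode_apply, HDual.antipode_apply, F.antipode_antipode hF]
  have h := congrArg (fun q : HDual k K => σ q) (B.eq_sum_left F hF (antipode_mem_chrAlg hf))
  simp only [map_sum, map_smul, hss] at h
  conv_lhs => rw [h]
  refine Finset.sum_congr rfl fun i _ => ?_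
  rw [← antipode_mul, HDual.antipode_apply, F.antipode_nint hF]

end Blocks
end chars
end Hopf

namespace Hopf

theorem exists_of_sum_sq_eq_one {ι : Type*} [Fintype ι] [DecidableEq ι] (n : ι → ℕ) (h : ∑ i, n i * n i = 1) :
    ∃ i, n i = 1 ∧ ∀ j, j ≠ i → n j = 0 := by
  obtain ⟨i, _, hi⟩ := Finset.exists_ne_zero_of_sum_ne_zero (h.trans_ne one_ne_zero)
  have h1 := Finset.add_sum_erase Finset.univ (fun i => n i * n i) (Finset.mem_univ i)
  rw [h] at h1
  have h2 : 1 ≤ n i * n i := Nat.one_le_iff_ne_zero.2 hi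
  have h3 : n i * n i = 1 := by have h1' : n i * n i + ∑ j ∈ Finset.univ.erase i, n j * n j = 1 := h1; omega
  have h4 : ∑ j ∈ Finset.univ.erase i, n j * n j = 0 := by
    have h1' : n i * n i + ∑ j ∈ Finset.univ.erase i, n j * n j = 1 := h1
    omega
  refine ⟨i, Nat.eq_one_of_mul_eq_one_right h3, fun j hj => ?_⟩
  have h5 := Finset.sum_eq_zero_iff.1 h4 j (by simp [hj])
  simpa using h5

section intchars
variable {k : Type*} [Field k] [CharZero k] [IsAlgClosed k] {K : Type*} [Ring K] [HopfAlgebra k K] [FiniteDimensional k K]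

local notation "ε" => Coalgebra.counit (R := k)
local notation "σ" => HopfAlgebra.antipode k

namespace Blocks
variable (B : Blocks k K)

theorem eq_psi_of_nat (F : Frob k K) (hF : ε F.Lam ≠ 0) {f : HDual k K} (hf : f ∈ chrAlg k K) (hn : ∀ i, ∃ n : ℕ, f (B.P i) = n)
    (h1 : (f * σ f) F.nint = 1) : ∃ i, f = B.psi i := by
  choose n hn using hn
  have h2 : (f * σ f) F.nint = ∑ i, f (B.P i) * f (B.P i) := by
    have h3 : σ f = ∑ i, f (B.P i) • σ (B.psi i) := by
      conv_lhs => rw [B.eq_sum_psi hf]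
      simp only [map_sum, map_smul]
    rw [h3, Finset.mul_sum, HDual.sum_apply]
    simp only [mul_smul_comm, HDual.smul_apply, ← B.apply_P F hF hf]
  rw [h2] at h1
  simp only [hn] at h1
  obtain ⟨i, hi, hj⟩ := exists_of_sum_sq_eq_one n (by exact_mod_cast h1)
  refine ⟨i, ?_⟩
  rw [B.eq_sum_psi hf, Finset.sum_eq_single i]
  · rw [hn, hi, Nat.cast_one, one_smul]
  · intro j _ hji
    rw [hn, hj j hji, Nat.cast_zero, zero_smul]
  · simp

theorem _root_.Hopf.mem_chrAlg_of_isGroupLikeElem {χ : HDual k K} (hχ : IsGroupLikeElem k χ) : χ ∈ chrAlg k K := fun x y => by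
  rw [(isGroupLikeElem_dual_iff.1 hχ).2, (isGroupLikeElem_dual_iff.1 hχ).2, mul_comm]

theorem exists_eq_psi (F : Frob k K) (hF : ε F.Lam ≠ 0) {χ : HDual k K} (hχ : IsGroupLikeElem k χ) : ∃ i, χ = B.psi i := by
  refine B.eq_psi_of_nat F hF (mem_chrAlg_of_isGroupLikeElem hχ) (fun i => ?_) ?_
  · have h := (isGroupLikeElem_dual_iff.1 hχ).2 (B.P i) (B.P i)
    rw [P_mul_P] at h
    have h1 : χ (B.P i) * (χ (B.P i) - 1) = 0 := by linear_combination -h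
    rcases _root_.mul_eq_zero.1 h1 with h2 | h2
    · exact ⟨0, by rw [h2, Nat.cast_zero]⟩
    · exact ⟨1, by rw [sub_eq_zero.1 h2, Nat.cast_one]⟩
  · rw [hχ.mul_antipode_cancel, HDual.one_apply, F.counit_nint hF]

theorem exists_mul_psi (F : Frob k K) (hF : ε F.Lam ≠ 0) {χ : HDual k K} (hχ : IsGroupLikeElem k χ) (i : Fin B.n) :
    ∃ j, χ * B.psi i = B.psi j := by
  refine B.eq_psi_of_nat F hF ((chrAlg k K).mul_mem (mem_chrAlg_of_isGroupLikeElem hχ) (B.psi_mem i)) (fun j => ?_) ?_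
  · rw [← apply_lactH]
    have h : B.rep i (lactH χ (B.P j)) * B.rep i (lactH χ (B.P j)) = B.rep i (lactH χ (B.P j)) := by
      rw [← map_mul, ← lactH_mul hχ, P_mul_P]
    obtain ⟨n, hn⟩ := exists_trace_idem h
    exact ⟨n, hn⟩
  · rw [antipode_mul, F.mul_nint_comm hF, mul_assoc, ← mul_assoc (σ χ), hχ.antipode_mul_cancel, one_mul,
      F.mul_nint_comm hF, B.psi_mul_antipode_psi F hF, if_pos rfl]

/-- Virtual characters. -/
def IsVirtual (f : HDual k K) : Prop := f ∈ chrAlg k K ∧ ∀ i, ∃ n : ℤ, f (B.P i) = n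

theorem isVirtual_psi (i : Fin B.n) : B.IsVirtual (B.psi i) :=
  ⟨B.psi_mem i, fun j => by
    rw [psi_P]
    exact ⟨if i = j then 1 else 0, by split_ifs <;> simp⟩⟩

theorem isVirtual_antipode_psi (i : Fin B.n) : B.IsVirtual (σ (B.psi i)) :=
  ⟨antipode_mem_chrAlg (B.psi_mem i), fun j => by
    rw [HDual.antipode_apply]
    have h : B.rep i (σ (B.P j)) * B.rep i (σ (B.P j)) = B.rep i (σ (B.P j)) := by
      rw [← map_mul, ← antipode_mul, P_mul_P]
    obtain ⟨n, hn⟩ := exists_trace_idem h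
    exact ⟨n, by rw [Int.cast_natCast]; exact hn⟩⟩

theorem IsVirtual.mul {f q : HDual k K} (hf : B.IsVirtual f) (hq : B.IsVirtual q) : B.IsVirtual (f * q) := by
  refine ⟨(chrAlg k K).mul_mem hf.1 hq.1, fun l => ?_⟩
  obtain ⟨n, hn⟩ := Classical.axiomOfChoice hf.2
  obtain ⟨m, hm⟩ := Classical.axiomOfChoice hq.2
  choose N hN _ using fun i j => B.exists_chr_P (tensorRep (B.rep i) (B.rep j)) l
  refine ⟨∑ i, ∑ j, n i * m j * N i j, ?_⟩
  rw [B.eq_sum_psi hf.1, B.eq_sum_psi hq.1, Finset.sum_mul, HDual.sum_apply]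
  push_cast
  refine Finset.sum_congr rfl fun i _ => ?_
  rw [Finset.mul_sum, HDual.sum_apply]
  refine Finset.sum_congr rfl fun j _ => ?_
  rw [smul_mul_smul_comm, HDual.smul_apply, hn, hm, ← hN, chr_tensorRep]
  rfl

/-- The class equation on the negative part of a central character of order two. -/
theorem finrank_dvd (B : Blocks k K) (F : Frob k K) (hF : ε F.Lam ≠ 0) {p : ℕ} (hp : p ≠ 0) (hd : Module.finrank k K = 2 * p)
    {c : HDual k K} (hc : IsGroupLikeElem k c) (hcc : c * c = 1) (hcomm : ∀ f ∈ chrAlg k K, c * f = f * c)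
    {e : HDual k K} (he : e ∈ chrAlg k K) (hee : e * e = e) (he0 : e ≠ 0) (hce : c * e = -e) {t : HDual k K → k}
    (ht : ∀ x ∈ chrAlg k K, e * x * e = t x • e) :
    Module.finrank k (LinearMap.range (LinearMap.mulLeft k e)) ∣ p := by
  set d := Module.finrank k (LinearMap.range (LinearMap.mulLeft k e)) with hdd
  have hdim := F.nint_of_idem hF hee
  rw [← hdd, hd] at hdim
  have hd0 : d ≠ 0 := by
    intro h
    have h1 := Submodule.finrank_eq_zero.1 (hdd.symm.trans h)
    have h2 : e ∈ LinearMap.range (LinearMap.mulLeft k e) := ⟨1, mul_one e⟩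
    rw [h1, Submodule.mem_bot] at h2
    exact he0 h2
  have hpk : (p : k) ≠ 0 := by exact_mod_cast hp
  have hdk : (d : k) ≠ 0 := by exact_mod_cast hd0
  push_cast at hdim
  have hte : e F.nint ≠ 0 := by
    intro h
    rw [h, mul_zero] at hdim
    exact hdk hdim.symm
  let τ : chrAlg k K →ₗ[k] k := (HDual.ev k F.nint) ∘ₗ (chrAlg k K).val.toLinearMap
  have hsum := sum_sum_dual (A := chrAlg k K) τ (fun i => ⟨B.psi i, B.psi_mem i⟩)
    (fun i => ⟨σ (B.psi i), antipode_mem_chrAlg (B.psi_mem i)⟩)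
    (fun f => Subtype.ext (by simpa [τ] using B.eq_sum_left F hF f.2))
    (fun f => Subtype.ext (by simpa [τ] using B.eq_sum_right F hF f.2))
    (fun x y => F.mul_nint_comm hF _ _) (e := ⟨e, he⟩) (Subtype.ext hee) hte (s := fun x => t x)
    (fun x => Subtype.ext (ht _ x.2))
  have hsum' : ∑ i, ∑ j, B.psi i * B.psi j * e * σ (B.psi i) * σ (B.psi j) = (e F.nint)⁻¹ ^ 2 • e := by
    have := congrArg Subtype.val hsum
    simpa [τ] using this
  choose s hs using B.exists_mul_psi F hF hc
  have hinj : ∀ i j, B.psi i = B.psi j → i = j := fun i j h => by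
    have h1 := congrArg (fun q : HDual k K => q (B.P j)) h
    simp only [psi_P, if_true] at h1
    by_contra h2
    rw [if_neg h2] at h1
    exact zero_ne_one h1
  have hss : ∀ i, s (s i) = i := fun i => hinj _ _ (by rw [← hs, ← hs, ← mul_assoc, hcc, one_mul])
  have hσc : σ c = c := by
    calc σ c = σ c * (c * c) := by rw [hcc, mul_one]
      _ = c := by rw [← mul_assoc, hc.antipode_mul_cancel, one_mul]
  have hs' : ∀ i, σ (B.psi (s i)) = c * σ (B.psi i) := fun i => by
    rw [← hs, antipode_mul, hσc, hcomm _ (antipode_mem_chrAlg (B.psi_mem i))]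
  have hm : ∀ i, B.psi i ∈ chrAlg k K := B.psi_mem
  have hm' : ∀ i, σ (B.psi i) ∈ chrAlg k K := fun i => antipode_mem_chrAlg (B.psi_mem i)
  have hmul : ∀ {f q}, f ∈ chrAlg k K → q ∈ chrAlg k K → f * q ∈ chrAlg k K := fun hf hq => (chrAlg k K).mul_mem hf hq
  set G := fun i j => B.psi i * B.psi j * e * σ (B.psi i) * σ (B.psi j) with hG
  have hGe : ∀ i j, B.psi (s i) * B.psi j * e = - (B.psi i * B.psi j * e) := fun i j => by
    rw [← hs, mul_assoc c, hcomm _ (hmul (hm i) (hm j)), mul_assoc, hce, mul_neg]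
  have hGe' : ∀ i j, B.psi i * B.psi (s j) * e = - (B.psi i * B.psi j * e) := fun i j => by
    rw [← hs, hcomm _ (hm j), ← mul_assoc, mul_assoc, hce, mul_neg]
  have hG1 : ∀ i j, G (s i) j = G i j := fun i j => by
    simp only [hG, hs', hGe]
    rw [neg_mul, ← mul_assoc _ c, ← hcomm _ (hmul (hmul (hm i) (hm j)) he), ← mul_assoc, ← mul_assoc,
      mul_assoc c, hcomm _ (hmul (hm i) (hm j)), mul_assoc _ c, hce]
    simp only [mul_neg, neg_mul, neg_neg]
  have hG2 : ∀ i j, G i (s j) = G i j := fun i j => by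
    simp only [hG, hs', hGe']
    rw [← mul_assoc _ c, ← hcomm _ (by simpa using hmul (hmul (hmul (hm i) (hm j)) he) (hm' i)), neg_mul, mul_neg,
      ← mul_assoc, ← mul_assoc, mul_assoc c, ← mul_assoc c, hcomm _ (hmul (hm i) (hm j)), mul_assoc _ c, hce]
    simp only [mul_neg, neg_mul, neg_neg]
  have hzero : ∀ v : HDual k K, v = -v → v = 0 := fun v hv => by
    have h2 : (2 : k) • v = 0 := by rw [two_smul]; nth_rewrite 1 [hv]; exact neg_add_cancel v
    exact (smul_eq_zero.1 h2).resolve_left two_ne_zero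
  have hG3 : ∀ i j, s i = i → G i j = 0 := fun i j hi => by
    have h := hGe i j
    rw [hi] at h
    simp only [hG]
    rw [hzero _ h, zero_mul, zero_mul]
  have hG4 : ∀ i j, s j = j → G i j = 0 := fun i j hj => by
    have h := hGe' i j
    rw [hj] at h
    simp only [hG]
    rw [hzero _ h, zero_mul, zero_mul]
  have h4 : (4 : k) • ∑ i with i < s i, ∑ j with j < s j, G i j = (e F.nint)⁻¹ ^ 2 • e := by
    rw [← hsum']
    change _ = ∑ i, ∑ j, G i j
    rw [Finset.sum_congr rfl fun i _ => sum_involution s hss (fun j => G i j) (hG2 i) (hG4 i),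
      ← Finset.smul_sum, sum_involution s hss (fun i => ∑ j with j < s j, G i j)
        (fun i => Finset.sum_congr rfl fun j _ => hG1 i j) (fun i hi => Finset.sum_eq_zero fun j _ => hG3 i j hi),
      smul_smul, ← Nat.cast_smul_eq_nsmul k]
    norm_num
  have hV : ∀ l m, ∃ n : ℤ, (∑ i with i < s i, ∑ j with j < s j,
      B.psi i * B.psi j * B.psi m * σ (B.psi i) * σ (B.psi j)) (B.P l) = n := fun l m => by
    have hv : ∀ i j, B.IsVirtual (B.psi i * B.psi j * B.psi m * σ (B.psi i) * σ (B.psi j)) := fun i j =>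
      ((((B.isVirtual_psi i).mul _ (B.isVirtual_psi j)).mul _ (B.isVirtual_psi m)).mul _
        (B.isVirtual_antipode_psi i)).mul _ (B.isVirtual_antipode_psi j)
    choose N hN using fun i j => (hv i j).2 l
    refine ⟨∑ i with i < s i, ∑ j with j < s j, N i j, ?_⟩
    push_cast
    simp only [HDual.sum_apply, hN]
  choose N hN using hV
  refine dvd_of_isIntegral (k := k) hd0 (isIntegral_of_eigen N _ (fun l => e (B.P l)) ?_ fun l => ?_)
  · intro h
    rw [B.eq_sum_psi he] at he0
    refine he0 (Finset.sum_eq_zero fun i _ => ?_)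
    rw [congrFun h i, Pi.zero_apply, zero_smul]
  · have h5 : ((p : k) / d) ^ 2 • e = ∑ i with i < s i, ∑ j with j < s j, G i j := by
      have h6 : e F.nint = d / (2 * p) := by rw [← hdim]; field_simp
      have h7 : ((p : k) / d) ^ 2 = (4 : k)⁻¹ * (e F.nint)⁻¹ ^ 2 := by
        rw [h6]; field_simp; norm_num
      rw [h7, mul_smul, ← h4, smul_smul, inv_mul_cancel₀ (by norm_num), one_smul]
    have h8 := congrArg (fun q : HDual k K => q (B.P l)) h5
    simp only [HDual.smul_apply] at h8
    rw [h8]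
    have h9 : ∑ i with i < s i, ∑ j with j < s j, G i j = ∑ m, e (B.P m) • ∑ i with i < s i, ∑ j with j < s j,
      B.psi i * B.psi j * B.psi m * σ (B.psi i) * σ (B.psi j) := by
      have h10 : ∀ i j, G i j = ∑ m, e (B.P m) • (B.psi i * B.psi j * B.psi m * σ (B.psi i) * σ (B.psi j)) := fun i j => by
        simp only [hG]
        conv_lhs => rw [B.eq_sum_psi he]
        simp only [Finset.mul_sum, Finset.sum_mul, mul_smul_comm, smul_mul_assoc]
      simp only [h10, Finset.smul_sum]
      rw [Finset.sum_congr rfl fun i _ => Finset.sum_comm, Finset.sum_comm]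
    rw [h9, HDual.sum_apply]
    refine Finset.sum_congr rfl fun m _ => ?_
    rw [HDual.smul_apply, hN, mul_comm]

end Blocks
end intchars
end Hopf

namespace Hopf

section central
variable {k : Type*} [Field k] [CharZero k] [IsAlgClosed k] {K : Type*} [Ring K] [HopfAlgebra k K] [FiniteDimensional k K]

local notation "ε" => Coalgebra.counit (R := k)
local notation "σ" => HopfAlgebra.antipode k

theorem commute_chrAlg {g : K} {c : HDual k K} (hgg : g * g = 1) (hcomm : ∀ x, ract c x = g * lactH c x * g) :
    ∀ f ∈ chrAlg k K, c * f = f * c := fun f hf => HDual.ext fun x => by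
  rw [← apply_lactH, ← apply_ract, hcomm, hf, ← mul_assoc, hgg, one_mul]

theorem Frob.isSemisimpleRing_chrAlg (F : Frob k K) (hF : ε F.Lam ≠ 0) : IsSemisimpleRing (chrAlg k K) := by
  have hfin : FiniteDimensional k (chrAlg k K) :=
    inferInstanceAs (FiniteDimensional k (Subalgebra.toSubmodule (chrAlg k K)))
  have hss : IsSemisimpleRing K := F.isSemisimpleRing hF
  obtain ⟨B⟩ := Blocks.nonempty (k := k) (K := K)
  refine isSemisimpleRing_of_trace (A := chrAlg k K) (fun f => f.1 F.nint) (fun f hf => ?_) fun f hf => ?_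
  · exact F.nint_of_isNilpotent hF (hf.map (chrAlg k K).val)
  · refine Subtype.ext ?_
    rw [B.eq_sum_left F hF f.2]
    refine Finset.sum_eq_zero fun i _ => ?_
    have h := hf ⟨σ (B.psi i), antipode_mem_chrAlg (B.psi_mem i)⟩
    have h1 : (f.1 * σ (B.psi i)) F.nint = 0 := h
    rw [h1, zero_smul]

theorem Frob.exists_minimal_idem_chrAlg (F : Frob k K) (hF : ε F.Lam ≠ 0) {f : HDual k K} (hm : f ∈ chrAlg k K)
    (hf : f * f = f) (hf0 : f ≠ 0) :
    ∃ e ∈ chrAlg k K, e ≠ 0 ∧ e * e = e ∧ f * e = e ∧ e * f = e ∧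
      ∃ t : HDual k K → k, ∀ x ∈ chrAlg k K, e * x * e = t x • e := by
  have hfin : FiniteDimensional k (chrAlg k K) :=
    inferInstanceAs (FiniteDimensional k (Subalgebra.toSubmodule (chrAlg k K)))
  have hss := F.isSemisimpleRing_chrAlg hF
  obtain ⟨n, d, hd, ⟨E⟩⟩ := IsSemisimpleRing.exists_algEquiv_pi_matrix_of_isAlgClosed k (chrAlg k K)
  obtain ⟨e, h0, h1, h2, h3, t, ht⟩ := exists_minimal_idem (A := chrAlg k K) ⟨n, d, hd, E⟩ (f := ⟨f, hm⟩) (Subtype.ext hf)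
    (fun h => hf0 (congrArg Subtype.val h))
  classical
  refine ⟨e, e.2, fun h => h0 (Subtype.ext h), congrArg Subtype.val h1, congrArg Subtype.val h2,
    congrArg Subtype.val h3, fun x => if hx : x ∈ chrAlg k K then t ⟨x, hx⟩ else 0, fun x hx => ?_⟩
  simp only [dif_pos hx]
  exact congrArg Subtype.val (ht ⟨x, hx⟩)

namespace Frob
variable (F : Frob k K)

theorem exists_central_grouplike (hF : ε F.Lam ≠ 0) {e : HDual k K} (he : e ∈ chrAlg k K)
    (h1 : Module.finrank k (LinearMap.range (LinearMap.mulLeft k e)) = 1) :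
    ∃ h : K, IsGroupLikeElem k h ∧ (∀ q, e * q = q h • e) ∧ ∀ x, h * x = x * h := by
  have hmem : e ∈ LinearMap.range (LinearMap.mulLeft k e) := ⟨1, mul_one e⟩
  have he0 : e ≠ 0 := by
    rintro rfl
    have h2 : LinearMap.range (LinearMap.mulLeft k (0 : HDual k K)) = ⊥ := by
      rw [LinearMap.mulLeft_zero_eq_zero, LinearMap.range_zero]
    rw [h2, finrank_bot] at h1
    exact zero_ne_one h1
  have hex : ∀ q, ∃ t : k, e * q = t • e := fun q => by
    obtain ⟨t, ht⟩ := exists_smul_eq_of_finrank_eq_one h1 (x := ⟨e, hmem⟩)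
      (fun h => he0 (congrArg Subtype.val h)) ⟨e * q, q, rfl⟩
    exact ⟨t, (congrArg Subtype.val ht).symm⟩
  obtain ⟨x0, hx0⟩ : ∃ x, e x ≠ 0 := by
    by_contra! h
    exact he0 (HDual.ext h)
  obtain ⟨h, hh⟩ := exists_ev (HDual.of (IsLinearMap.mk' (fun q : HDual k K => (e x0)⁻¹ * (e * q) x0)
    ⟨fun q r => by rw [mul_add, HDual.add_apply, mul_add], fun a q => by
      rw [mul_smul_comm, HDual.smul_apply, smul_eq_mul]; ring⟩))
  have hh : ∀ q : HDual k K, (e x0)⁻¹ * (e * q) x0 = q h := hh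
  have heq : ∀ q, e * q = q h • e := fun q => by
    obtain ⟨t, ht⟩ := hex q
    rw [← hh, ht, HDual.smul_apply, mul_comm t, inv_mul_cancel_left₀ hx0]
  have hg : IsGroupLikeElem k h := by
    refine isGroupLikeElem_of_apply ?_ fun q r => ?_
    · rw [← HDual.one_apply, ← hh, mul_one, inv_mul_cancel₀ hx0]
    · have h2 : (q * r) h • e = (q h * r h) • e := by
        rw [← heq, ← mul_assoc, heq, smul_mul_assoc, heq, smul_smul]
      exact smul_left_injective k he0 h2
  refine ⟨h, hg, heq, ?_⟩
  have hσσ : ∀ q : HDual k K, σ (σ q) = q := fun q => HDual.ext fun x => by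
    rw [HDual.antipode_apply, HDual.antipode_apply, F.antipode_antipode hF]
  have heq' : ∀ q, q * σ e = q (σ h) • σ e := fun q => by
    conv_lhs => rw [← hσσ q, ← antipode_mul, heq, map_smul, HDual.antipode_apply]
  let l : HDual k K := HDual.of ((σ e).toLin ∘ₗ LinearMap.mulRight k (σ h))
  have hl : ∀ r, r * l = r 1 • l := fun r => HDual.ext fun x => by
    let r' : HDual k K := HDual.of (r.toLin ∘ₗ LinearMap.mulRight k h)
    have h1 : (r * l) x = (r' * σ e) (x * σ h) := by
      rw [HDual.mul_apply, HDual.mul_apply, sw_mul (k := k) x (σ h) (fun u v => r' u * (σ e) v)]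
      refine congrArg (sw k x) (funext₂ fun u v => ?_)
      rw [sw_of_comul_eq_tmul hg.antipode.comul_eq_tmul_self (fun a b => r' (u * a) * (σ e) (v * b))]
      change r u * (σ e) (v * σ h) = r (u * σ h * h) * (σ e) (v * σ h)
      rw [mul_assoc u, hg.antipode_mul_cancel, mul_one]
    rw [h1, heq']
    change r (σ h * h) * (σ e) (x * σ h) = r 1 * (σ e) (x * σ h)
    rw [hg.antipode_mul_cancel]
  have hl' := F.eq_smul_lam hl
  set s := l F.Lam
  have hσe : ∀ x, (σ e) x = s * F.lam (x * h) := fun x => by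
    have h2 := congrArg (fun q : HDual k K => q (x * h)) hl'
    change (σ e) (x * h * σ h) = _ at h2
    rwa [mul_assoc, hg.mul_antipode_cancel, mul_one] at h2
  have hs : s ≠ 0 := fun h2 => he0 <| by
    rw [← hσσ e, show σ e = 0 from HDual.ext fun x => by rw [hσe, h2, zero_mul]; rfl, map_zero]
  intro y
  refine (sub_eq_zero.1 (F.nondeg_right fun x => ?_)).symm
  have h2 : s * F.lam (x * y * h) = s * F.lam (y * x * h) := by
    rw [← hσe, ← hσe]
    exact antipode_mem_chrAlg he x y
  have h3 := mul_left_cancel₀ hs h2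
  rw [mul_sub, map_sub, ← mul_assoc, h3, mul_assoc y, F.lam_mul_comm hF y, mul_assoc, sub_self]

theorem lam_grouplike (hF : ε F.Lam ≠ 0) {h : K} (hg : IsGroupLikeElem k h) (h1 : h ≠ 1) :
    LinearMap.trace k K (LinearMap.mulLeft k h) = 0 := by
  rw [← chr_lmul_apply, F.chr_lmul_eq_lam hF, HDual.smul_apply]
  by_contra h2
  refine h1 (eq_of_hdual (k := k) fun r => ?_)
  have h3 := congrArg (fun q : HDual k K => q h) (F.mul_lam r)
  simp only [Hopf.IsGroupLikeElem.apply_mul hg, HDual.smul_apply] at h3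
  exact mul_right_cancel₀ (right_ne_zero_of_mul h2) h3

theorem not_two_order_two (hF : ε F.Lam ≠ 0) {p : ℕ} (hodd : Odd p) (hd : Module.finrank k K = 2 * p)
    {h h' : K} (hg : IsGroupLikeElem k h) (hg' : IsGroupLikeElem k h') (hh : h * h = 1) (hh' : h' * h' = 1)
    (h1 : h ≠ 1) (h1' : h' ≠ 1) (hne : h ≠ h') (hc : h * h' = h' * h) : False := by
  have hid : ((4 : k)⁻¹ • ((1 + h) * (1 + h'))) * ((4 : k)⁻¹ • ((1 + h) * (1 + h'))) =
      (4 : k)⁻¹ • ((1 + h) * (1 + h')) := by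
    have h2 : (1 + h) * (1 + h) = (2 : k) • (1 + h) := by
      rw [two_smul, mul_add, add_mul, add_mul, hh]; simp only [one_mul, mul_one]; abel
    have h2' : (1 + h') * (1 + h') = (2 : k) • (1 + h') := by
      rw [two_smul, mul_add, add_mul, add_mul, hh']; simp only [one_mul, mul_one]; abel
    have h3 : (1 + h') * (1 + h) = (1 + h) * (1 + h') := by
      simp only [mul_add, add_mul, one_mul, mul_one, hc]; abel
    rw [smul_mul_smul_comm, mul_assoc, ← mul_assoc (1 + h'), h3, mul_assoc, h2', ← mul_assoc, h2,
      mul_smul_comm, smul_mul_assoc, smul_smul, smul_smul]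
    norm_num
  obtain ⟨n, hn⟩ := exists_trace_idem (f := LinearMap.mulLeft k ((4 : k)⁻¹ • ((1 + h) * (1 + h'))))
    (LinearMap.ext fun x => by
      rw [Module.End.mul_apply, LinearMap.mulLeft_apply, LinearMap.mulLeft_apply, ← mul_assoc, hid])
  have hne' : h * h' ≠ 1 := fun h2 => hne (by rw [← mul_one h, ← hh', ← mul_assoc, h2, one_mul])
  rw [← chr_lmul_apply] at hn
  have e1 := F.lam_grouplike hF hg h1
  have e2 := F.lam_grouplike hF hg' h1'
  have e3 := F.lam_grouplike hF (hg.mul hg') hne'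
  rw [← chr_lmul_apply] at e1 e2 e3
  have e0 := chr_one (Algebra.lmul k K)
  rw [hd] at e0
  rw [map_smul, mul_add, add_mul, add_mul, map_add, map_add, map_add, one_mul, one_mul, mul_one, e1, e2, e3, e0] at hn
  push_cast at hn
  have h5 : (2 * p : k) = 4 * n := by rw [← hn, smul_eq_mul]; field_simp; ring
  have h6 : 2 * p = 4 * n := by exact_mod_cast h5
  obtain ⟨m, hm⟩ := hodd
  omega

theorem exists_orderOf_eq_of_pair (hF : ε F.Lam ≠ 0) {p : ℕ} (hp : p.Prime) (hodd : Odd p) (hd : Module.finrank k K = 2 * p)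
    {c : HDual k K} (hc : IsGroupLikeElem k c) (hcomm : ∀ f ∈ chrAlg k K, c * f = f * c)
    {e e' : HDual k K} (he : e ∈ chrAlg k K) (he' : e' ∈ chrAlg k K) (hce : c * e = -e) (hce' : c * e' = -e')
    (hee' : e' * e' = e') (h0 : e * e' = 0)
    (h1 : Module.finrank k (LinearMap.range (LinearMap.mulLeft k e)) = 1)
    (h1' : Module.finrank k (LinearMap.range (LinearMap.mulLeft k e')) = 1) :
    ∃ a : K, IsGroupLikeElem k a ∧ orderOf a = 2 * p := by
  have hne0 : ∀ e : HDual k K, Module.finrank k (LinearMap.range (LinearMap.mulLeft k e)) = 1 → e ≠ 0 := by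
    rintro e h1 rfl
    have h2 : LinearMap.range (LinearMap.mulLeft k (0 : HDual k K)) = ⊥ := by
      rw [LinearMap.mulLeft_zero_eq_zero, LinearMap.range_zero]
    rw [h2, finrank_bot] at h1
    exact zero_ne_one h1
  have key : ∀ (e : HDual k K) (h : K), e ∈ chrAlg k K → c * e = -e → e ≠ 0 → IsGroupLikeElem k h →
      (∀ q, e * q = q h • e) → h ≠ 1 ∧ (orderOf h = 2 * p ∨ h * h = 1) := by
    intro e h hm hce hne hg hq
    have hch : c h = -1 := by
      have h2 := hq c
      rw [← hcomm e hm, hce, ← neg_one_smul k e] at h2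
      exact (smul_left_injective k hne h2).symm
    have hpow : ∀ n, c (h ^ n) = (-1) ^ n := fun n => by
      induction n with
      | zero => rw [pow_zero, pow_zero, (isGroupLikeElem_dual_iff.1 hc).1]
      | succ n ih => rw [pow_succ, (isGroupLikeElem_dual_iff.1 hc).2, ih, hch, pow_succ]
    refine ⟨fun h2 => ?_, ?_⟩
    · rw [h2, (isGroupLikeElem_dual_iff.1 hc).1] at hch
      norm_num [self_eq_neg] at hch
    have hev : Even (orderOf h) := by
      have h3 := hpow (orderOf h)
      rw [pow_orderOf_eq_one, (isGroupLikeElem_dual_iff.1 hc).1] at h3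
      by_contra h4
      rw [(Nat.not_even_iff_odd.1 h4).neg_one_pow] at h3
      norm_num [self_eq_neg] at h3
    obtain ⟨m, hm2⟩ := hev.two_dvd
    have hdvd := orderOf_dvd_finrank (k := k) hg
    rw [hd, hm2] at hdvd
    rcases (Nat.dvd_prime hp).1 (Nat.dvd_of_mul_dvd_mul_left two_pos hdvd) with h5 | h5
    · right
      rw [← pow_two, ← orderOf_dvd_iff_pow_eq_one, hm2, h5, mul_one]
    · left
      rw [hm2, h5]
  obtain ⟨h, hg, hq, hz⟩ := F.exists_central_grouplike hF he h1
  obtain ⟨h', hg', hq', hz'⟩ := F.exists_central_grouplike hF he' h1'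
  obtain ⟨hn, h2⟩ := key e h he hce (hne0 _ h1) hg hq
  obtain ⟨hn', h2'⟩ := key e' h' he' hce' (hne0 _ h1') hg' hq'
  rcases h2 with h2 | h2
  · exact ⟨h, hg, h2⟩
  rcases h2' with h2' | h2'
  · exact ⟨h', hg', h2'⟩
  refine (F.not_two_order_two hF hodd hd hg hg' h2 h2' hn hn' (fun h3 => ?_) (hz h')).elim
  have h4 := hq e'
  have h5 := hq' e'
  rw [h0, eq_comm, smul_eq_zero, or_iff_left (hne0 _ h1), h3] at h4
  rw [h4, zero_smul, hee'] at h5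
  exact hne0 _ h1' h5

end Frob
end central
end Hopf

namespace Hopf

section twist
variable {k : Type*} [Field k] [CharZero k] [IsAlgClosed k] {K : Type*} [Ring K] [HopfAlgebra k K] [FiniteDimensional k K]

local notation "ε" => Coalgebra.counit (R := k)
local notation "σ" => HopfAlgebra.antipode k

namespace Blocks
variable (B : Blocks k K)

theorem u_mul_comm (i : Fin B.n) (x : K) : B.u i * x = x * B.u i := by
  apply B.E.injective
  rw [map_mul, map_mul, E_u]
  funext l
  by_cases h : l = i
  · subst h; simp
  · simp [h]

theorem u_eq_sum (i : Fin B.n) : B.u i = ∑ p, B.E.symm (munit k B.d i p p) := by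
  rw [← map_sum, u]
  congr 1
  funext l
  by_cases h : l = i
  · subst h
    simp only [munit, Finset.sum_apply, Pi.single_eq_same]
    ext r s
    rw [Matrix.sum_apply, Finset.sum_eq_single r]
    · simp [Matrix.one_apply, Matrix.single_apply]
    · intro t _ ht
      simp [ht]
    · simp
  · simp [munit, Finset.sum_apply, h]

theorem mul_munit (i : Fin B.n) (x : K) (p q : Fin (B.d i)) :
    x * B.E.symm (munit k B.d i p q) = ∑ r, B.E x i r p • B.E.symm (munit k B.d i r q) := by
  apply B.E.injective
  simp only [map_mul, map_sum, map_smul, AlgEquiv.apply_symm_apply]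
  conv_lhs => rw [eq_sum_munit (B.E x)]
  rw [Finset.sum_mul, Finset.sum_eq_single i]
  · simp only [Finset.sum_mul, smul_mul_assoc, munit_mul_same]
    simp
  · intro l _ hl
    simp only [Finset.sum_mul, smul_mul_assoc]
    refine Finset.sum_eq_zero fun r _ => Finset.sum_eq_zero fun s _ => ?_
    rw [show munit k B.d l r s * munit k B.d i p q = 0 from ?_, smul_zero]
    funext m
    by_cases h : m = i
    · subst h; simp [munit, Ne.symm hl]
    · simp [munit, h]
  · simp

theorem munit_mul (i : Fin B.n) (x : K) (p q : Fin (B.d i)) :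
    B.E.symm (munit k B.d i p q) * x = ∑ r, B.E x i q r • B.E.symm (munit k B.d i p r) := by
  apply B.E.injective
  simp only [map_mul, map_sum, map_smul, AlgEquiv.apply_symm_apply]
  conv_lhs => rw [eq_sum_munit (B.E x)]
  rw [Finset.mul_sum, Finset.sum_eq_single i]
  · simp only [Finset.mul_sum, mul_smul_comm, munit_mul_same]
    simp
  · intro l _ hl
    simp only [Finset.mul_sum, mul_smul_comm]
    refine Finset.sum_eq_zero fun r _ => Finset.sum_eq_zero fun s _ => ?_
    rw [show munit k B.d i p q * munit k B.d l r s = 0 from ?_, smul_zero]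
    funext m
    by_cases h : m = i
    · subst h; simp [munit, Ne.symm hl]
    · simp [munit, h]
  · simp

/-- An endomorphism preserving an irreducible character is implemented by an invertible element of the block. -/
theorem exists_implement (i : Fin B.n) (τ : K →ₗ[k] K) (hτ : ∀ x y, τ (x * y) = τ x * τ y)
    (hψ : B.psi i (τ (B.P i)) ≠ 0) :
    ∃ j j' : K, j' * j = B.u i ∧ B.u i * j = j ∧ (∀ x, j * x = τ x * j) ∧ ∀ x, x * j' = j' * τ x := by
  set m := fun p q => B.E.symm (munit k B.d i p q) with hm
  obtain ⟨r, s, hy⟩ : ∃ r s, B.E (τ (B.P i)) i r s ≠ 0 := by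
    by_contra! h
    exact hψ (by rw [psi_apply, Matrix.trace]; exact Finset.sum_eq_zero fun p _ => h p p)
  have hmm : ∀ p q r s, m p q * m r s = if q = r then m p s else 0 := fun p q r s => by
    simp only [hm]
    rw [← map_mul, munit_mul_same]
    split_ifs <;> simp
  have hxm : ∀ x p q, x * m p q = ∑ r, B.E x i r p • m r q := B.mul_munit i
  have hmx : ∀ x p q, m p q * x = ∑ r, B.E x i q r • m p r := B.munit_mul i
  have hum : ∀ p q, B.u i * m p q = m p q := fun p q => by
    rw [hxm, E_u]
    simp [Matrix.one_apply]
  have hP : B.P i = m 0 0 := rfl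
  refine ⟨∑ p, τ (m p 0) * m s 0 * m 0 p, (B.E (τ (B.P i)) i r s)⁻¹ • ∑ p, m p 0 * m 0 r * τ (m 0 p), ?_, ?_, ?_, ?_⟩
  · have h1 : ∀ p q, m p 0 * m 0 r * τ (m 0 p) * (τ (m q 0) * m s 0 * m 0 q) =
        if p = q then B.E (τ (B.P i)) i r s • m p p else 0 := fun p q => by
      have h2 : m p 0 * m 0 r * τ (m 0 p) * (τ (m q 0) * m s 0 * m 0 q) =
          m p 0 * (m 0 r * τ (m 0 p * m q 0)) * (m s 0 * m 0 q) := by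
        rw [hτ]; simp only [mul_assoc]
      rw [h2, hmm]
      split_ifs with h
      · subst h
        rw [← hP, hmx (τ (B.P i)), Finset.mul_sum, Finset.sum_mul, Finset.sum_eq_single s]
        · rw [mul_smul_comm, hmm, if_pos rfl, smul_mul_assoc, hmm s, if_pos rfl, hmm, if_pos rfl]
        · intro t _ ht
          rw [mul_smul_comm, hmm, if_pos rfl, smul_mul_assoc, hmm s, if_pos rfl, hmm, if_neg ht, smul_zero]
        · simp
      · rw [map_zero, mul_zero, mul_zero, zero_mul]
    rw [smul_mul_assoc, Finset.sum_mul_sum, u_eq_sum]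
    simp only [h1, Finset.sum_ite_eq, Finset.mem_univ, if_true]
    rw [← Finset.smul_sum, smul_smul, inv_mul_cancel₀ hy, one_smul]
  · rw [Finset.mul_sum]
    refine Finset.sum_congr rfl fun p _ => ?_
    rw [← mul_assoc, ← mul_assoc, u_mul_comm, mul_assoc _ _ (m s 0), hum]
  · intro x
    rw [Finset.sum_mul, Finset.mul_sum]
    simp only [mul_assoc, hmx x, Finset.mul_sum]
    rw [Finset.sum_comm]
    refine Finset.sum_congr rfl fun q _ => ?_
    rw [← mul_assoc, ← hτ, hxm x, map_sum, Finset.sum_mul]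
    simp only [map_smul, smul_mul_assoc, mul_smul_comm]
  · intro x
    rw [mul_smul_comm, smul_mul_assoc, Finset.sum_mul, Finset.mul_sum]
    congr 1
    simp only [mul_assoc, ← hτ, hmx x]
    simp only [← mul_assoc, hxm x, map_sum, Finset.sum_mul, Finset.mul_sum, map_smul, smul_mul_assoc, mul_smul_comm]
    exact Finset.sum_comm

theorem Tr_mul_mul (a b : K) : Tr k (fun x : K => a * x * b) = ∑ i, B.psi i a * B.psi i b := by
  have h1 : Tr k (fun x : K => a * x * b) = LinearMap.trace k K (LinearMap.mulLeft k a ∘ₗ LinearMap.mulRight k b) := by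
    rw [← Tr_eq_trace]
    simp [mul_assoc]
  have h2 := trace_mul_mul (k := k) (d := B.d) (B.E a) (B.E b)
  simp only [psi_apply]
  rw [h1, ← h2, ← LinearMap.trace_conj' _ B.E.toLinearEquiv]
  congr 1
  refine LinearMap.ext fun x => ?_
  simp [LinearEquiv.conj_apply]

end Blocks
end twist
end Hopf

namespace Hopf

section twist
variable {k : Type*} [Field k] [CharZero k] [IsAlgClosed k] {K : Type*} [Ring K] [HopfAlgebra k K] [FiniteDimensional k K]

local notation "ε" => Coalgebra.counit (R := k)
local notation "σ" => HopfAlgebra.antipode k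

theorem sw_ract_left {M : Type*} [AddCommGroup M] [Module k M] (q : HDual k K) (x : K) (f : K → K → M)
    (h1 : ∀ y, IsLinearMap k (fun x => f x y) := by fun_prop)
    (h2 : ∀ x, IsLinearMap k (fun y => f x y) := by fun_prop) :
    sw k x (fun u v => f (ract q u) v) = sw k x (fun u v => f u (lactH q v)) := by
  have e1 : ∀ u v, f (ract q u) v = sw k u (fun a b => q b • f a v) := fun u v => by
    rw [ract_apply, ← sw_map (q := fun t => f t v) (h1 v)]
    simp only [(h1 v).map_smul]
  have e2 : ∀ u v, f u (lactH q v) = sw k v (fun a b => q a • f u b) := fun u v => by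
    rw [lactH_apply, ← sw_map (q := fun t => f u t) (h2 u)]
    simp only [(h2 u).map_smul]
  simp only [e1, e2]
  exact sw_assoc x (fun a b w => q b • f a w) (fun b w => by have := h1 w; fun_prop)
    (fun a w => by fun_prop) (fun a b => by have := h2 a; fun_prop)

theorem antipode_eq_self {χ : K} (h : IsGroupLikeElem k χ) (hχ : χ * χ = 1) : σ χ = χ := by
  calc σ χ = σ χ * (χ * χ) := by rw [hχ, mul_one]
    _ = χ := by rw [← mul_assoc, h.antipode_mul_cancel, one_mul]

theorem ract_antipode {c : HDual k K} (hσ : σ c = c) (x : K) : ract c (σ x) = σ (lactH c x) := by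
  rw [ract_apply, sw_antipode x (fun a b => c b • a), lactH_apply, map_sw]
  refine congrArg (sw k x) (funext₂ fun a b => ?_)
  rw [map_smul, ← HDual.antipode_apply, hσ]

theorem lactH_antipode {c : HDual k K} (hσ : σ c = c) (x : K) : lactH c (σ x) = σ (ract c x) := by
  rw [lactH_apply, sw_antipode x (fun a b => c a • b), ract_apply, map_sw]
  refine congrArg (sw k x) (funext₂ fun a b => ?_)
  rw [map_smul, ← HDual.antipode_apply, hσ]

/-- The adjoint action `A ↦ ∑ x₁ A S(x₂)`. -/
noncomputable def adj (x : K) : Module.End k K :=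
  IsLinearMap.mk' (fun A => sw k x (fun u v => u * A * σ v)) (by fun_prop)

theorem adj_apply (x A : K) : adj (k := k) x A = sw k x (fun u v => u * A * σ v) := rfl

theorem adj_mul (x y : K) : adj (k := k) (x * y) = adj x * adj y := by
  refine LinearMap.ext fun A => ?_
  rw [Module.End.mul_apply, adj_apply, adj_apply, adj_apply, sw_mul x y (fun u v => u * A * σ v)]
  refine congrArg (sw k x) (funext₂ fun u v => ?_)
  rw [← sw_map (k := k) (q := fun t => u * t * σ v) (by fun_prop)]
  refine congrArg (sw k y) (funext₂ fun a b => ?_)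
  rw [antipode_mul]
  simp only [mul_assoc]

/-- The trace of the adjoint action composed with an operator commuting with it is tracial. -/
theorem trace_mul_adj (C : Module.End k K) (hC : ∀ x, C * adj x = adj x * C) (x y : K) :
    LinearMap.trace k K (C * adj (x * y)) = LinearMap.trace k K (C * adj (y * x)) := by
  rw [adj_mul, adj_mul, ← mul_assoc, hC, mul_assoc, LinearMap.trace_mul_comm, mul_assoc]

theorem sw_ract_antipode {M : Type*} [AddCommGroup M] [Module k M] {c : HDual k K} (hc : IsGroupLikeElem k c)
    (hcc : c * c = 1) (x : K) (f : K → K → M)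
    (h1 : ∀ y, IsLinearMap k (fun x => f x y) := by fun_prop)
    (h2 : ∀ x, IsLinearMap k (fun y => f x y) := by fun_prop) :
    sw k x (fun u v => f (ract c u) (ract c (σ v))) = sw k x (fun u v => f u (σ v)) := by
  have hσ := antipode_eq_self hc hcc
  simp only [ract_antipode hσ]
  rw [sw_ract_left c x (fun u v => f u (σ (lactH c v))) (fun v => h1 _)
    (fun u => by have := h2 u; fun_prop)]
  simp only [lactH_lactH, hcc, lactH_one]

namespace Blocks

theorem not_isMinimal_twist (B : Blocks k K) (F : Frob k K) (hF : ε F.Lam ≠ 0) (hd : 2 < Module.finrank k K)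
    {g : K} {c : HDual k K} (hg : IsGroupLikeElem k g) (hc : IsGroupLikeElem k c) (hgg : g * g = 1) (hcc : c * c = 1)
    (hcg : c g = -1) (htw : ∀ x, ract c x = g * lactH c x * g) {t : HDual k K → k}
    (ht : ∀ x ∈ chrAlg k K, ((2 : k)⁻¹ • (1 - c)) * x * ((2 : k)⁻¹ • (1 - c)) = t x • ((2 : k)⁻¹ • (1 - c))) : False := by
  have hσ := antipode_eq_self hc hcc
  have hcomm := commute_chrAlg hgg htw
  have hone : IsGroupLikeElem k (1 : HDual k K) := IsGroupLikeElem.one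
  obtain ⟨i0, hi0⟩ := B.exists_eq_psi F hF hone
  obtain ⟨i1, hi1⟩ := B.exists_eq_psi F hF hc
  have h01 : i0 ≠ i1 := fun h => by
    have h1 : (1 : HDual k K) g = c g := by rw [hi0, hi1, h]
    rw [hcg, HDual.one_apply, hg.counit_eq_one] at h1
    norm_num [eq_neg_iff_add_eq_zero] at h1
  have hfix : ∀ i, i ≠ i0 → i ≠ i1 → c * B.psi i = B.psi i := fun i hne0 hne1 => by
    obtain ⟨l, hl⟩ := B.exists_mul_psi F hF hc i
    have h1 := congrArg (fun q : HDual k K => q (B.P i)) (ht _ (B.psi_mem i))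
    have h2 : ((2 : k)⁻¹ • (1 - c)) * B.psi i * ((2 : k)⁻¹ • (1 - c)) = (2 : k)⁻¹ • (B.psi i - c * B.psi i) := by
      have h3 : (1 - c) * B.psi i * (1 - c) = (2 : k) • (B.psi i - c * B.psi i) := by
        rw [sub_mul, one_mul, mul_sub, mul_one, sub_mul, mul_assoc c, ← hcomm _ (B.psi_mem i), ← mul_assoc c c, hcc,
          one_mul, two_smul]
        abel
      rw [smul_mul_assoc, smul_mul_smul_comm, h3, smul_smul]
      norm_num
    have h4 : (1 : HDual k K) (B.P i) = 0 := by rw [hi0, psi_P, if_neg hne0.symm]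
    have h5 : c (B.P i) = 0 := by rw [hi1, psi_P, if_neg hne1.symm]
    simp only [h2, HDual.smul_apply, HDual.sub_apply, h4, h5, hl, psi_P, if_true, sub_zero, mul_zero] at h1
    split_ifs at h1 with h6
    · rw [hl, h6]
    · norm_num at h1
  obtain ⟨i, hne0, hne1⟩ : ∃ i, i ≠ i0 ∧ i ≠ i1 := by
    by_contra! h
    have hd1 : ∀ i, B.d i = 1 := fun i => by
      have h1 : (B.d i : k) = 1 := by
        rw [← psi_one]
        by_cases h2 : i = i0
        · rw [h2, ← hi0]; exact (isGroupLikeElem_dual_iff.1 hone).1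
        · rw [h i h2, ← hi1]; exact (isGroupLikeElem_dual_iff.1 hc).1
      exact_mod_cast h1
    have h1 := chr_one (Algebra.lmul k K)
    rw [B.chr_lmul_eq, HDual.sum_apply] at h1
    simp only [HDual.smul_apply, psi_one, hd1, Nat.cast_one, mul_one, Finset.sum_const, nsmul_eq_mul] at h1
    have h2 : Finset.univ ⊆ ({i0, i1} : Finset (Fin B.n)) := fun i _ => by
      by_cases h3 : i = i0
      · simp [h3]
      · simp [h i h3]
    have h3 := (Finset.card_le_card h2).trans Finset.card_le_two
    have h4 : (Finset.univ : Finset (Fin B.n)).card = Module.finrank k K := by exact_mod_cast h1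
    omega
  have hfix' : B.psi i * c = B.psi i := by rw [← hcomm _ (B.psi_mem i), hfix i hne0 hne1]
  obtain ⟨j, j', hj'j, huj, hj, hj'⟩ := B.exists_implement i (ract c) (ract_mul hc)
    (by rw [apply_ract, hfix', psi_P, if_pos rfl]; exact one_ne_zero)
  let C : Module.End k K := IsLinearMap.mk' (fun A => j * A * j') (by fun_prop)
  have hCadj : ∀ x, C * adj x = adj x * C := fun x => LinearMap.ext fun A => by
    rw [Module.End.mul_apply, Module.End.mul_apply, adj_apply, adj_apply]
    change j * sw k x (fun u v => u * A * σ v) * j' = sw k x (fun u v => u * (j * A * j') * σ v)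
    rw [← sw_map (k := k) (q := fun t => j * t * j') (by fun_prop),
      ← sw_ract_antipode hc hcc x (fun u v => u * (j * A * j') * v)]
    refine congrArg (sw k x) (funext₂ fun u v => ?_)
    calc j * (u * A * σ v) * j' = (j * u) * A * (σ v * j') := by simp only [mul_assoc]
      _ = _ := by rw [hj, hj']; simp only [mul_assoc]
  let θ : HDual k K := HDual.of (IsLinearMap.mk' (fun x => sw k x (fun u v => B.psi i (j * u) * B.psi i (σ v * j')))
    (by fun_prop))
  have hθ : ∀ x, θ x = sw k x (fun u v => B.psi i (j * u) * B.psi i (σ v * j')) := fun x => rfl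
  have hθC : ∀ x, θ x = LinearMap.trace k K (C * adj x) := fun x => by
    rw [← Tr_eq_trace]
    have h1 : (fun A : K => (C * adj x : Module.End k K) A) = fun A => sw k x (fun u v => (j * u) * A * (σ v * j')) := funext fun A => by
      change j * sw k x (fun u v => u * A * σ v) * j' = _
      rw [← sw_map (k := k) (q := fun t => j * t * j') (by fun_prop)]
      simp only [mul_assoc]
    rw [h1, Tr_sw x (fun u v A => (j * u) * A * (σ v * j')), hθ]
    refine congrArg (sw k x) (funext₂ fun u v => ?_)
    rw [B.Tr_mul_mul, Finset.sum_eq_single i]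
    · intro l _ hl
      rw [← huj, mul_assoc, psi_u_mul, if_neg hl.symm, zero_mul]
    · simp
  have hθtr : ∀ x y, θ (x * y) = θ (y * x) := fun x y => by
    rw [hθC, hθC, trace_mul_adj C hCadj]
  have hτg : ract c g = -g := by rw [ract_grouplike hg, hcg, neg_one_smul]
  have hθg : θ g = 0 := by
    rw [hθ, sw_of_comul_eq_tmul hg.comul_eq_tmul_self (fun u v => B.psi i (j * u) * B.psi i (σ v * j'))]
    have h1 : B.psi i (j * g) = - B.psi i (j * g) := by
      conv_lhs => rw [hj, hτg, neg_mul, map_neg, B.psi_mem]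
    rw [self_eq_neg.1 h1, zero_mul]
  have hθτ : ∀ x, θ (ract c x) = - θ x := fun x => by
    rw [hθ, sw_ract c x (fun u v => B.psi i (j * u) * B.psi i (σ v * j')), hθ, ← neg_one_smul k, smul_sw]
    refine congrArg (sw k x) (funext₂ fun u v => ?_)
    have h1 : ∀ z, lactH c z = g * ract c z * g := fun z => by
      rw [htw]
      calc lactH c z = (g * g) * lactH c z * (g * g) := by rw [hgg, one_mul, mul_one]
        _ = _ := by simp only [mul_assoc]
    have h2 : B.psi i (σ (ract c v) * j') = - B.psi i (σ v * j') := by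
      rw [← lactH_antipode hσ, h1]
      calc B.psi i (g * ract c (σ v) * g * j') = B.psi i (g * (ract c (σ v) * (g * j'))) := by simp only [mul_assoc]
        _ = B.psi i (ract c (σ v) * (g * j') * g) := B.psi_mem i _ _
        _ = - B.psi i (ract c (σ v) * j') := by
          rw [hj', hτg, mul_neg, mul_neg, neg_mul, map_neg, mul_assoc, mul_assoc, hgg, mul_one]
        _ = - B.psi i (σ v * j') := by rw [B.psi_mem i _ j', ← hj']
    rw [h2, smul_eq_mul]
    ring
  have hθn : θ F.nint = 1 := by
    rw [hθ, B.sw_nint_self F hF, hj'j, ← mul_one (B.u i), psi_u_mul, if_pos rfl, psi_one, inv_mul_cancel₀]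
    exact_mod_cast NeZero.ne (B.d i)
  have hψ0 : ∀ l, B.psi l F.nint = if l = i0 then 1 else 0 := fun l => by
    rw [← B.psi_mul_antipode_psi F hF, ← hi0, antipode_eq_self hone (one_mul 1), mul_one]
  have hψ1 : ∀ l, B.psi l (ract c F.nint) = if l = i1 then 1 else 0 := fun l => by
    rw [← B.psi_mul_antipode_psi F hF, ← hi1, hσ, apply_ract]
  have hθs : ∀ x, θ x = ∑ l, θ (B.P l) * B.psi l x := fun x => by
    conv_lhs => rw [B.eq_sum_psi hθtr]
    rw [HDual.sum_apply]
    rfl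
  have hψg : ∀ l, B.psi l g = (if l = i0 then 1 else 0) - (if l = i1 then 1 else 0) := fun l => by
    by_cases h0 : l = i0
    · rw [if_pos h0, if_neg (h0.trans_ne h01), sub_zero, h0, ← hi0]
      exact hg.counit_eq_one
    · by_cases h1 : l = i1
      · rw [if_pos h1, if_neg h0, zero_sub, h1, ← hi1, hcg]
      · have h2 := Hopf.IsGroupLikeElem.apply_mul hg c (B.psi l)
        rw [hfix l h0 h1, hcg, neg_one_mul] at h2
        rw [if_neg h0, if_neg h1, sub_zero, self_eq_neg.1 h2]
  have h2 := hθs g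
  have h3 := hθs F.nint
  have h4 := hθs (ract c F.nint)
  rw [hθτ] at h4
  simp only [hψ0, hψ1, hψg, mul_sub, mul_ite, mul_one, mul_zero, Finset.sum_sub_distrib, Finset.sum_ite_eq',
    Finset.mem_univ, if_true, hθg, hθn] at h2 h3 h4
  rw [← h3, ← h4] at h2
  norm_num at h2

end Blocks
end twist
end Hopf

namespace Hopf

section endgame
variable {k : Type*} [Field k] [CharZero k] [IsAlgClosed k] {K : Type*} [Ring K] [HopfAlgebra k K] [FiniteDimensional k K]

local notation "ε" => Coalgebra.counit (R := k)
local notation "σ" => HopfAlgebra.antipode k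

theorem finrank_mulLeft_pos {e : HDual k K} (he0 : e ≠ 0) :
    0 < Module.finrank k (LinearMap.range (LinearMap.mulLeft k e)) := by
  refine Nat.pos_of_ne_zero fun h => he0 ?_
  have h2 : e ∈ LinearMap.range (LinearMap.mulLeft k e) := ⟨1, mul_one e⟩
  rwa [Submodule.finrank_eq_zero.1 h, Submodule.mem_bot] at h2

theorem Frob.exists_orderOf_eq_of_twist (F : Frob k K) (hF : ε F.Lam ≠ 0) {p : ℕ} (hp : p.Prime) (hodd : Odd p)
    (hd : Module.finrank k K = 2 * p) {g : K} {c : HDual k K} (hg : IsGroupLikeElem k g) (hc : IsGroupLikeElem k c)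
    (hgg : g * g = 1) (hcc : c * c = 1) (hcg : c g = -1) (htw : ∀ x, ract c x = g * lactH c x * g) :
    ∃ a : K, IsGroupLikeElem k a ∧ orderOf a = 2 * p := by
  have hss := F.isSemisimpleRing hF
  obtain ⟨B⟩ := Blocks.nonempty (k := k) (K := K)
  have hcomm := commute_chrAlg hgg htw
  have hcm : c ∈ chrAlg k K := mem_chrAlg_of_isGroupLikeElem hc
  have h2 : (2 : k) ≠ 0 := two_ne_zero
  set f : HDual k K := (2 : k)⁻¹ • (1 - c) with hfdef
  have hfm : f ∈ chrAlg k K := (chrAlg k K).smul_mem (sub_mem (one_mem _) hcm) _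
  have hcf : c * f = -f := by
    rw [hfdef, mul_smul_comm, mul_sub, mul_one, hcc, ← smul_neg, neg_sub]
  have hff : f * f = f := by
    nth_rw 1 [hfdef]
    rw [smul_mul_assoc, sub_mul, one_mul, hcf, sub_neg_eq_add, ← two_smul k f, smul_smul, inv_mul_cancel₀ h2, one_smul]
  have hcn : c F.nint = 0 := by
    have h := F.mul_nint g
    rw [hg.counit_eq_one, one_smul] at h
    have h3 := congrArg c h
    rw [(isGroupLikeElem_dual_iff.1 hc).2, hcg] at h3
    have h4 : (2 : k) * c F.nint = 0 := by linear_combination -h3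
    exact (_root_.mul_eq_zero.1 h4).resolve_left h2
  have hfn : f F.nint = 2⁻¹ := by
    rw [hfdef, HDual.smul_apply, HDual.sub_apply, hcn, HDual.one_apply, F.counit_nint hF, sub_zero, mul_one]
  have hf0 : f ≠ 0 := by
    intro h
    rw [h, HDual.zero_apply] at hfn
    exact inv_ne_zero h2 hfn.symm
  obtain ⟨e, hem, he0, hee, hfe, hef, t, ht⟩ := F.exists_minimal_idem_chrAlg hF hfm hff hf0
  have hce : c * e = -e := by rw [← hfe, ← mul_assoc, hcf, neg_mul]
  have hne : e ≠ f := by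
    rintro rfl
    exact B.not_isMinimal_twist F hF (by rw [hd]; have := hp.two_le; omega) hg hc hgg hcc hcg htw ht
  have hsm : f - e ∈ chrAlg k K := sub_mem hfm hem
  have hss' : (f - e) * (f - e) = f - e := by
    rw [sub_mul, mul_sub, mul_sub, hff, hef, hee, hfe, sub_self, sub_zero]
  obtain ⟨e', hem', he0', hee', hfe', hef', t', ht'⟩ :=
    F.exists_minimal_idem_chrAlg hF hsm hss' (sub_ne_zero.2 hne.symm)
  have h0 : e * e' = 0 := by
    rw [← hfe', ← mul_assoc, mul_sub, hef, hee, sub_self, zero_mul]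
  have h0' : e' * e = 0 := by
    rw [← hef', mul_assoc, sub_mul, hfe, hee, sub_self, mul_zero]
  have hff' : f * e' = e' := by rwa [sub_mul, h0, sub_zero] at hfe'
  have hff'' : e' * f = e' := by rwa [mul_sub, h0', sub_zero] at hef'
  have hce' : c * e' = -e' := by rw [← hff', ← mul_assoc, hcf, neg_mul]
  have hrr : (f - e - e') * (f - e - e') = f - e - e' := by
    simp only [sub_mul, mul_sub, hff, hfe, hef, hee, h0, h0', hff', hff'', hee']
    abel
  have d1 := B.finrank_dvd F hF hp.ne_zero hd hc hcc hcomm hem hee he0 hce ht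
  have d2 := B.finrank_dvd F hF hp.ne_zero hd hc hcc hcomm hem' hee' he0' hce' ht'
  have n1 := F.nint_of_idem hF hee
  have n2 := F.nint_of_idem hF hee'
  have n3 := F.nint_of_idem hF hrr
  have p1 := finrank_mulLeft_pos he0
  have p2 := finrank_mulLeft_pos he0'
  rw [HDual.sub_apply, HDual.sub_apply, mul_sub, mul_sub, n1, n2, hfn, hd] at n3
  have hle : Module.finrank k (LinearMap.range (LinearMap.mulLeft k e)) +
      Module.finrank k (LinearMap.range (LinearMap.mulLeft k e')) +
      Module.finrank k (LinearMap.range (LinearMap.mulLeft k (f - e - e'))) = p := by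
    have h5 : (p : k) = ((2 * p : ℕ) : k) * 2⁻¹ := by push_cast; field_simp
    have : ((Module.finrank k (LinearMap.range (LinearMap.mulLeft k e)) +
      Module.finrank k (LinearMap.range (LinearMap.mulLeft k e')) +
      Module.finrank k (LinearMap.range (LinearMap.mulLeft k (f - e - e'))) : ℕ) : k) = p := by
      push_cast
      rw [← n3, h5]
      ring
    exact_mod_cast this
  have one_of : ∀ d : ℕ, d ∣ p → d ≠ p → d = 1 := fun d hd hn => ((Nat.dvd_prime hp).1 hd).resolve_right hn
  exact F.exists_orderOf_eq_of_pair hF hp hodd hd hc hcomm hem hem' hce hce' hee' h0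
    (one_of _ d1 (by omega)) (one_of _ d2 (by omega))

end endgame
end Hopf

namespace Hopf

section bistable
variable {k : Type*} [Field k] {H : Type*} [Ring H] [HopfAlgebra k H] [FiniteDimensional k H]

local notation "ε" => Coalgebra.counit (R := k)
local notation "σ" => HopfAlgebra.antipode k

/-- A subspace stable under both actions of the dual, i.e. a subcoalgebra. -/
def IsBistable (C : Submodule k H) : Prop := ∀ c ∈ C, ∀ q : HDual k H, ract q c ∈ C ∧ lactH q c ∈ C

theorem eq_sum_basis {M V : Type*} [AddCommGroup M] [Module k M] [AddCommGroup V] [Module k V] [FiniteDimensional k V]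
    {f : V → M} (hf : IsLinearMap k f) (v : V) :
    f v = ∑ i, (Module.finBasis k V).coord i v • f (Module.finBasis k V i) := by
  conv_lhs => rw [← (Module.finBasis k V).sum_repr v]
  exact (map_sum (hf.mk' f) _ _).trans (Finset.sum_congr rfl fun i _ => hf.map_smul _ _)

theorem sw_eq_sum_ract {M : Type*} [AddCommGroup M] [Module k M] (a : H) (f : H → H → M)
    (h1 : ∀ y, IsLinearMap k (fun x => f x y)) (h2 : ∀ x, IsLinearMap k (fun y => f x y)) :
    sw k a f = ∑ i, f (ract (HDual.of ((Module.finBasis k H).coord i)) a) (Module.finBasis k H i) := by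
  have e1 : f = fun u v => ∑ i, f ((Module.finBasis k H).coord i v • u) (Module.finBasis k H i) :=
    funext₂ fun u v => (eq_sum_basis (h2 u) v).trans
      (Finset.sum_congr rfl fun i _ => ((h1 _).map_smul _ _).symm)
  conv_lhs => rw [e1]
  rw [sw_finsum]
  exact Finset.sum_congr rfl fun i _ => sw_map (q := fun t => f t (Module.finBasis k H i)) (h1 _) a
    (fun u v => (Module.finBasis k H).coord i v • u)

theorem sw_eq_sum_lactH {M : Type*} [AddCommGroup M] [Module k M] (a : H) (f : H → H → M)
    (h1 : ∀ y, IsLinearMap k (fun x => f x y)) (h2 : ∀ x, IsLinearMap k (fun y => f x y)) :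
    sw k a f = ∑ i, f (Module.finBasis k H i) (lactH (HDual.of ((Module.finBasis k H).coord i)) a) := by
  have e1 : f = fun u v => ∑ i, f (Module.finBasis k H i) ((Module.finBasis k H).coord i u • v) :=
    funext₂ fun u v => (eq_sum_basis (h1 v) u).trans
      (Finset.sum_congr rfl fun i _ => ((h2 _).map_smul _ _).symm)
  conv_lhs => rw [e1]
  rw [sw_finsum]
  exact Finset.sum_congr rfl fun i _ => sw_map (q := fun t => f (Module.finBasis k H i) t) (h2 _) a
    (fun u v => (Module.finBasis k H).coord i u • v)

theorem IsBistable.comul_mem {C : Submodule k H} (hC : IsBistable C) {c : H} (hc : c ∈ C) :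
    Coalgebra.comul (R := k) c ∈ LinearMap.range (TensorProduct.map C.subtype C.subtype) := by
  obtain ⟨P, hP⟩ := LinearMap.exists_leftInverse_of_injective C.subtype C.ker_subtype
  have hP' : ∀ x ∈ C, (P x : H) = x := fun x hx => congrArg Subtype.val (LinearMap.congr_fun hP ⟨x, hx⟩)
  have h : Coalgebra.comul (R := k) c = TensorProduct.map C.subtype C.subtype (sw k c (fun u v => P u ⊗ₜ[k] P v)) := by
    refine Eq.trans ?_ (map_sw (TensorProduct.map C.subtype C.subtype) c (fun u v => P u ⊗ₜ[k] P v)).symm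
    simp only [TensorProduct.map_tmul, Submodule.subtype_apply]
    rw [sw_eq_sum_ract c (fun u v => (P u : H) ⊗ₜ[k] (P v : H))
      (fun y => lin_tmul_left (C.subtype ∘ₗ P).isLinear _) (fun x => lin_tmul_right (C.subtype ∘ₗ P).isLinear _)]
    simp only [hP' _ (hC c hc _).1]
    rw [← sw_eq_sum_ract c (fun u v => u ⊗ₜ[k] (P v : H)) (fun y => by fun_prop)
      (fun x => lin_tmul_right (C.subtype ∘ₗ P).isLinear _), sw_eq_sum_lactH c (fun u v => u ⊗ₜ[k] (P v : H)) (fun y => by fun_prop)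
      (fun x => lin_tmul_right (C.subtype ∘ₗ P).isLinear _)]
    simp only [hP' _ (hC c hc _).2]
    rw [← sw_eq_sum_lactH c (fun u v => u ⊗ₜ[k] v) (fun y => by fun_prop) (fun y => by fun_prop), sw_tmul]
  exact ⟨_, h.symm⟩

theorem isBistable_iff {C : Submodule k H} : IsBistable C ↔
    ∀ c ∈ C, Coalgebra.comul (R := k) c ∈ LinearMap.range (TensorProduct.map C.subtype C.subtype) := by
  refine ⟨fun h c hc => h.comul_mem hc, fun h c hc q => ?_⟩
  obtain ⟨t, ht⟩ := h c hc
  rw [ract_apply, lactH_apply, sw_eq_bil c _ (fun _ => by fun_prop) (fun _ => by fun_prop),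
    sw_eq_bil c _ (fun _ => by fun_prop) (fun _ => by fun_prop), ← ht]
  clear ht
  induction t with
  | zero => simp
  | add s t hs ht => simp only [map_add]; exact ⟨add_mem hs.1 ht.1, add_mem hs.2 ht.2⟩
  | tmul u v => simp [bil, C.smul_mem]

theorem counit_lactH (q : HDual k H) (x : H) : ε (lactH q x) = q x := by
  have := apply_lactH q 1 x
  rwa [mul_one, HDual.one_apply] at this

theorem ract_of_isGroupLikeElem {a : H} (ha : IsGroupLikeElem k a) (q : HDual k H) : ract q a = q a • a := by
  rw [ract_apply, sw_of_comul_eq_tmul ha.comul_eq_tmul_self (fun u v => q v • u)]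

theorem lactH_of_isGroupLikeElem {a : H} (ha : IsGroupLikeElem k a) (q : HDual k H) : lactH q a = q a • a := by
  rw [lactH_apply, sw_of_comul_eq_tmul ha.comul_eq_tmul_self (fun u v => q u • v)]

theorem isBistable_span {a : H} (ha : IsGroupLikeElem k a) : IsBistable (Submodule.span k {a}) := fun c hc q => by
  obtain ⟨t, rfl⟩ := Submodule.mem_span_singleton.1 hc
  rw [map_smul, map_smul, ract_of_isGroupLikeElem ha, lactH_of_isGroupLikeElem ha]
  exact ⟨Submodule.smul_mem _ _ (Submodule.smul_mem _ _ (Submodule.mem_span_singleton_self a)),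
    Submodule.smul_mem _ _ (Submodule.smul_mem _ _ (Submodule.mem_span_singleton_self a))⟩

end bistable

section pointed
variable {k : Type*} [Field k] [CharZero k] [IsAlgClosed k] {K H : Type*} [Ring K] [HopfAlgebra k K] [FiniteDimensional k K]
  [Ring H] [HopfAlgebra k H] [FiniteDimensional k H]

/-- A minimal subcoalgebra lies in a Hopf subalgebra whose annihilator squares to zero. -/
theorem le_range_of_isMinimal {ι : K →ₐc[k] H} (hJ : ∀ q r : HDual k H, pull ι q = 0 → pull ι r = 0 → q * r = 0)
    {C : Submodule k H} (hC : IsBistable C)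
    (hmin : ∀ D : Submodule k H, IsBistable D → D ≤ C → D = ⊥ ∨ D = C) {c : H} (hc : c ∈ C) : ∃ x, ι x = c := by
  have hD : IsBistable (C ⊓ LinearMap.range ι.toLinearMap) := by
    rintro _ ⟨hx, ⟨x, rfl⟩⟩ q
    exact ⟨⟨(hC _ hx q).1, ⟨_, (ract_hom ι q x).symm⟩⟩, ⟨(hC _ hx q).2, ⟨_, (lactH_hom ι q x).symm⟩⟩⟩
  rcases hmin _ hD inf_le_left with h | h
  · refine mem_range_of_pull fun q hq => ?_
    have h1 : lactH q c ∈ C ⊓ LinearMap.range ι.toLinearMap :=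
      ⟨(hC c hc q).2, mem_range_of_pull fun r hr => by rw [apply_lactH, hJ q r hq hr, HDual.zero_apply]⟩
    rw [h, Submodule.mem_bot] at h1
    rw [← counit_lactH, h1, map_zero]
  · exact (h.ge hc).2

theorem finrank_eq_one_of_isMinimal {a : H} (ha : IsGroupLikeElem k a)
    {C : Submodule k H} (hC : IsBistable C) (h0 : C ≠ ⊥)
    (hmin : ∀ D : Submodule k H, IsBistable D → D ≤ C → D = ⊥ ∨ D = C)
    (hle : C ≤ Submodule.span k (Set.range fun i : Fin (orderOf a) => a ^ (i : ℕ))) : Module.finrank k C = 1 := by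
  obtain ⟨c, hc, hc0⟩ := C.ne_bot_iff.1 h0
  have hli := linearIndependent_pow ha
  obtain ⟨s, hs⟩ := (Submodule.mem_span_range_iff_exists_fun k).1 (hle hc)
  obtain ⟨i, hi⟩ : ∃ i, s i ≠ 0 := by
    by_contra! h
    exact hc0 (by rw [← hs]; simp [h])
  obtain ⟨q, hq⟩ := LinearMap.exists_extend ((Finsupp.lapply i) ∘ₗ hli.repr)
  have hq' : ∀ j : Fin (orderOf a), HDual.of q (a ^ (j : ℕ)) = if j = i then 1 else 0 := fun j => by
    have h1 := LinearMap.congr_fun hq ⟨a ^ (j : ℕ), Submodule.subset_span ⟨j, rfl⟩⟩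
    refine h1.trans ?_
    rw [LinearMap.comp_apply, hli.repr_eq_single j _ rfl, Finsupp.lapply_apply, Finsupp.single_apply]
  have h1 := (hC c hc (HDual.of q)).2
  rw [← hs, map_sum] at h1
  simp only [map_smul, lactH_of_isGroupLikeElem ha.pow, hq', ite_smul, one_smul, zero_smul, smul_ite, smul_zero,
    Finset.sum_ite_eq', Finset.mem_univ, if_true] at h1
  have h2 : a ^ (i : ℕ) ∈ C := by
    rw [← inv_smul_smul₀ hi (a ^ (i : ℕ))]
    exact C.smul_mem _ h1
  have hai : IsGroupLikeElem k (a ^ (i : ℕ)) := ha.pow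
  rcases hmin _ (isBistable_span hai) (by rwa [Submodule.span_singleton_le_iff_mem]) with h | h
  · rw [Submodule.span_singleton_eq_bot] at h
    exact absurd h hai.ne_zero
  · rw [← h, finrank_span_singleton hai.ne_zero]

end pointed
end Hopf

namespace Hopf

section main
variable {k : Type*} [Field k] [CharZero k] [IsAlgClosed k] {H : Type*} [Ring H] [HopfAlgebra k H] [FiniteDimensional k H]

local notation "ε" => Coalgebra.counit (R := k)
local notation "σ" => HopfAlgebra.antipode k

theorem exists_generator_of_isHopfSub {p : ℕ} (hp : p.Prime) (hodd : Odd p) (F : Frob k H) (hF : ε F.Lam = 0)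
    (hH : Module.finrank k H = 4 * p) (K : Subalgebra k H) [hK : IsHopfSub K] (hd : Module.finrank k K = 2 * p) :
    ∃ a : H, a ∈ K ∧ IsGroupLikeElem k a ∧ orderOf a = 2 * p ∧
      Subalgebra.toSubmodule K = Submodule.span k (Set.range fun i : Fin (orderOf a) => a ^ (i : ℕ)) ∧
      ∀ C : Submodule k H, IsBistable C → C ≠ ⊥ → (∀ D : Submodule k H, IsBistable D → D ≤ C → D = ⊥ ∨ D = C) →
        Module.finrank k C = 1 := by
  have hfin : FiniteDimensional k K := inferInstanceAs (FiniteDimensional k (Subalgebra.toSubmodule K))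
  have hnt : Nontrivial K := Module.nontrivial_of_finrank_pos (R := k) (by rw [hd]; have := hp.pos; omega)
  obtain ⟨FK⟩ := exists_frob k K
  have hFK := counit_Lam_ne_zero_of_two_mul_prime hp hodd hd FK
  obtain ⟨chi, f, D, hα⟩ := exists_index2 (subHom K) (subHom_injective K) FK hFK F hF (by rw [hH, hd]; ring)
  obtain ⟨a, ha, hord⟩ : ∃ a : K, IsGroupLikeElem k a ∧ orderOf a = 2 * p := by
    rcases D.exists_generator_or hα (subHom_injective K) hFK hF hp hd with h | ⟨g, c, hg, hc, hgg, hcc, hcg, htw⟩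
    · exact h
    · exact FK.exists_orderOf_eq_of_twist hFK hp hodd hd hg hc hgg hcc hcg htw
  have ha' : IsGroupLikeElem k (a : H) := ha.map (subHom K)
  have hord' : orderOf (a : H) = 2 * p := by
    rw [← hord]
    exact orderOf_injective (K.val : K →* H) Subtype.val_injective a
  have hspan : Subalgebra.toSubmodule K =
      Submodule.span k (Set.range fun i : Fin (orderOf (a : H)) => (a : H) ^ (i : ℕ)) := by
    rw [← span_pow_eq ha']
    have hle : Subalgebra.toSubmodule (Algebra.adjoin k {(a : H)}) ≤ Subalgebra.toSubmodule K :=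
      Algebra.adjoin_le (Set.singleton_subset_iff.2 a.2)
    refine (Submodule.eq_of_le_of_finrank_eq hle ?_).symm
    exact (finrank_adjoin ha').trans (hord'.trans hd.symm)
  refine ⟨a, a.2, ha', hord', hspan, fun C hC h0 hmin => finrank_eq_one_of_isMinimal ha' hC h0 hmin fun c hc => ?_⟩
  rw [← hspan]
  obtain ⟨x, rfl⟩ := le_range_of_isMinimal (ι := subHom K) (fun q r => D.mul_eq_zero) hC hmin hc
  exact x.2

/-- The annihilator of a Hopf ideal. -/
noncomputable def annihilator (I : Submodule k H) (h1 : ∀ x ∈ I, ε x = 0)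
    (h2 : ∀ x ∈ I, ∀ q r : HDual k H, (∀ y ∈ I, q y = 0) → (∀ y ∈ I, r y = 0) → (q * r) x = 0) :
    Subalgebra k (HDual k H) where
  carrier := {q | ∀ x ∈ I, q x = 0}
  mul_mem' {q r} hq hr := fun x hx => h2 x hx q r hq hr
  add_mem' {q r} hq hr := fun x hx => by rw [HDual.add_apply, hq x hx, hr x hx, add_zero]
  algebraMap_mem' t := fun x hx => by
    rw [Algebra.algebraMap_eq_smul_one, HDual.smul_apply, HDual.one_apply, h1 x hx, mul_zero]

theorem mul_apply_eq_zero {I : Submodule k H} {q r : HDual k H} (hq : ∀ y ∈ I, q y = 0) (hr : ∀ y ∈ I, r y = 0) {x : H}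
    (hx : Coalgebra.comul (R := k) x ∈ LinearMap.range (TensorProduct.map I.subtype (LinearMap.id : H →ₗ[k] H)) ⊔
          LinearMap.range (TensorProduct.map (LinearMap.id : H →ₗ[k] H) I.subtype)) : (q * r) x = 0 := by
  rw [HDual.mul_apply, sw_eq_bil x _ (fun _ => by fun_prop) (fun _ => by fun_prop)]
  generalize Coalgebra.comul (R := k) x = s at hx
  obtain ⟨_, ⟨t, rfl⟩, _, ⟨t', rfl⟩, rfl⟩ := Submodule.mem_sup.1 hx
  rw [map_add]
  have e1 : ∀ t, bil (fun u v => q u * r v) (fun _ => by fun_prop) (fun _ => by fun_prop)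
      (TensorProduct.map I.subtype (LinearMap.id : H →ₗ[k] H) t) = 0 := fun t => by
    induction t with
    | zero => simp
    | add a b ha hb => rw [map_add, map_add, ha, hb, add_zero]
    | tmul a b => simp [bil, hq a a.2]
  have e2 : ∀ t, bil (fun u v => q u * r v) (fun _ => by fun_prop) (fun _ => by fun_prop)
      (TensorProduct.map (LinearMap.id : H →ₗ[k] H) I.subtype t) = 0 := fun t => by
    induction t with
    | zero => simp
    | add a b ha hb => rw [map_add, map_add, ha, hb, add_zero]
    | tmul a b => simp [bil, hr b b.2]
  rw [e1, e2, add_zero]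

theorem lactH_ev (φ : HDual k (HDual k H)) {x : H} (hx : ∀ q, φ q = q x) (q : HDual k H) (y : H) :
    lactH φ q y = q (x * y) := by
  rw [lactH_apply]
  simp only [hx]
  rw [HDual.sw_ev_left, HDual.lact_apply]

theorem ract_ev (φ : HDual k (HDual k H)) {x : H} (hx : ∀ q, φ q = q x) (q : HDual k H) (y : H) :
    ract φ q y = q (y * x) := by
  rw [ract_apply]
  simp only [hx]
  rw [← HDual.sw_ev_ev]
  refine (map_sw (HDual.ev k y) q (fun q1 q2 => q2 x • q1)).trans ?_
  exact congrArg (sw k q) (funext₂ fun u v => mul_comm _ _)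

theorem isBistable_hdual_iff {C : Submodule k (HDual k H)} :
    IsBistable C ↔ ∀ f ∈ C, ∀ x, HDual.of (f.toLin ∘ₗ LinearMap.mulLeft k x) ∈ C ∧
      HDual.of (f.toLin ∘ₗ LinearMap.mulRight k x) ∈ C := by
  constructor
  · intro h f hf x
    have h1 := h f hf (HDual.of (HDual.ev k x))
    have e1 : ract (HDual.of (HDual.ev k x)) f = HDual.of (f.toLin ∘ₗ LinearMap.mulRight k x) :=
      HDual.ext fun y => ract_ev _ (fun _ => rfl) f y
    have e2 : lactH (HDual.of (HDual.ev k x)) f = HDual.of (f.toLin ∘ₗ LinearMap.mulLeft k x) :=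
      HDual.ext fun y => lactH_ev _ (fun _ => rfl) f y
    rw [e1, e2] at h1
    exact h1.symm
  · intro h f hf φ
    obtain ⟨x, hx⟩ := exists_ev φ
    have e1 : ract φ f = HDual.of (f.toLin ∘ₗ LinearMap.mulRight k x) :=
      HDual.ext fun y => ract_ev _ hx f y
    have e2 : lactH φ f = HDual.of (f.toLin ∘ₗ LinearMap.mulLeft k x) :=
      HDual.ext fun y => lactH_ev _ hx f y
    rw [e1, e2]
    exact (h f hf x).symm

theorem finrank_annihilator (I : Submodule k H) (h1 : ∀ x ∈ I, ε x = 0)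
    (h2 : ∀ x ∈ I, ∀ q r : HDual k H, (∀ y ∈ I, q y = 0) → (∀ y ∈ I, r y = 0) → (q * r) x = 0) :
    Module.finrank k I + Module.finrank k (annihilator I h1 h2) = Module.finrank k H := by
  have h : Subalgebra.toSubmodule (annihilator I h1 h2) = (I.dualAnnihilator : Submodule k (Module.Dual k H)) := by
    ext φ
    exact (Submodule.mem_dualAnnihilator φ).symm
  have h3 := Subspace.finrank_add_finrank_dualAnnihilator_eq I
  rw [← h] at h3
  exact h3

theorem isHopfSub_annihilator (I : Submodule k H) (h1 : ∀ x ∈ I, ε x = 0)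
    (h2 : ∀ x ∈ I, ∀ q r : HDual k H, (∀ y ∈ I, q y = 0) → (∀ y ∈ I, r y = 0) → (q * r) x = 0)
    (h3 : ∀ a ∈ I, ∀ x : H, x * a ∈ I ∧ a * x ∈ I) (h4 : ∀ a ∈ I, σ a ∈ I) : IsHopfSub (annihilator I h1 h2) where
  comul_mem := isBistable_iff (C := Subalgebra.toSubmodule (annihilator I h1 h2)) |>.1 (isBistable_hdual_iff.2 fun f hf x =>
    ⟨fun y hy => hf _ (h3 y hy x).1, fun y hy => hf _ (h3 y hy x).2⟩)
  antipode_mem q hq := fun x hx => by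
    rw [HDual.antipode_apply]
    exact hq _ (h4 x hx)

end main
end Hopf

namespace Hopf

section transfer
variable {k H : Type} [Field k] [CharZero k] [IsAlgClosed k] [Ring H] [HopfAlgebra k H] [FiniteDimensional k H]

theorem IsBistable.exists_sum {C : Submodule k (HDual k H)} (h : IsBistable C) {f : HDual k H} (hf : f ∈ C) :
    ∃ (n : ℕ) (u v : Fin n → HDual k H), (∀ i, u i ∈ C ∧ v i ∈ C) ∧ ∀ a b : H, f (a * b) = ∑ i, u i a * v i b := by
  obtain ⟨t, ht⟩ := h.comul_mem hf
  obtain ⟨S, hS⟩ := TensorProduct.exists_finset t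
  refine ⟨S.card, fun i => (S.equivFin.symm i).1.1, fun i => (S.equivFin.symm i).1.2,
    fun i => ⟨(S.equivFin.symm i).1.1.2, (S.equivFin.symm i).1.2.2⟩, fun a b => ?_⟩
  rw [← HDual.lact_apply, ← HDual.tensorHom_comul, ← ht, hS, map_sum, map_sum, LinearMap.sum_apply, HDual.sum_apply,
    Equiv.sum_comp S.equivFin.symm (fun s => (s.1.1 : HDual k H) a * (s.1.2 : HDual k H) b), ← Finset.sum_coe_sort S]
  refine Finset.sum_congr rfl fun s _ => ?_
  rw [TensorProduct.map_tmul, HDual.tensorHom_tmul, HDual.smul_apply]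
  rfl

theorem isSubcoalgebraOf_iff {C : Submodule k H} :
    IsSubcoalgebraOf (Coalgebra.comul (R := k) (A := H)) C ↔ IsBistable C := isBistable_iff.symm

theorem isDualSubcoalgebraOf_iff {C : Submodule k (HDual k H)} :
    IsDualSubcoalgebraOf (LinearMap.mul k H) C ↔ IsBistable C := by
  constructor
  · refine fun h => isBistable_hdual_iff.2 fun f hf x => ?_
    obtain ⟨n, u, v, huv, hfm⟩ := h f hf
    refine ⟨?_, ?_⟩
    · have e : HDual.of (f.toLin ∘ₗ LinearMap.mulLeft k x) = ∑ i, HDual.toLin (u i) x • HDual.of (v i) :=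
        HDual.ext fun y => by
          rw [HDual.sum_apply]
          exact hfm x y
      rw [e]
      exact C.sum_mem fun i _ => C.smul_mem _ (huv i).2
    · have e : HDual.of (f.toLin ∘ₗ LinearMap.mulRight k x) = ∑ i, HDual.toLin (v i) x • HDual.of (u i) :=
        HDual.ext fun y => by
          rw [HDual.sum_apply]
          exact (hfm y x).trans (Finset.sum_congr rfl fun i _ => mul_comm _ _)
      rw [e]
      exact C.sum_mem fun i _ => C.smul_mem _ (huv i).1
  · intro h f hf
    exact h.exists_sum hf

theorem convMul_eq (q r : HDual k H) : convMul q.toLin r.toLin = (q * r).toLin := by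
  refine LinearMap.ext fun x => ?_
  change _ = (q * r) x
  rw [HDual.mul_apply, sw_eq_bil x _ (fun _ => by fun_prop) (fun _ => by fun_prop)]
  change LinearMap.mul' k k (TensorProduct.map q.toLin r.toLin (Coalgebra.comul x)) = _
  generalize (Coalgebra.comul (R := k) x) = t
  induction t with
  | zero => simp
  | add a b ha hb => simp only [map_add, ha, hb]
  | tmul a b => simp [bil]

theorem convPow_eq (q : HDual k H) (n : ℕ) : convPow q.toLin n = (q ^ n).toLin := by
  induction n with
  | zero => rw [pow_zero]; rfl
  | succ n ih => rw [convPow, ih, convMul_eq, pow_succ]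

end transfer
end Hopf

/-- let `H` be a non-semisimple Hopf algebra of dimension `4p`, `p` an odd prime,
over an algebraically closed field of characteristic zero.
(i) If `H` has a Hopf subalgebra `K` of dimension `2p`, then `H` is pointed and `K` is the
group algebra of a cyclic group of order `2p` (it has a basis of group-likes `aⁿ` for a
group-like `a` of order `2p`).
(ii) If `H` has a Hopf ideal `I` of dimension `2p`, then `H*` is pointed and `H/I` is
isomorphic to the group algebra of a cyclic group of order `2p`; the latter is expressed by
saying that the functionals on `H` vanishing on `I` (that is, `(H/I)*`) are spanned by the
convolution powers of a single algebra character `φ` of convolution order `2p`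
vanishing on `I`. -/
theorem nonsemisimple_dim_4p_hopf_subalgebra_and_hopf_ideal_dim_2p
    (k : Type) [Field k] [IsAlgClosed k] [CharZero k]
    (p : ℕ) (hp : p.Prime) (hodd : Odd p)
    (H : Type) [Ring H] [HopfAlgebra k H]
    (hdim : Module.finrank k H = 4 * p)
    (hns : ¬ IsSemisimpleRing H) :
    (∀ K : Subalgebra k H,
      IsSubcoalgebraOf (Coalgebra.comul (R := k) (A := H)) (Subalgebra.toSubmodule K) →
      (∀ a ∈ K, HopfAlgebra.antipode (R := k) a ∈ K) →
      Module.finrank k K = 2 * p →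
      (IsPointedOf (Coalgebra.comul (R := k) (A := H)) ∧
        ∃ a : H, a ∈ K ∧ IsGroupLikeOf (Coalgebra.comul (R := k) (A := H)) a ∧
          a ^ (2 * p) = 1 ∧ (∀ m : ℕ, 0 < m → m < 2 * p → a ^ m ≠ 1) ∧
          Subalgebra.toSubmodule K = Submodule.span k {x : H | ∃ n : ℕ, x = a ^ n})) ∧
    (∀ I : Submodule k H,
      (∀ a ∈ I, ∀ x : H, x * a ∈ I ∧ a * x ∈ I) →
      (∀ a ∈ I, Coalgebra.counit (R := k) a = 0) →
      (∀ a ∈ I, HopfAlgebra.antipode (R := k) a ∈ I) →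
      (∀ a ∈ I, Coalgebra.comul (R := k) a ∈
        LinearMap.range (TensorProduct.map I.subtype (LinearMap.id : H →ₗ[k] H)) ⊔
          LinearMap.range (TensorProduct.map (LinearMap.id : H →ₗ[k] H) I.subtype)) →
      Module.finrank k I = 2 * p →
      (IsDualPointedOf (LinearMap.mul k H) ∧
        ∃ φ : Module.Dual k H, IsDualGroupLikeOf (LinearMap.mul k H) 1 φ ∧
          (∀ j : ℕ, j < 2 * p → ∀ a ∈ I, convPow φ j a = 0) ∧
          (∀ i j : ℕ, i < 2 * p → j < 2 * p → convPow φ i = convPow φ j → i = j) ∧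
          convPow φ (2 * p) = Coalgebra.counit ∧
          Submodule.span k {ψ : Module.Dual k H | ∃ j : ℕ, j < 2 * p ∧ ψ = convPow φ j} =
            I.dualAnnihilator)) := by
  have hp0 := hp.pos
  have hfin : FiniteDimensional k H := Module.finite_of_finrank_pos (by omega)
  have hnt : Nontrivial H := Module.nontrivial_of_finrank_pos (R := k) (by omega)
  obtain ⟨F⟩ := Hopf.exists_frob k H
  have hF : Coalgebra.counit (R := k) F.Lam = 0 := by
    by_contra h
    exact hns (F.isSemisimpleRing h)
  refine ⟨fun K hK hσ hd => ?_, fun I h1 h2 h3 h4 hd => ?_⟩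
  · have hsub : Hopf.IsHopfSub K := ⟨hK, hσ⟩
    obtain ⟨a, haK, ha, hord, hspan, hpt⟩ := Hopf.exists_generator_of_isHopfSub hp hodd F hF hdim K hd
    refine ⟨fun C hC => hpt C (Hopf.isSubcoalgebraOf_iff.1 hC.1) hC.2.1
        fun D hD hle => hC.2.2 D (Hopf.isSubcoalgebraOf_iff.2 hD) hle,
      a, haK, ⟨ha.ne_zero, ha.comul_eq_tmul_self⟩, by rw [← hord, pow_orderOf_eq_one],
      fun m hm0 hm h => ?_, ?_⟩
    · exact pow_ne_one_of_lt_orderOf hm0.ne' (by rwa [hord]) h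
    · refine le_antisymm (hspan.le.trans (Submodule.span_mono ?_)) (Submodule.span_le.2 ?_)
      · rintro _ ⟨i, rfl⟩
        exact ⟨i, rfl⟩
      · rintro _ ⟨n, rfl⟩
        exact K.pow_mem haK n
  · have h5 : ∀ x ∈ I, ∀ q r : Hopf.HDual k H, (∀ y ∈ I, q y = 0) → (∀ y ∈ I, r y = 0) → (q * r) x = 0 :=
      fun x hx q r hq hr => Hopf.mul_apply_eq_zero hq hr (h4 x hx)
    have hsub := Hopf.isHopfSub_annihilator I h2 h5 h1 h3
    have hfr := Hopf.finrank_annihilator I h2 h5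
    have hF' : Coalgebra.counit (R := k) F.dual.Lam = 0 := by
      rw [Hopf.Frob.dual_Lam, Hopf.HDual.counit_apply]
      by_contra h
      exact F.lam_one_ne_zero_iff.1 h hF
    obtain ⟨a, haK, ha, hord, hspan, hpt⟩ := Hopf.exists_generator_of_isHopfSub hp hodd F.dual hF'
      (Hopf.HDual.finrank_eq.trans hdim) (Hopf.annihilator I h2 h5) (by omega)
    have hchi := Hopf.isGroupLikeElem_dual_iff.1 ha
    refine ⟨fun C hC => hpt C (Hopf.isDualSubcoalgebraOf_iff.1 hC.1) hC.2.1
        fun D hD hle => hC.2.2 D (Hopf.isDualSubcoalgebraOf_iff.2 hD) hle,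
      a.toLin, ⟨hchi.1, hchi.2⟩, fun j _ x hx => ?_, fun i j hi hj hij => ?_, ?_, ?_⟩
    · rw [Hopf.convPow_eq]
      exact (Hopf.annihilator I h2 h5).pow_mem haK j x hx
    · rw [Hopf.convPow_eq, Hopf.convPow_eq] at hij
      rw [← hord] at hi hj
      exact pow_injOn_Iio_orderOf hi hj hij
    · rw [Hopf.convPow_eq, ← hord, pow_orderOf_eq_one]
      rfl
    · have e1 : {ψ : Module.Dual k H | ∃ j : ℕ, j < 2 * p ∧ ψ = convPow a.toLin j} =
          Set.range fun i : Fin (orderOf a) => (a ^ (i : ℕ)).toLin := by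
        ext ψ
        simp only [Hopf.convPow_eq]
        exact ⟨fun ⟨j, hj, h⟩ => ⟨⟨j, by rwa [hord]⟩, h.symm⟩, fun ⟨i, h⟩ => ⟨i, by rw [← hord]; exact i.2, h.symm⟩⟩
      rw [e1]
      refine Eq.trans hspan.symm ?_
      ext φ
      exact (Submodule.mem_dualAnnihilator φ).symm
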